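/- (Log-concavity example.) Let K and L be nonempty compact convex sets in ℝⁿ and let 1 ≤ j ≤ n−1. Then MV(K^{(j−1)}, L^{(n−j+1)}) · MV(K^{(j+1)}, L^{(n−j−1)}) ≤ MV(K^{(j)}, L^{(n−j)})². In particular, if all these mixed volumes are positive, the sequence b_j := log MV(K^{(j)}, L^{(n−j)}), j = 0, …, n, satisfies b_{j−1} + b_{j+1} ≤ 2 b_j, i.e., it is concave. -/

import Mathlib

section FrozenDefs
open scoped Pointwise
open MeasureTheory Finset

/-- Lebesgue volume of a subset of ℝⁿ, as a real number. -/
noncomputable def vol {n : ℕ} (A : Set (Fin n → ℝ)) : ℝ := (volume A).toReal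

/-- The mixed volume of `n` convex bodies in ℝⁿ, defined by the inclusion–exclusion
formula. -/
noncomputable def MV (n : ℕ) (K : Fin n → Set (Fin n → ℝ)) : ℝ :=
  ∑ j ∈ Finset.Icc 1 n, (-1 : ℝ) ^ (n - j) *
    ∑ S ∈ Finset.univ.powersetCard j, vol (∑ i ∈ S, K i)

/-- The mixed volume `MV(K^{(m)}, L^{(n−m)})` of `K` taken `m` times and `L` taken
`n − m` times. -/
noncomputable def mvKL (n : ℕ) (K L : Set (Fin n → ℝ)) (m : ℕ) : ℝ :=
  MV n (fun j => if (j : ℕ) < m then K else L)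
end FrozenDefs

set_option linter.unusedSectionVars false
set_option linter.unusedSimpArgs false
set_option linter.unusedVariables false

section PartP1
open MvPolynomial

section PolyD
variable {ι : Type} [Fintype ι] [DecidableEq ι]

/-- directional derivative of a polynomial -/
noncomputable def dD (v : ι → ℝ) (p : MvPolynomial ι ℝ) : MvPolynomial ι ℝ :=
  ∑ i, v i • pderiv i p

lemma dD_add_left (v w : ι → ℝ) (p : MvPolynomial ι ℝ) : dD (v + w) p = dD v p + dD w p := by
  simp [dD, add_smul, Finset.sum_add_distrib]

lemma dD_smul_left (a : ℝ) (v : ι → ℝ) (p : MvPolynomial ι ℝ) : dD (a • v) p = a • dD v p := by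
  simp [dD, Finset.smul_sum, smul_smul]

lemma dD_add (v : ι → ℝ) (p q : MvPolynomial ι ℝ) : dD v (p + q) = dD v p + dD v q := by
  simp [dD, Finset.sum_add_distrib]

lemma dD_smul (v : ι → ℝ) (a : ℝ) (p : MvPolynomial ι ℝ) : dD v (a • p) = a • dD v p := by
  simp only [dD, Derivation.map_smul, Finset.smul_sum]
  exact Finset.sum_congr rfl fun i _ => smul_comm _ _ _

lemma dD_zero (v : ι → ℝ) : dD v 0 = 0 := by simp [dD]

lemma dD_zero_left (p : MvPolynomial ι ℝ) : dD 0 p = 0 := by simp [dD]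

lemma dD_single (i : ι) (p : MvPolynomial ι ℝ) : dD (Pi.single i 1) p = pderiv i p := by
  classical
  unfold dD
  rw [Finset.sum_eq_single i]
  · simp
  · intro j _ hj; simp [hj]
  · simp

lemma dD_mul (v : ι → ℝ) (p q : MvPolynomial ι ℝ) : dD v (p * q) = dD v p * q + p * dD v q := by
  simp only [dD, Finset.sum_mul, Finset.mul_sum, ← Finset.sum_add_distrib]
  refine Finset.sum_congr rfl fun i _ => ?_
  rw [pderiv_mul, smul_add, smul_mul_assoc, mul_smul_comm]

lemma dD_X (v : ι → ℝ) (i : ι) : dD v (X i : MvPolynomial ι ℝ) = C (v i) := by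
  classical
  unfold dD
  rw [Finset.sum_eq_single i]
  · simp [MvPolynomial.smul_eq_C_mul]
  · intro j _ hj
    rw [pderiv_X_of_ne (Ne.symm hj), smul_zero]
  · simp

lemma dD_C (v : ι → ℝ) (a : ℝ) : dD v (C a : MvPolynomial ι ℝ) = 0 := by
  simp [dD]

lemma pderiv_comm' (i j : ι) (p : MvPolynomial ι ℝ) :
    pderiv i (pderiv j p) = pderiv j (pderiv i p) := by
  induction p using MvPolynomial.induction_on with
  | C a => simp
  | add p q hp hq => simp [hp, hq]
  | mul_X p k hp =>
    simp only [pderiv_mul, map_add, hp, pderiv_X]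
    have h1 : pderiv i (Pi.single (M := fun _ => MvPolynomial ι ℝ) j 1 k) = 0 := by
      by_cases h : k = j
      · subst h; simp
      · simp [Pi.single_eq_of_ne h]
    have h2 : pderiv j (Pi.single (M := fun _ => MvPolynomial ι ℝ) i 1 k) = 0 := by
      by_cases h : k = i
      · subst h; simp
      · simp [Pi.single_eq_of_ne h]
    rw [h1, h2]; ring

lemma dD_comm (v w : ι → ℝ) (p : MvPolynomial ι ℝ) : dD v (dD w p) = dD w (dD v p) := by
  simp only [dD, map_sum, Finset.smul_sum]
  rw [Finset.sum_comm]
  refine Finset.sum_congr rfl fun i _ => Finset.sum_congr rfl fun j _ => ?_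
  rw [Derivation.map_smul, Derivation.map_smul, pderiv_comm', smul_comm]

lemma dD_hom (v : ι → ℝ) {p : MvPolynomial ι ℝ} {n : ℕ} (hp : p.IsHomogeneous n) :
    (dD v p).IsHomogeneous (n - 1) := by
  unfold dD
  refine IsHomogeneous.sum _ _ _ fun i _ => ?_
  rw [MvPolynomial.smul_eq_C_mul]
  exact (hp.pderiv).C_mul _

lemma dD_deriv (v x : ι → ℝ) (p : MvPolynomial ι ℝ) (t : ℝ) :
    HasDerivAt (fun s : ℝ => eval (x + s • v) p) (eval (x + t • v) (dD v p)) t := by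
  induction p using MvPolynomial.induction_on with
  | C a => simpa [dD_C] using hasDerivAt_const t a
  | add p q hp hq =>
    simp only [dD_add, map_add]
    exact hp.add hq
  | mul_X p k hp =>
    have h : HasDerivAt (fun s : ℝ => x k + s * v k) (v k) t := by
      simpa using ((hasDerivAt_id t).mul_const (v k)).const_add (x k)
    have := hp.mul h
    simp only [dD_mul, dD_X, map_mul, map_add, eval_X, eval_C, Pi.add_apply, Pi.smul_apply,
      smul_eq_mul]
    exact this

instance dD_lc : LeftCommutative (dD : (ι → ℝ) → MvPolynomial ι ℝ → MvPolynomial ι ℝ) :=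
  ⟨dD_comm⟩

/-- iterated derivative along a multiset -/
noncomputable def mD (s : Multiset (ι → ℝ)) (p : MvPolynomial ι ℝ) : MvPolynomial ι ℝ :=
  s.foldr dD p

@[simp] lemma mD_zero (p : MvPolynomial ι ℝ) : mD 0 p = p := rfl
lemma mD_cons (v : ι → ℝ) (s : Multiset (ι → ℝ)) (p : MvPolynomial ι ℝ) :
    mD (v ::ₘ s) p = dD v (mD s p) := Multiset.foldr_cons _ _ _ _
lemma mD_add (s t : Multiset (ι → ℝ)) (p : MvPolynomial ι ℝ) : mD (s + t) p = mD s (mD t p) := by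
  induction s using Multiset.induction_on with
  | empty => simp
  | cons a s ih => rw [Multiset.cons_add, mD_cons, mD_cons, ih]
lemma mD_dD (v : ι → ℝ) (s : Multiset (ι → ℝ)) (p : MvPolynomial ι ℝ) :
    mD s (dD v p) = dD v (mD s p) := by
  induction s using Multiset.induction_on with
  | empty => simp
  | cons a s ih => rw [mD_cons, mD_cons, ih, dD_comm]
lemma mD_poly_zero (s : Multiset (ι → ℝ)) : mD s (0 : MvPolynomial ι ℝ) = 0 := by
  induction s using Multiset.induction_on with
  | empty => rfl
  | cons a s ih => rw [mD_cons, ih, dD_zero]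
lemma mD_hom (s : Multiset (ι → ℝ)) {p : MvPolynomial ι ℝ} {n : ℕ} (hp : p.IsHomogeneous n) :
    (mD s p).IsHomogeneous (n - s.card) := by
  induction s using Multiset.induction_on with
  | empty => simpa
  | cons a s ih =>
    rw [mD_cons, Multiset.card_cons, ← Nat.sub_sub]
    exact dD_hom _ ih

lemma eval_hom_smul {p : MvPolynomial ι ℝ} {n : ℕ} (hp : p.IsHomogeneous n) (t : ℝ) (x : ι → ℝ) :
    eval (t • x) p = t ^ n * eval x p := by
  rw [eval_eq', eval_eq', Finset.mul_sum]
  refine Finset.sum_congr rfl fun d hd => ?_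
  have h1 : ∑ i, d i = n := by
    have := hp (mem_support_iff.1 hd)
    rw [← this, Finsupp.weight_apply, Finsupp.sum_fintype _ _ (by simp)]
    simp
  simp only [Pi.smul_apply, smul_eq_mul, mul_pow, Finset.prod_mul_distrib]
  rw [Finset.prod_pow_eq_pow_sum, h1]
  ring

lemma eval_hom_zero {p : MvPolynomial ι ℝ} (hp : p.IsHomogeneous 0) (x y : ι → ℝ) :
    eval x p = eval y p := by
  have h1 := eval_hom_smul hp 0 x
  have h2 := eval_hom_smul hp 0 y
  simp at h1 h2
  rw [← h1, ← h2]

lemma euler {p : MvPolynomial ι ℝ} {n : ℕ} (hp : p.IsHomogeneous n) (x : ι → ℝ) :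
    eval x (dD x p) = n * eval x p := by
  have h1 := dD_deriv x x p 0
  have h2 : HasDerivAt (fun s : ℝ => (1 + s) ^ n * eval x p) ((n : ℝ) * eval x p) 0 := by
    have := (((hasDerivAt_id (0 : ℝ)).const_add 1).pow n).mul_const (eval x p)
    simpa using this
  have : (fun s : ℝ => eval (x + s • x) p) = fun s : ℝ => (1 + s) ^ n * eval x p := by
    ext s
    rw [← eval_hom_smul hp]; congr 1
    rw [add_smul, one_smul]
  rw [this] at h1
  simpa using h1.unique h2

lemma mD_replicate {p : MvPolynomial ι ℝ} {n k : ℕ} (hp : p.IsHomogeneous n) (hk : k ≤ n) (x : ι → ℝ) :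
    eval x (mD (Multiset.replicate k x) p) = (n.descFactorial k : ℝ) * eval x p := by
  induction k with
  | zero => simp
  | succ k ih =>
    rw [Multiset.replicate_succ, mD_cons, euler (mD_hom _ hp), ih (by omega), Multiset.card_replicate,
      Nat.descFactorial_succ]
    push_cast; ring

lemma poly_zero_of_open {p : MvPolynomial ι ℝ} {U : Set (ι → ℝ)} (hU : IsOpen U) (hne : U.Nonempty)
    (h : ∀ x ∈ U, eval x p = 0) : p = 0 := by
  obtain ⟨x, hx⟩ := hne
  obtain ⟨r, hr, hb⟩ := Metric.isOpen_iff.1 hU x hx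
  refine MvPolynomial.funext_set (fun i => Set.Ioo (x i - r) (x i + r))
    (fun i => Set.Ioo_infinite (by linarith)) fun y hy => ?_
  rw [map_zero]
  apply h; apply hb
  rw [Metric.mem_ball, dist_pi_lt_iff hr]
  intro i
  have := hy i trivial
  rw [Real.dist_eq, abs_lt]; constructor <;> linarith [this.1, this.2]

/-- iterated mean value theorem -/
lemma mvt_iter {κ : Type} [DecidableEq κ] (T : Finset κ) (v : κ → ι → ℝ) :
    ∀ (p : MvPolynomial ι ℝ) (x : ι → ℝ), ∃ θ : κ → ℝ, (∀ k, θ k ∈ Set.Icc (0:ℝ) 1) ∧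
      ∑ S ∈ T.powerset, (-1 : ℝ) ^ (S.card + T.card) * eval (x + ∑ k ∈ S, v k) p =
      eval (x + ∑ k ∈ T, θ k • v k) (mD (T.val.map v) p) := by
  induction T using Finset.induction_on with
  | empty => intro p x; exact ⟨0, by simp⟩
  | insert a T ha ih =>
    intro p x
    have hd : ∀ t : ℝ, HasDerivAt (fun t : ℝ => ∑ S ∈ T.powerset, (-1 : ℝ) ^ (S.card + T.card) *
        eval (x + t • v a + ∑ k ∈ S, v k) p) (∑ S ∈ T.powerset, (-1 : ℝ) ^ (S.card + T.card) *
        eval (x + t • v a + ∑ k ∈ S, v k) (dD (v a) p)) t := by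
      intro t
      refine HasDerivAt.fun_sum fun S _ => ?_
      have := dD_deriv (v a) (x + ∑ k ∈ S, v k) p t
      simp only [add_right_comm x _ (∑ k ∈ S, v k)]
      exact this.const_mul _
    obtain ⟨t, ht, hm⟩ := exists_hasDerivAt_eq_slope _ _ (zero_lt_one)
      (fun t _ => (hd t).continuousAt.continuousWithinAt) (fun t _ => hd t)
    obtain ⟨θ, hθ, h⟩ := ih (dD (v a) p) (x + t • v a)
    refine ⟨Function.update θ a t, ?_, ?_⟩
    · intro k
      by_cases hk : k = a
      · subst hk; simp [ht.1.le, ht.2.le]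
      · simp [hk, hθ k]
    · rw [Finset.sum_insert ha, Finset.insert_val_of_notMem ha, Multiset.map_cons, mD_cons, ← mD_dD]
      have e1 : ∑ k ∈ T, Function.update θ a t k • v k = ∑ k ∈ T, θ k • v k := by
        refine Finset.sum_congr rfl fun k hk => ?_
        rw [Function.update_of_ne]; rintro rfl; exact ha hk
      rw [e1, Function.update_self, ← add_assoc, ← h, hm, Finset.sum_powerset_insert ha]
      simp only [sub_zero, div_one, one_smul, zero_smul, add_zero]
      rw [add_comm, sub_eq_add_neg, ← Finset.sum_neg_distrib]
      congr 1
      · refine Finset.sum_congr rfl fun S hS => ?_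
        have : a ∉ S := fun h => ha (Finset.mem_powerset.1 hS h)
        rw [Finset.card_insert_of_notMem this, Finset.card_insert_of_notMem ha, Finset.sum_insert this,
          ← add_assoc]
        have e3 : S.card + 1 + T.card + 1 = S.card + T.card + 2 := by ring
        rw [e3, pow_add, ← add_assoc]; norm_num
      · refine Finset.sum_congr rfl fun S hS => ?_
        rw [Finset.card_insert_of_notMem ha, ← add_assoc, pow_succ]
        ring

end PolyD
end PartP1

section PartP2
open MvPolynomial

section Core
variable {ι : Type} [Fintype ι] [DecidableEq ι]

lemma symm_spectral {V : Type} [NormedAddCommGroup V] [InnerProductSpace ℝ V] [FiniteDimensional ℝ V]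
    (A : V →ₗ[ℝ] V) (hA : A.IsSymmetric) (u : V)
    (h1 : ∀ x, inner ℝ (A x) x ≤ inner ℝ x x) (h2 : ∀ x, inner ℝ (A x) x ≤ inner ℝ (A x) (A x))
    (h3 : ∀ x, A x = x → inner ℝ x x = (1:ℝ) → ∃ a : ℝ, x = a • u) (x : V)
    (hx : inner ℝ x u = (0:ℝ)) : inner ℝ (A x) x ≤ (0:ℝ) := by
  set b := hA.eigenvectorBasis rfl with hb
  have hAb : ∀ i, A (b i) = (hA.eigenvalues rfl i) • b i := fun i => hA.apply_eigenvectorBasis rfl i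
  rw [← b.sum_inner_mul_inner]
  refine Finset.sum_nonpos fun i _ => ?_
  rw [hA, hAb, inner_smul_right, real_inner_comm x (b i)]
  set l := hA.eigenvalues rfl i
  have hbi : inner ℝ (b i) (b i) = (1:ℝ) := by
    rw [real_inner_self_eq_norm_sq, b.norm_eq_one]; norm_num
  have e1 := h1 (b i)
  have e2 := h2 (b i)
  simp only [hAb, inner_smul_left, inner_smul_right, hbi, conj_trivial, mul_one] at e1 e2
  by_cases hl : l = 1
  · obtain ⟨a, ha⟩ := h3 (b i) (by rw [hAb]; change l • _ = _; rw [hl, one_smul]) hbi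
    rw [ha, inner_smul_right, hx]; simp
  · have : l ≤ 0 := by
      by_contra hc
      push Not at hc
      have : l < 1 := lt_of_le_of_ne e1 hl
      nlinarith
    nlinarith [mul_self_nonneg (inner ℝ x (b i) : ℝ)]

noncomputable def eT (T : Finset ι) : Multiset (ι → ℝ) := T.val.map (fun i => Pi.single i 1)

noncomputable def fT (p : MvPolynomial ι ℝ) (T : Finset ι) : MvPolynomial ι ℝ := mD (eT T) p

noncomputable def Ph (p : MvPolynomial ι ℝ) (T : Finset ι) (s : Multiset (ι → ℝ)) : ℝ :=
  eval 0 (mD s (fT p T))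

structure CoreHyp (n : ℕ) (p : MvPolynomial ι ℝ) (C : Set (ι → ℝ)) (Lin : Submodule ℝ (ι → ℝ)) :
    Prop where
  hom : p.IsHomogeneous n
  op : IsOpen C
  lin : ∀ l ∈ Lin, dD l p = 0
  pos : ∀ T : Finset ι, fT p T = 0 ∨ ∀ c ∈ C, 0 < eval c (fT p T)
  rep : ∀ T : Finset ι, fT p T ≠ 0 → ∀ c ∈ C, ∃ a : ι → ℝ, (∀ i ∉ T, 0 < a i) ∧ (∀ i ∈ T, a i = 0) ∧
    c - a ∈ Lin
  lc : ∀ T : Finset ι, ∀ c v, c + v ∈ C → c - v ∈ C → c ∈ C →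
    eval (c + v) (fT p T) * eval (c - v) (fT p T) ≤ eval c (fT p T) ^ 2

lemma fT_insert (p : MvPolynomial ι ℝ) {T : Finset ι} {i : ι} (hi : i ∉ T) :
    fT p (insert i T) = dD (Pi.single i 1) (fT p T) := by
  unfold fT eT
  rw [Finset.insert_val_of_notMem hi, Multiset.map_cons, mD_cons]

lemma fT_hom {n : ℕ} {p : MvPolynomial ι ℝ} (hp : p.IsHomogeneous n) (T : Finset ι) :
    (fT p T).IsHomogeneous (n - T.card) := by
  have := mD_hom (eT T) hp
  unfold fT
  simpa [eT] using this

lemma dD_expand (a : ι → ℝ) (q : MvPolynomial ι ℝ) :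
    dD a q = ∑ i, a i • dD (Pi.single i 1) q := by
  simp only [dD_single]; rfl

lemma Ph_single (p : MvPolynomial ι ℝ) {T : Finset ι} {i : ι} (hi : i ∉ T) (s : Multiset (ι → ℝ)) :
    Ph p T (Pi.single i 1 ::ₘ s) = Ph p (insert i T) s := by
  unfold Ph; rw [fT_insert p hi, mD_dD, mD_cons]

lemma Ph_expand (p : MvPolynomial ι ℝ) {T : Finset ι} (a : ι → ℝ) (ha : ∀ i ∈ T, a i = 0)
    (s : Multiset (ι → ℝ)) :
    Ph p T (a ::ₘ s) = ∑ i ∈ Tᶜ, a i * Ph p (insert i T) s := by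
  have h1 : Ph p T (a ::ₘ s) = ∑ i, a i * Ph p T (Pi.single i 1 ::ₘ s) := by
    unfold Ph
    rw [mD_cons, dD_expand, map_sum]
    refine Finset.sum_congr rfl fun i _ => ?_
    rw [smul_eval, mD_cons]
  rw [h1, ← Finset.sum_compl_add_sum T, Finset.sum_eq_zero (s := T) (fun i hi => by rw [ha i hi, zero_mul]), add_zero]
  exact Finset.sum_congr rfl fun i hi => by rw [Ph_single p (by simpa using hi)]

lemma Ph_add (p : MvPolynomial ι ℝ) (T : Finset ι) (a b : ι → ℝ) (s : Multiset (ι → ℝ)) :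
    Ph p T ((a + b) ::ₘ s) = Ph p T (a ::ₘ s) + Ph p T (b ::ₘ s) := by
  unfold Ph; simp only [mD_cons, dD_add_left, map_add]
lemma Ph_smul (p : MvPolynomial ι ℝ) (T : Finset ι) (t : ℝ) (b : ι → ℝ) (s : Multiset (ι → ℝ)) :
    Ph p T ((t • b) ::ₘ s) = t * Ph p T (b ::ₘ s) := by
  unfold Ph; simp only [mD_cons, dD_smul_left, smul_eval]

/-- the bilinear form -/
noncomputable def PhB (p : MvPolynomial ι ℝ) (T : Finset ι) (s : Multiset (ι → ℝ)) :
    LinearMap.BilinForm ℝ (ι → ℝ) :=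
  LinearMap.mk₂ ℝ (fun a b => Ph p T (a ::ₘ b ::ₘ s))
    (fun a a' b => Ph_add _ _ _ _ _) (fun t a b => Ph_smul _ _ _ _ _)
    (fun a b b' => by rw [Multiset.cons_swap, Ph_add, Multiset.cons_swap b, Multiset.cons_swap b'])
    (fun t a b => by rw [Multiset.cons_swap, Ph_smul, Multiset.cons_swap b]; rfl)

lemma PhB_apply (p : MvPolynomial ι ℝ) (T : Finset ι) (s : Multiset (ι → ℝ)) (a b : ι → ℝ) :
    PhB p T s a b = Ph p T (a ::ₘ b ::ₘ s) := rfl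

lemma PhB_comm (p : MvPolynomial ι ℝ) (T : Finset ι) (s : Multiset (ι → ℝ)) (a b : ι → ℝ) :
    PhB p T s a b = PhB p T s b a := by
  rw [PhB_apply, PhB_apply, Multiset.cons_swap]

lemma rcs (B : LinearMap.BilinForm ℝ (ι → ℝ)) (hB : ∀ a b, B a b = B b a) (c : ι → ℝ) (hc : 0 < B c c)
    (h : ∀ x, B x c = 0 → B x x ≤ 0) (x : ι → ℝ) : B x x * B c c ≤ B x c ^ 2 := by
  have h1 := h (B c c • x - B x c • c) (by simp; ring)
  simp only [map_sub, map_smul, LinearMap.sub_apply, LinearMap.smul_apply, smul_eq_mul, hB c x] at h1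
  have : B c c * (B x x * B c c - B x c ^ 2) ≤ 0 := by nlinarith
  nlinarith [nonpos_of_mul_nonpos_right this hc]

lemma Ph_zero (p : MvPolynomial ι ℝ) {T : Finset ι} (h : fT p T = 0) (s : Multiset (ι → ℝ)) :
    Ph p T s = 0 := by
  unfold Ph; rw [h, mD_poly_zero, map_zero]

variable {n : ℕ} {p : MvPolynomial ι ℝ} {C : Set (ι → ℝ)} {Lin : Submodule ℝ (ι → ℝ)}

lemma CoreHyp.phlin (H : CoreHyp n p C Lin) (T : Finset ι) {l : ι → ℝ} (hl : l ∈ Lin)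
    (s : Multiset (ι → ℝ)) : Ph p T (l ::ₘ s) = 0 := by
  unfold Ph
  rw [mD_cons, ← mD_dD]
  unfold fT
  rw [← mD_dD, H.lin l hl, mD_poly_zero, mD_poly_zero, map_zero]

lemma CoreHyp.phcongr (H : CoreHyp n p C Lin) (T : Finset ι) {a c : ι → ℝ} (h : c - a ∈ Lin)
    (s : Multiset (ι → ℝ)) : Ph p T (c ::ₘ s) = Ph p T (a ::ₘ s) := by
  have : c = (c - a) + a := by abel
  rw [this, Ph_add, H.phlin T h, zero_add]

lemma CoreHyp.phpos (H : CoreHyp n p C Lin) : ∀ (k : ℕ) (T : Finset ι) (s : Multiset (ι → ℝ)),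
    s.card = k → T.card + k = n → (∀ c ∈ s, c ∈ C) → C.Nonempty → fT p T ≠ 0 → 0 < Ph p T s := by
  intro k
  induction k with
  | zero =>
    intro T s hs hT hsC hC hf
    rw [Multiset.card_eq_zero] at hs
    subst hs
    obtain ⟨c, hc⟩ := hC
    have h0 := fT_hom H.hom T
    rw [show n - T.card = 0 by omega] at h0
    unfold Ph
    rw [mD_zero, eval_hom_zero h0 0 c]
    exact ((H.pos T).resolve_left hf) c hc
  | succ k ih =>
    intro T s hs hT hsC hC hf
    obtain ⟨c, hcs⟩ := Multiset.card_pos_iff_exists_mem.1 (by omega : 0 < s.card)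
    obtain ⟨s, rfl⟩ := Multiset.exists_cons_of_mem hcs
    simp only [Multiset.card_cons, add_left_inj] at hs
    have hcC : c ∈ C := hsC c (by simp)
    have hsC' : ∀ c ∈ s, c ∈ C := fun x hx => hsC x (by simp [hx])
    obtain ⟨a, ha1, ha2, ha3⟩ := H.rep T hf c hcC
    rw [H.phcongr T ha3, Ph_expand p a ha2]
    have hcard : ∀ i ∈ Tᶜ, (insert i T).card + k = n := fun i hi => by
      rw [Finset.card_insert_of_notMem (by simpa using hi)]; omega
    apply Finset.sum_pos'
    · intro i hi
      refine mul_nonneg (ha1 i (by simpa using hi)).le ?_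
      by_cases hz : fT p (insert i T) = 0
      · rw [Ph_zero p hz]
      · exact (ih _ s hs (hcard i hi) hsC' hC hz).le
    · by_contra hcon
      push Not at hcon
      have hz : ∀ i ∈ Tᶜ, fT p (insert i T) = 0 := by
        intro i hi
        by_contra hz
        exact absurd (mul_pos (ha1 i (by simpa using hi)) (ih _ s hs (hcard i hi) hsC' hC hz)) (not_lt.2 (hcon i hi))
      have hd : dD c (fT p T) = 0 := by
        have : c = (c - a) + a := by abel
        rw [this, dD_add_left]
        have h1 : dD (c - a) (fT p T) = 0 := by
          unfold fT; rw [← mD_dD, H.lin _ ha3, mD_poly_zero]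
        rw [h1, zero_add, dD_expand]
        refine Finset.sum_eq_zero fun i _ => ?_
        by_cases hi : i ∈ T
        · rw [ha2 i hi, zero_smul]
        · rw [← fT_insert p hi, hz i (by simpa using hi), smul_zero]
      have he := euler (fT_hom H.hom T) c
      rw [hd, map_zero] at he
      have := ((H.pos T).resolve_left hf) c hcC
      have h2 : (0:ℝ) < ((n - T.card : ℕ) : ℝ) := by
        have : 0 < n - T.card := by omega
        exact_mod_cast this
      nlinarith [mul_pos h2 this]

lemma CoreHyp.bm (H : CoreHyp n p C Lin) (k : ℕ) (T : Finset ι) (hT : T.card + k + 2 = n)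
    (hf : fT p T ≠ 0) (c : ι → ℝ) (hc : c ∈ C) (h : ι → ℝ)
    (h0 : PhB p T (Multiset.replicate k c) h c = 0) : PhB p T (Multiset.replicate k c) h h ≤ 0 := by
  set f := fT p T with hfdef
  have hfh := fT_hom H.hom T
  rw [show n - T.card = k + 2 by omega, ← hfdef] at hfh
  have hd1 : (dD h f).IsHomogeneous (k+1) := dD_hom h hfh
  have hd2 : (dD h (dD h f)).IsHomogeneous k := dD_hom h hd1
  have e1 : PhB p T (Multiset.replicate k c) h c = ((k+1).factorial : ℝ) * eval c (dD h f) := by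
    rw [PhB_apply, ← Multiset.replicate_succ]
    unfold Ph
    have h3 := mD_hom (Multiset.replicate (k+1) c) hd1
    rw [Multiset.card_replicate, Nat.sub_self] at h3
    rw [mD_cons, ← mD_dD, ← hfdef, eval_hom_zero h3 0 c, mD_replicate hd1 le_rfl, Nat.descFactorial_self]
  have e2 : PhB p T (Multiset.replicate k c) h h = (k.factorial : ℝ) * eval c (dD h (dD h f)) := by
    rw [PhB_apply]
    unfold Ph
    have h3 := mD_hom (Multiset.replicate k c) hd2
    rw [Multiset.card_replicate, Nat.sub_self] at h3
    rw [mD_cons, mD_cons, ← mD_dD, ← mD_dD, ← hfdef, eval_hom_zero h3 0 c, mD_replicate hd2 le_rfl, Nat.descFactorial_self]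
  have hf1 : (0:ℝ) < ((k+1).factorial : ℝ) := by exact_mod_cast Nat.factorial_pos _
  have hf2 : (0:ℝ) < ((k).factorial : ℝ) := by exact_mod_cast Nat.factorial_pos _
  have z1 : eval c (dD h f) = 0 := by
    rw [e1] at h0
    exact (mul_eq_zero.1 h0).resolve_left hf1.ne'
  rw [e2]
  by_contra hcon
  push Not at hcon
  have z2 : 0 < eval c (dD h (dD h f)) := (mul_pos_iff_of_pos_left hf2).1 hcon
  have z0 : 0 < eval c f := ((H.pos T).resolve_left hf) c hc
  set ψ : ℝ → ℝ := fun t => eval (c + t • h) f * eval (c + t • (-h)) f with hψ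
  have hneg : ∀ q, dD (-h) q = - dD h q := fun q => by
    have := dD_smul_left (-1) h q
    simpa using this
  have hψ' : ∀ t, HasDerivAt ψ (eval (c + t • h) (dD h f) * eval (c + t • (-h)) f +
      eval (c + t • h) f * eval (c + t • (-h)) (- dD h f)) t := by
    intro t
    have := (dD_deriv h c f t).mul (dD_deriv (-h) c f t)
    rw [hneg] at this
    exact this
  have hder : deriv ψ = fun t => eval (c + t • h) (dD h f) * eval (c + t • (-h)) f +
      eval (c + t • h) f * eval (c + t • (-h)) (- dD h f) := funext fun t => (hψ' t).deriv
  have hψ'' : HasDerivAt (deriv ψ) (2 * eval c (dD h (dD h f)) * eval c f) 0 := by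
    rw [hder]
    have := ((dD_deriv h c (dD h f) 0).mul (dD_deriv (-h) c f 0)).add
      ((dD_deriv h c f 0).mul (dD_deriv (-h) c (- dD h f) 0))
    simp only [hneg, zero_smul, add_zero, map_neg, z1] at this
    have e : dD h (-dD h f) = - dD h (dD h f) := by
      have := dD_smul h (-1) (dD h f)
      simpa using this
    simp only [e, map_neg] at this
    simp only [map_neg]
    refine HasDerivAt.congr_deriv this ?_
    ring
  have hmin : IsLocalMin ψ 0 := by
    apply isLocalMin_of_deriv_deriv_pos
    · rw [hψ''.deriv]; positivity
    · rw [hder]; simp [z1]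
    · exact (hψ' 0).continuousAt
  have hmax : IsLocalMax ψ 0 := by
    have c1 : Filter.Tendsto (fun t : ℝ => c + t • h) (nhds 0) (nhds c) := by
      have : Continuous (fun t : ℝ => c + t • h) := by fun_prop
      simpa using this.tendsto 0
    have c2 : Filter.Tendsto (fun t : ℝ => c - t • h) (nhds 0) (nhds c) := by
      have : Continuous (fun t : ℝ => c - t • h) := by fun_prop
      simpa using this.tendsto 0
    filter_upwards [c1 (H.op.mem_nhds hc), c2 (H.op.mem_nhds hc)] with t h1 h2
    have := H.lc T c (t • h) h1 h2 hc
    simp only [hψ, zero_smul, add_zero, smul_neg, ← sub_eq_add_neg]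
    rw [sub_zero, ← sq]; exact this
  have hconst : ψ =ᶠ[nhds 0] fun _ => ψ 0 := by
    filter_upwards [hmin, hmax] with t h1 h2 using le_antisymm h2 h1
  have := hconst.deriv.deriv_eq
  rw [hψ''.deriv] at this
  simp at this
  rcases this with h | h <;> linarith

end Core
end PartP2

section PartP3
open MvPolynomial

lemma lor_alg {α : Type} [Fintype α] [DecidableEq α] (M : α → α → ℝ) (a q : α → ℝ)
    (hs : ∀ i j, M i j = M j i) (hn : ∀ i j, i ≠ j → 0 ≤ M i j) (ha : ∀ i, 0 < a i) (hq0 : ∀ i, 0 < q i)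
    (hq : ∀ i, ∑ j, a j * M i j = q i)
    (h2 : ∀ z : α → ℝ, ∑ i, z i * ∑ j, M i j * z j ≤ ∑ i, a i / q i * (∑ j, M i j * z j) ^ 2)
    (conn : ∀ I : α → Prop, (∃ i, I i) → (∃ j, ¬ I j) → ∃ i j, I i ∧ ¬ I j ∧ M i j ≠ 0)
    (z : α → ℝ) (hz : ∑ i, z i * q i = 0) : ∑ i, z i * ∑ j, M i j * z j ≤ 0 := by
  have key : ∀ r : α → ℝ, ∑ i, q i * (a i * r i) ^ 2 / a i - ∑ i, (a i * r i) * ∑ j, M i j * (a j * r j) =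
      1 / 2 * ∑ i, ∑ j, a i * a j * M i j * (r i - r j) ^ 2 := by
    intro r
    have e1 : ∑ i, q i * (a i * r i) ^ 2 / a i = ∑ i, ∑ j, a i * a j * M i j * r i ^ 2 := by
      refine Finset.sum_congr rfl fun i _ => ?_
      rw [← hq i, mul_div_assoc, Finset.sum_mul]
      refine Finset.sum_congr rfl fun j _ => ?_
      have := (ha i).ne'
      field_simp
    have e1' : ∑ i, q i * (a i * r i) ^ 2 / a i = ∑ i, ∑ j, a i * a j * M i j * r j ^ 2 := by
      rw [e1, Finset.sum_comm]
      refine Finset.sum_congr rfl fun i _ => Finset.sum_congr rfl fun j _ => ?_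
      rw [hs j i]; ring
    have e2 : ∑ i, (a i * r i) * ∑ j, M i j * (a j * r j) = ∑ i, ∑ j, a i * a j * M i j * (r i * r j) := by
      refine Finset.sum_congr rfl fun i _ => ?_
      rw [Finset.mul_sum]
      exact Finset.sum_congr rfl fun j _ => by ring
    have e3 : ∑ i, ∑ j, a i * a j * M i j * (r i - r j) ^ 2 =
        ∑ i, ∑ j, a i * a j * M i j * r i ^ 2 + ∑ i, ∑ j, a i * a j * M i j * r j ^ 2
        - 2 * ∑ i, ∑ j, a i * a j * M i j * (r i * r j) := by
      simp only [Finset.mul_sum, ← Finset.sum_add_distrib, ← Finset.sum_sub_distrib]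
      refine Finset.sum_congr rfl fun i _ => Finset.sum_congr rfl fun j _ => ?_
      ring
    rw [e3, ← e1, ← e1', e2]; ring
  have tn : ∀ (r : α → ℝ) i j, 0 ≤ a i * a j * M i j * (r i - r j) ^ 2 := by
    intro r i j
    by_cases hij : i = j
    · subst hij; simp
    · have := hn i j hij; have := ha i; have := ha j; positivity
  set d : α → ℝ := fun i => Real.sqrt (a i / q i) with hd
  have hd0 : ∀ i, 0 < d i := fun i => Real.sqrt_pos.2 (div_pos (ha i) (hq0 i))
  have hd2 : ∀ i, d i ^ 2 = a i / q i := fun i => Real.sq_sqrt (div_pos (ha i) (hq0 i)).le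
  set N : Matrix α α ℝ := Matrix.of fun i j => d i * M i j * d j with hN
  have hNh : N.IsHermitian := by
    ext i j; simp [hN, hs i j]; ring
  set A := Matrix.toEuclideanLin N with hA
  have hAs : A.IsSymmetric := Matrix.isSymmetric_toEuclideanLin_iff.2 hNh
  have hAx : ∀ x i, (A x) i = d i * ∑ j, M i j * (d j * x j) := by
    intro x i
    rw [hA, Matrix.toLpLin_apply]
    simp only [Matrix.mulVec, dotProduct, hN, Matrix.of_apply, Finset.mul_sum]
    exact Finset.sum_congr rfl fun j _ => by ring
  have hin : ∀ x y : EuclideanSpace ℝ α, inner ℝ x y = ∑ i, x i * y i := by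
    intro x y; rw [PiLp.inner_apply]; exact Finset.sum_congr rfl fun j _ => by simp [mul_comm]
  have hAxx : ∀ x, inner ℝ (A x) x = ∑ i, (d i * x i) * ∑ j, M i j * (d j * x j) := by
    intro x
    rw [hin]
    exact Finset.sum_congr rfl fun j _ => by rw [hAx]; ring
  have hq' : ∀ i, q i / a i * d i ^ 2 = 1 := fun i => by
    rw [hd2]; have := ha i; have := hq0 i; field_simp
  have hxx : ∀ x : EuclideanSpace ℝ α, inner ℝ x x = ∑ i, q i * (a i * (d i * x i / a i)) ^ 2 / a i := by
    intro x
    rw [hin]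
    refine Finset.sum_congr rfl fun i _ => ?_
    rw [mul_div_cancel₀ _ (ha i).ne']
    calc x i * x i = (q i / a i * d i ^ 2) * (x i * x i) := by rw [hq', one_mul]
      _ = _ := by ring
  have hdiff : ∀ x, inner ℝ x x - inner ℝ (A x) x =
      1 / 2 * ∑ i, ∑ j, a i * a j * M i j * (d i * x i / a i - d j * x j / a j) ^ 2 := by
    intro x
    rw [← key (fun i => d i * x i / a i), hxx, hAxx]
    simp only [mul_div_cancel₀ _ (ha _).ne']
  set x : EuclideanSpace ℝ α := WithLp.toLp 2 (fun i => z i / d i) with hx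
  set u : EuclideanSpace ℝ α := WithLp.toLp 2 (fun i => d i * q i) with hu
  have hdx : ∀ i, d i * x i = z i := fun i => mul_div_cancel₀ _ (hd0 i).ne'
  have fin := symm_spectral A hAs u ?_ ?_ ?_ x ?_
  · rw [hAxx] at fin
    simpa only [hdx] using fin
  · intro x
    have := hdiff x
    have h3 : 0 ≤ ∑ i, ∑ j, a i * a j * M i j * (d i * x i / a i - d j * x j / a j) ^ 2 :=
      Finset.sum_nonneg fun i _ => Finset.sum_nonneg fun j _ => tn (fun i => d i * x i / a i) i j
    linarith
  · intro x
    rw [hAxx, hin]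
    refine (h2 fun i => d i * x i).trans (le_of_eq ?_)
    refine Finset.sum_congr rfl fun i _ => ?_
    rw [hAx, ← hd2]; ring
  · intro x h1 hx1
    have h0 := hdiff x
    rw [h1, sub_self] at h0
    have h0' : ∑ i, ∑ j, a i * a j * M i j * (d i * x i / a i - d j * x j / a j) ^ 2 = 0 := by linarith
    have hzz : ∀ i j, a i * a j * M i j * (d i * x i / a i - d j * x j / a j) ^ 2 = 0 := by
      intro i j
      have h4 := (Finset.sum_eq_zero_iff_of_nonneg (fun i _ => Finset.sum_nonneg fun j _ => tn (fun i => d i * x i / a i) i j)).1 h0' i (Finset.mem_univ _)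
      exact (Finset.sum_eq_zero_iff_of_nonneg (fun j _ => tn (fun i => d i * x i / a i) i j)).1 h4 j (Finset.mem_univ _)
    have hne : Nonempty α := by
      by_contra hc
      rw [not_nonempty_iff] at hc
      rw [hin] at hx1
      simp at hx1
    obtain ⟨i0⟩ := hne
    have hall : ∀ i, d i * x i / a i = d i0 * x i0 / a i0 := by
      by_contra hc
      push Not at hc
      obtain ⟨i, j, hi, hj, hij⟩ := conn (fun i => d i * x i / a i = d i0 * x i0 / a i0) ⟨i0, rfl⟩ hc
      have := hzz i j
      have h5 : d i * x i / a i - d j * x j / a j = 0 := by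
        have h6 := (ha i).ne'; have h7 := (ha j).ne'
        simpa [h6, h7, hij] using this
      exact hj (by linarith)
    refine ⟨d i0 * x i0 / a i0, ?_⟩
    ext i
    have h8 := hall i
    rw [← h8]
    simp only [hu, PiLp.smul_apply, smul_eq_mul]
    calc x i = (q i / a i * d i ^ 2) * x i := by rw [hq', one_mul]
      _ = _ := by ring
  · rw [hin, ← hz]
    refine Finset.sum_congr rfl fun i _ => ?_
    rw [← hdx i]; simp only [hu]; ring

section Core
variable {ι : Type} [Fintype ι] [DecidableEq ι]
variable {n : ℕ} {p : MvPolynomial ι ℝ} {C : Set (ι → ℝ)} {Lin : Submodule ℝ (ι → ℝ)}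

lemma transf (B : LinearMap.BilinForm ℝ (ι → ℝ)) (hB : ∀ a b, B a b = B b a) (c c0 : ι → ℝ)
    (hc : 0 < B c c) (h : ∀ x, B x c0 = 0 → B x x ≤ 0) (x : ι → ℝ) (hx : B x c = 0) : B x x ≤ 0 := by
  by_contra hcon
  push Not at hcon
  have h1 := h (B c c0 • x - B x c0 • c) (by simp; ring)
  simp only [map_sub, map_smul, LinearMap.sub_apply, LinearMap.smul_apply, smul_eq_mul, hB c x, hx] at h1
  have h2 : B c c0 = 0 := by
    by_contra h3
    have : 0 < B c c0 ^ 2 := by positivity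
    nlinarith [mul_pos this hcon, mul_nonneg (sq_nonneg (B x c0)) hc.le]
  linarith [h c h2]

lemma CoreHyp.conn (H : CoreHyp n p C Lin) (k : ℕ) (T : Finset ι) (hT : T.card + k + 2 = n)
    (hf : fT p T ≠ 0) (c : ι → ℝ) (hc : c ∈ C) (a : ι → ℝ) (ha1 : ∀ i ∉ T, 0 < a i)
    (ha2 : ∀ i ∈ T, a i = 0) (ha3 : c - a ∈ Lin) (I : ι → Prop)
    (hI1 : ∃ i, i ∉ T ∧ I i ∧ fT p (insert i T) ≠ 0) (hI2 : ∃ i, i ∉ T ∧ ¬ I i ∧ fT p (insert i T) ≠ 0)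
    (hI : ∀ i j, i ∉ T → j ∉ T → I i → ¬ I j → fT p (insert j (insert i T)) = 0) : False := by
  classical
  set Q := PhB p T (Multiset.replicate k c) with hQ
  set u1 : ι → ℝ := fun i => if I i then a i else 0 with hu1
  set u2 : ι → ℝ := fun i => if I i then 0 else a i with hu2
  have hu : a = u1 + u2 := by
    ext i; simp only [hu1, hu2, Pi.add_apply]; split_ifs <;> simp
  have hQc : ∀ x, Q x c = Q x u1 + Q x u2 := by
    intro x
    rw [← map_add, ← hu, hQ, PhB_comm, PhB_comm _ _ _ x, PhB_apply, PhB_apply, H.phcongr T ha3]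
  have h12 : Q u1 u2 = 0 := by
    rw [hQ, PhB_apply, Ph_expand p u1 (fun i hi => by simp [hu1, ha2 i hi])]
    refine Finset.sum_eq_zero fun i hi => ?_
    have hi : i ∉ T := by simpa using hi
    by_cases hIi : I i
    · rw [Ph_expand p u2]
      · rw [Finset.sum_eq_zero, mul_zero]
        intro j hj
        simp only [Finset.mem_compl, Finset.mem_insert, not_or] at hj
        by_cases hIj : I j
        · simp [hu2, hIj]
        · rw [Ph_zero p (hI i j hi hj.2 hIi hIj), mul_zero]
      · intro j hj
        rcases Finset.mem_insert.1 hj with rfl | hj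
        · simp [hu2, hIi]
        · simp [hu2, ha2 j hj]
    · simp [hu1, hIi]
  have h21 : Q u2 u1 = 0 := by rw [hQ, PhB_comm]; exact h12
  have hpos : ∀ u : ι → ℝ, (∀ i, 0 ≤ u i) → (∀ i ∈ T, u i = 0) →
      (∃ i, i ∉ T ∧ 0 < u i ∧ fT p (insert i T) ≠ 0) → 0 < Q u c := by
    intro u hu0 huT ⟨i, hi, hui, hfi⟩
    rw [hQ, PhB_apply, Ph_expand p u huT, ← Multiset.replicate_succ]
    have hp : ∀ i ∈ Tᶜ, fT p (insert i T) ≠ 0 → 0 < Ph p (insert i T) (Multiset.replicate (k+1) c) := by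
      intro i hi hfi
      refine H.phpos (k+1) _ _ (by simp) ?_ (fun x hx => by rw [Multiset.eq_of_mem_replicate hx]; exact hc) ⟨c, hc⟩ hfi
      rw [Finset.card_insert_of_notMem (by simpa using hi)]; omega
    refine Finset.sum_pos' (fun j hj => mul_nonneg (hu0 j) ?_) ⟨i, by simpa using hi, mul_pos hui (hp i (by simpa using hi) hfi)⟩
    by_cases hz : fT p (insert j T) = 0
    · rw [Ph_zero p hz]
    · exact (hp j hj hz).le
  have ha0 : ∀ i, 0 ≤ a i := fun i => by
    by_cases hi : i ∈ T
    · rw [ha2 i hi]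
    · exact (ha1 i hi).le
  have p1 : 0 < Q u1 c := by
    refine hpos u1 (fun i => by simp only [hu1]; split_ifs; exacts [ha0 i, le_rfl]) (fun i hi => by simp [hu1, ha2 i hi]) ?_
    obtain ⟨i, hi, hIi, hfi⟩ := hI1
    exact ⟨i, hi, by simp [hu1, hIi, ha1 i hi], hfi⟩
  have p2 : 0 < Q u2 c := by
    refine hpos u2 (fun i => by simp only [hu2]; split_ifs; exacts [le_rfl, ha0 i]) (fun i hi => by simp [hu2, ha2 i hi]) ?_
    obtain ⟨i, hi, hIi, hfi⟩ := hI2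
    exact ⟨i, hi, by simp [hu2, hIi, ha1 i hi], hfi⟩
  have q1 := hQc u1
  have q2 := hQc u2
  have := H.bm k T hT hf c hc (Q u2 c • u1 - Q u1 c • u2) (by rw [← hQ]; simp; ring)
  rw [← hQ] at this
  simp only [map_sub, map_smul, LinearMap.sub_apply, LinearMap.smul_apply, smul_eq_mul, h12, h21] at this
  rw [h12, add_zero] at q1
  rw [h21, zero_add] at q2
  rw [← q1, ← q2] at this
  have := mul_pos p1 p2
  nlinarith [mul_pos this p1, mul_pos this p2]
end Core
end PartP3

section PartP4
open MvPolynomial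

section Core
variable {ι : Type} [Fintype ι] [DecidableEq ι]
variable {n : ℕ} {p : MvPolynomial ι ℝ} {C : Set (ι → ℝ)} {Lin : Submodule ℝ (ι → ℝ)}

lemma CoreHyp.near (H : CoreHyp n p C Lin) {T : Finset ι} (hf : fT p T ≠ 0) {c : ι → ℝ} (hc : c ∈ C)
    (h : ι → ℝ) : ∃ y : ι → ℝ, (∀ i ∈ T, y i = 0) ∧ h - y ∈ Lin := by
  have c1 : Filter.Tendsto (fun t : ℝ => c + t • h) (nhds 0) (nhds c) := by
    have : Continuous (fun t : ℝ => c + t • h) := by fun_prop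
    simpa using this.tendsto 0
  obtain ⟨ε, hε, hmem⟩ := Metric.eventually_nhds_iff.1 (c1 (H.op.mem_nhds hc))
  have hm : c + (ε/2) • h ∈ C := hmem (by simp [abs_of_pos hε]; linarith)
  obtain ⟨a, ha1, ha2, ha3⟩ := H.rep T hf _ hc
  obtain ⟨b, hb1, hb2, hb3⟩ := H.rep T hf _ hm
  refine ⟨(2/ε) • (b - a), fun i hi => by simp [ha2 i hi, hb2 i hi], ?_⟩
  have : h - (2/ε) • (b - a) = (2/ε) • ((c + (ε/2) • h - b) - (c - a)) := by
    ext i; simp only [Pi.sub_apply, Pi.smul_apply, Pi.add_apply, smul_eq_mul]; field_simp; ring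
  rw [this]
  exact Lin.smul_mem _ (Lin.sub_mem hb3 ha3)

lemma CoreHyp.step (H : CoreHyp n p C Lin) (k : ℕ) (T : Finset ι) (s : Multiset (ι → ℝ))
    (hT : T.card + (k + 1) + 2 = n) (hs : s.card = k) (hsC : ∀ c ∈ s, c ∈ C) (hf : fT p T ≠ 0)
    (c : ι → ℝ) (hc : c ∈ C)
    (ih : ∀ i ∉ T, fT p (insert i T) ≠ 0 → ∀ h, PhB p (insert i T) s h c = 0 → PhB p (insert i T) s h h ≤ 0)
    (h : ι → ℝ) (h0 : PhB p T (c ::ₘ s) h c = 0) : PhB p T (c ::ₘ s) h h ≤ 0 := by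
  classical
  obtain ⟨a, ha1, ha2, ha3⟩ := H.rep T hf c hc
  obtain ⟨y, hy1, hy2⟩ := H.near hf hc h
  set Q := PhB p T (c ::ₘ s) with hQ
  have hQs : ∀ u v, Q u v = Q v u := PhB_comm _ _ _
  have hQl : ∀ {u v} b, u - v ∈ Lin → Q u b = Q v b := by
    intro u v b huv
    rw [hQ, PhB_apply, PhB_apply, H.phcongr T huv]
  have hQe : ∀ i, i ∉ T → ∀ b, Q (Pi.single i 1) b = Ph p (insert i T) (b ::ₘ c ::ₘ s) := by
    intro i hi b
    rw [hQ, PhB_apply, Ph_single p hi]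
  let α := {i : ι // i ∉ T ∧ fT p (insert i T) ≠ 0}
  have hsum : ∀ g : ι → ℝ, (∀ i ∉ T, fT p (insert i T) = 0 → g i = 0) → ∑ i ∈ Tᶜ, g i = ∑ i : α, g i := by
    intro g hg
    rw [← Finset.sum_subtype (Tᶜ.filter fun i => fT p (insert i T) ≠ 0) (by intro x; simp)]
    symm
    refine Finset.sum_filter_of_ne fun i hi hgi hz => hgi (hg i (by simpa using hi) hz)
  have hexp : ∀ u b : ι → ℝ, (∀ i ∈ T, u i = 0) → Q u b = ∑ i : α, u i * Q (Pi.single i.1 1) b := by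
    intro u b hu
    rw [← hsum (fun i => u i * Q (Pi.single i 1) b), hQ, PhB_apply, Ph_expand p u hu]
    · refine Finset.sum_congr rfl fun i hi => ?_
      rw [hQe i (by simpa using hi)]
    · intro i hi hz
      change u i * Q (Pi.single i 1) b = 0
      rw [hQe i hi, Ph_zero p hz, mul_zero]
  have hcard : ∀ i ∉ T, (insert i T).card + (k + 2) = n := fun i hi => by
    rw [Finset.card_insert_of_notMem hi]; omega
  have hqpos : ∀ i : α, 0 < Q (Pi.single i.1 1) c := by
    intro i
    rw [hQe _ i.2.1]
    refine H.phpos (k+2) _ _ (by simp [hs]) (hcard _ i.2.1) ?_ ⟨c, hc⟩ i.2.2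
    intro x hx
    simp only [Multiset.mem_cons] at hx
    rcases hx with rfl | rfl | hx
    exacts [hc, hc, hsC _ hx]
  have hMpos : ∀ i j : ι, i ∉ T → j ∉ T → i ≠ j → 
      (fT p (insert j (insert i T)) ≠ 0 → 0 < Q (Pi.single i 1) (Pi.single j 1)) ∧
      (fT p (insert j (insert i T)) = 0 → Q (Pi.single i 1) (Pi.single j 1) = 0) := by
    intro i j hi hj hij
    have hj' : j ∉ insert i T := by simp [hj, Ne.symm hij]
    rw [hQe _ hi, Ph_single p hj']
    refine ⟨fun hz => ?_, fun hz => Ph_zero p hz _⟩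
    refine H.phpos (k+1) _ _ (by simp [hs]) ?_ ?_ ⟨c, hc⟩ hz
    · rw [Finset.card_insert_of_notMem hj']; have := hcard i hi; omega
    · intro x hx
      simp only [Multiset.mem_cons] at hx
      rcases hx with rfl | hx
      exacts [hc, hsC _ hx]
  have main := lor_alg (α := α) (fun i j => Q (Pi.single i.1 1) (Pi.single j.1 1)) (fun i => a i)
    (fun i => Q (Pi.single i.1 1) c) (fun i j => hQs _ _) ?_ (fun i => ha1 _ i.2.1) hqpos ?_ ?_ ?_ (fun i => y i) ?_
  · have e1 : Q h h = Q y y := by rw [hQl h hy2, hQs, hQl y hy2]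
    rw [e1, hexp y y hy1]
    refine le_of_eq_of_le ?_ main
    refine Finset.sum_congr rfl fun i _ => ?_
    rw [hQs, hexp y _ hy1]
    congr 1
    exact Finset.sum_congr rfl fun j _ => by rw [hQs]; ring
  · intro i j hij
    have := hMpos i j i.2.1 j.2.1 (fun h => hij (Subtype.ext h))
    by_cases hz : fT p (insert j.1 (insert i.1 T)) = 0
    · exact (this.2 hz).ge
    · exact (this.1 hz).le
  · intro i
    rw [hQs _ c, hQl _ ha3, hexp a _ ha2]
    exact Finset.sum_congr rfl fun j _ => by rw [hQs]
  · intro z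
    set x : ι → ℝ := fun i => if hi : i ∉ T ∧ fT p (insert i T) ≠ 0 then z ⟨i, hi⟩ else 0 with hx
    have hxT : ∀ i ∈ T, x i = 0 := fun i hi => by simp [hx, hi]
    have hxz : ∀ i : α, x i = z i := fun i => by simp only [hx]; rw [dif_pos i.2]
    have hr : ∀ b, ∑ j : α, Q b (Pi.single j.1 1) * z j = Q b x := by
      intro b
      rw [hQs b x, hexp x b hxT]
      exact Finset.sum_congr rfl fun j _ => by rw [hQs, hxz]; ring
    simp only [hr]
    have e1 : ∑ i : α, z i * Q (Pi.single i.1 1) x = Q x x := by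
      rw [hexp x x hxT]
      exact Finset.sum_congr rfl fun j _ => by rw [hxz]
    have e2 : Q x x = ∑ i : α, a i * PhB p (insert i.1 T) s x x := by
      rw [← hsum (fun i => a i * PhB p (insert i T) s x x)]
      · simp only [hQ, PhB_apply]
        rw [Multiset.cons_swap x c, Multiset.cons_swap x c, H.phcongr T ha3, Ph_expand p a ha2]
      · intro i hi hz
        change a i * PhB p (insert i T) s x x = 0
        rw [PhB_apply, Ph_zero p hz, mul_zero]
    rw [e1, e2]
    refine Finset.sum_le_sum fun i _ => ?_
    have hq := hqpos i
    have hcc : PhB p (insert i.1 T) s c c = Q (Pi.single i.1 1) c := by rw [hQe _ i.2.1, PhB_apply]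
    have hxc : PhB p (insert i.1 T) s x c = Q (Pi.single i.1 1) x := by rw [hQe _ i.2.1, PhB_apply]
    have := rcs (PhB p (insert i.1 T) s) (PhB_comm _ _ _) c (by rw [hcc]; exact hq) (ih i.1 i.2.1 i.2.2) x
    rw [hcc, hxc] at this
    rw [div_mul_eq_mul_div, mul_div_assoc]
    refine mul_le_mul_of_nonneg_left ?_ (ha1 _ i.2.1).le
    rwa [le_div_iff₀ hq]
  · intro I hI1 hI2
    by_contra hcon
    push Not at hcon
    obtain ⟨i, hi⟩ := hI1
    obtain ⟨j, hj⟩ := hI2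
    refine H.conn (k+1) T hT hf c hc a ha1 ha2 ha3 (fun i => ∃ h : i ∉ T ∧ fT p (insert i T) ≠ 0, I ⟨i, h⟩)
      ⟨i, i.2.1, ⟨i.2, hi⟩, i.2.2⟩ ⟨j, j.2.1, ?_, j.2.2⟩ ?_
    · rintro ⟨_, h⟩; exact hj h
    · rintro i j hi hj ⟨hi', hIi⟩ hIj
      have hij : i ≠ j := by rintro rfl; exact hIj ⟨hi', hIi⟩
      by_cases hz : fT p (insert j T) = 0
      · rw [Finset.insert_comm, fT_insert p (by simp [hi, hij]), hz, dD_zero]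
      · by_contra hz2
        exact ((hMpos i j hi hj hij).1 hz2).ne' (hcon ⟨i, hi'⟩ ⟨j, hj, hz⟩ hIi (fun h => hIj ⟨⟨hj, hz⟩, h⟩))
  · rw [← hexp y c hy1, ← hQl c hy2, h0]

theorem CoreHyp.core (H : CoreHyp n p C Lin) : ∀ (k : ℕ) (T : Finset ι) (s : Multiset (ι → ℝ)),
    T.card + k + 2 = n → s.card = k → (∀ c ∈ s, c ∈ C) → fT p T ≠ 0 → ∀ c ∈ C, ∀ h,
    PhB p T s h c = 0 → PhB p T s h h ≤ 0 := by
  intro k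
  induction k with
  | zero =>
    intro T s hT hs hsC hf c hc h h0
    rw [Multiset.card_eq_zero] at hs
    subst hs
    exact H.bm 0 T hT hf c hc h h0
  | succ k ih =>
    intro T s hT hs hsC hf c hc
    obtain ⟨c3, hcs⟩ := Multiset.card_pos_iff_exists_mem.1 (by omega : 0 < s.card)
    obtain ⟨s, rfl⟩ := Multiset.exists_cons_of_mem hcs
    have hs' : s.card = k := by simpa using hs
    have hsC' : ∀ x ∈ s, x ∈ C := fun x hx => hsC x (by simp [hx])
    have hc3 : c3 ∈ C := hsC c3 (by simp)
    refine transf _ (PhB_comm _ _ _) c c3 ?_ ?_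
    · rw [PhB_apply]
      refine H.phpos (k+3) T _ (by simp [hs']) (by omega) ?_ ⟨c, hc⟩ hf
      intro x hx
      simp only [Multiset.mem_cons] at hx
      rcases hx with rfl | rfl | rfl | hx
      exacts [hc, hc, hc3, hsC' _ hx]
    · refine H.step k T s hT hs' hsC' hf c3 hc3 fun i hi hfi h => ?_
      exact ih (insert i T) s (by rw [Finset.card_insert_of_notMem hi]; omega) hs' hsC' hfi c3 hc3 h

theorem CoreHyp.final (H : CoreHyp n p C Lin) (s : Multiset (ι → ℝ)) (hn : s.card + 2 = n)
    (hsC : ∀ c ∈ s, c ∈ C) (k l : ι → ℝ) (hk : k ∈ C) (hl : l ∈ C) :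
    eval 0 (mD (k ::ₘ k ::ₘ s) p) * eval 0 (mD (l ::ₘ l ::ₘ s) p) ≤ eval 0 (mD (k ::ₘ l ::ₘ s) p) ^ 2 := by
  by_cases hp : p = 0
  · subst hp; simp [mD_poly_zero]
  · have hf : fT p ∅ = p := rfl
    have := rcs (PhB p ∅ s) (PhB_comm _ _ _) l ?_ (H.core s.card ∅ s (by simpa using hn) rfl hsC (by rwa [hf]) l hl) k
    · exact this
    · rw [PhB_apply]
      refine H.phpos (s.card + 2) ∅ _ (by simp) (by simpa using hn) ?_ ⟨l, hl⟩ (by rwa [hf])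
      intro x hx
      simp only [Multiset.mem_cons] at hx
      rcases hx with rfl | rfl | hx
      exacts [hl, hl, hsC _ hx]
end Core
end PartP4

section PartP5
open MeasureTheory

section BM
open scoped ENNReal

lemma bm1_compact {K L M : Set ℝ} (hK : IsCompact K) (hL : IsCompact L) (hKn : K.Nonempty) (hLn : L.Nonempty)
    (h : ∀ a ∈ K, ∀ b ∈ L, 2⁻¹ * (a + b) ∈ M) : volume K + volume L ≤ 2 * volume M := by
  obtain ⟨k, hk, hk'⟩ := hK.exists_isGreatest hKn
  obtain ⟨l, hl, hl'⟩ := hL.exists_isLeast hLn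
  have hM : volume ((fun x : ℝ => 2⁻¹ * x) ⁻¹' M) = 2 * volume M := by
    rw [Real.volume_preimage_mul_left (by norm_num)]
    congr 1
    norm_num
  rw [← hM]
  have e1 : volume ((fun x => l + x) '' K) = volume K := by
    rw [Set.image_add_left, measure_preimage_add]
  have e2 : volume ((fun x => k + x) '' L) = volume L := by
    rw [Set.image_add_left, measure_preimage_add]
  rw [← e1, ← e2]
  have c1 : IsCompact ((fun x => l + x) '' K) := hK.image (by fun_prop)
  have c2 : IsCompact ((fun x => k + x) '' L) := hL.image (by fun_prop)
  rw [← measure_union₀ c2.measurableSet.nullMeasurableSet]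
  · refine measure_mono ?_
    rintro _ (⟨x, hx, rfl⟩ | ⟨x, hx, rfl⟩)
    · have := h x hx l hl
      simpa [add_comm] using this
    · exact h k hk x hx
  · refine measure_mono_null (t := {k + l}) ?_ (by simp)
    rintro _ ⟨⟨x, hx, rfl⟩, ⟨y, hy, hxy⟩⟩
    have h1 := hk' hx
    have h2 := hl' hy
    simp only [Set.mem_singleton_iff] at *
    linarith

lemma bm1 {A B M : Set ℝ} (hA : MeasurableSet A) (hB : MeasurableSet B) (hAn : A.Nonempty) (hBn : B.Nonempty)
    (h : ∀ a ∈ A, ∀ b ∈ B, 2⁻¹ * (a + b) ∈ M) : volume A + volume B ≤ 2 * volume M := by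
  obtain ⟨a0, ha0⟩ := hAn
  obtain ⟨b0, hb0⟩ := hBn
  rw [hA.measure_eq_iSup_isCompact, hB.measure_eq_iSup_isCompact]
  simp only [iSup_and']
  refine ENNReal.biSup_add_biSup_le' ⟨∅, by simp⟩ ⟨∅, by simp⟩ ?_
  intro K hK L hL
  refine le_trans (add_le_add (measure_mono (Set.subset_insert a0 K)) (measure_mono (Set.subset_insert b0 L))) ?_
  refine bm1_compact (hK.2.insert _) (hL.2.insert _) (Set.insert_nonempty _ _) (Set.insert_nonempty _ _) ?_
  intro a ha b hb
  refine h a ?_ b ?_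
  · rcases ha with rfl | ha
    exacts [ha0, hK.1 ha]
  · rcases hb with rfl | hb
    exacts [hb0, hL.1 hb]

lemma pl1_real {f g h : ℝ → ℝ} (hf : Measurable f) (hg : Measurable g) (hh : Measurable h)
    (f0 : ∀ x, 0 ≤ f x) (g0 : ∀ x, 0 ≤ g x) (h0 : ∀ x, 0 ≤ h x) (f1 : ∀ x, f x ≤ 1) (g1 : ∀ x, g x ≤ 1)
    (fs : ∀ t < 1, ∃ x, t < f x) (gs : ∀ t < 1, ∃ x, t < g x)
    (H : ∀ x y, f x * g y ≤ h (2⁻¹ * (x + y)) ^ 2) :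
    (∫⁻ x, ENNReal.ofReal (f x)) + (∫⁻ x, ENNReal.ofReal (g x)) ≤ 2 * ∫⁻ x, ENNReal.ofReal (h x) := by
  rw [lintegral_eq_lintegral_meas_lt _ (.of_forall f0) hf.aemeasurable,
    lintegral_eq_lintegral_meas_lt _ (.of_forall g0) hg.aemeasurable,
    lintegral_eq_lintegral_meas_lt _ (.of_forall h0) hh.aemeasurable]
  have mm : ∀ (f : ℝ → ℝ), Measurable fun t => volume {x | t < f x} := fun f => by
    refine Antitone.measurable fun s t hst => measure_mono fun x hx => lt_of_le_of_lt hst hx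
  rw [← lintegral_add_left (mm f), ← lintegral_const_mul _ (mm h)]
  refine setLIntegral_mono ((mm h).const_mul _) fun t ht => ?_
  have ht : 0 < t := ht
  by_cases h1 : t < 1
  · refine bm1 (measurableSet_lt measurable_const hf) (measurableSet_lt measurable_const hg) (fs t h1) (gs t h1) ?_
    intro a ha b hb
    have ha : t < f a := ha
    have hb : t < g b := hb
    have := H a b
    change t < h _
    by_contra hc
    push Not at hc
    have := h0 (2⁻¹ * (a + b))
    nlinarith
  · have e1 : {x | t < f x} = ∅ := by ext x; simp; linarith [f1 x]
    have e2 : {x | t < g x} = ∅ := by ext x; simp; linarith [g1 x]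
    rw [e1, e2]; simp

lemma ennreal_amgm (a b c : ℝ≥0∞) (h : a + b ≤ 2 * c) : a * b ≤ c ^ 2 := by
  by_cases hc : c = ⊤
  · simp [hc]
  have h2 : 2 * c ≠ ⊤ := ENNReal.mul_ne_top (by norm_num) hc
  have ha : a ≠ ⊤ := ne_top_of_le_ne_top h2 (le_self_add.trans h)
  have hb : b ≠ ⊤ := ne_top_of_le_ne_top h2 (le_add_self.trans h)
  lift a to NNReal using ha
  lift b to NNReal using hb
  lift c to NNReal using hc
  norm_cast at h ⊢
  rw [← NNReal.coe_le_coe] at h ⊢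
  push_cast at h ⊢
  nlinarith [sq_nonneg ((a:ℝ) - b), a.2, b.2, c.2]

lemma pl1_bdd {f g h : ℝ → ℝ≥0∞} (hf : Measurable f) (hg : Measurable g) (hh : Measurable h)
    (N : ℝ≥0∞) (hN : N ≠ ⊤) (fN : ∀ x, f x ≤ N) (gN : ∀ x, g x ≤ N)
    (H : ∀ x y, f x * g y ≤ h (2⁻¹ * (x + y)) ^ 2) :
    (∫⁻ x, f x) * (∫⁻ x, g x) ≤ (∫⁻ x, h x) ^ 2 := by
  set F := ⨆ x, f x with hF
  set G := ⨆ x, g x with hG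
  have Ft : F ≠ ⊤ := ne_top_of_le_ne_top hN (iSup_le fN)
  have Gt : G ≠ ⊤ := ne_top_of_le_ne_top hN (iSup_le gN)
  have fF : ∀ x, f x ≤ F := le_iSup f
  have gG : ∀ x, g x ≤ G := le_iSup g
  by_cases F0 : F = 0
  · have : ∀ x, f x = 0 := fun x => le_antisymm ((fF x).trans F0.le) bot_le
    simp [this]
  by_cases G0 : G = 0
  · have : ∀ x, g x = 0 := fun x => le_antisymm ((gG x).trans G0.le) bot_le
    simp [this]
  have Fp : 0 < F.toReal := ENNReal.toReal_pos F0 Ft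
  have Gp : 0 < G.toReal := ENNReal.toReal_pos G0 Gt
  set s := ENNReal.ofReal (Real.sqrt (F.toReal * G.toReal)) with hs
  have ss : s ^ 2 = F * G := by
    rw [hs, ← ENNReal.ofReal_pow (Real.sqrt_nonneg _), Real.sq_sqrt (by positivity), ENNReal.ofReal_mul Fp.le,
      ENNReal.ofReal_toReal Ft, ENNReal.ofReal_toReal Gt]
  have s0 : s ≠ 0 := by
    rw [hs]; simp only [ne_eq, ENNReal.ofReal_eq_zero, not_le]; positivity
  have st : s ≠ ⊤ := ENNReal.ofReal_ne_top
  have nf : ∀ x, f x / F ≤ 1 := fun x => ENNReal.div_le_of_le_mul (by simpa using fF x)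
  have ng : ∀ x, g x / G ≤ 1 := fun x => ENNReal.div_le_of_le_mul (by simpa using gG x)
  have key := pl1_real (f := fun x => (f x / F).toReal) (g := fun x => (g x / G).toReal)
    (h := fun x => (min (h x / s) 1).toReal) (hf.div_const _).ennreal_toReal (hg.div_const _).ennreal_toReal
    ((hh.div_const _).min measurable_const).ennreal_toReal (fun _ => ENNReal.toReal_nonneg) (fun _ => ENNReal.toReal_nonneg)
    (fun _ => ENNReal.toReal_nonneg) (fun x => ENNReal.toReal_le_of_le_ofReal zero_le_one (by simpa using nf x))
    (fun x => ENNReal.toReal_le_of_le_ofReal zero_le_one (by simpa using ng x)) ?_ ?_ ?_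
  · have e1 : ∀ x, ENNReal.ofReal ((f x / F).toReal) = f x / F := fun x =>
      ENNReal.ofReal_toReal (ne_top_of_le_ne_top ENNReal.one_ne_top (nf x))
    have e2 : ∀ x, ENNReal.ofReal ((g x / G).toReal) = g x / G := fun x =>
      ENNReal.ofReal_toReal (ne_top_of_le_ne_top ENNReal.one_ne_top (ng x))
    have e3 : ∀ x, ENNReal.ofReal ((min (h x / s) 1).toReal) ≤ h x / s := fun x =>
      ENNReal.ofReal_toReal_le.trans (min_le_left _ _)
    simp only [e1, e2] at key
    have key2 : (∫⁻ x, f x / F) + (∫⁻ x, g x / G) ≤ 2 * ∫⁻ x, h x / s :=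
      key.trans (mul_le_mul_right (lintegral_mono e3) _)
    have k3 := ennreal_amgm _ _ _ key2
    simp only [div_eq_mul_inv] at k3
    rw [lintegral_mul_const _ hf, lintegral_mul_const _ hg, lintegral_mul_const _ hh] at k3
    have k4 := mul_le_mul_left k3 (s ^ 2)
    have r1 : (∫⁻ x, f x) * F⁻¹ * ((∫⁻ x, g x) * G⁻¹) * s ^ 2 = (∫⁻ x, f x) * (∫⁻ x, g x) := by
      rw [ss]
      calc _ = (∫⁻ x, f x) * (∫⁻ x, g x) * (F⁻¹ * F) * (G⁻¹ * G) := by ring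
        _ = _ := by rw [ENNReal.inv_mul_cancel F0 Ft, ENNReal.inv_mul_cancel G0 Gt]; simp
    have r2 : ((∫⁻ x, h x) * s⁻¹) ^ 2 * s ^ 2 = (∫⁻ x, h x) ^ 2 := by
      rw [← mul_pow, mul_assoc, ENNReal.inv_mul_cancel s0 st, mul_one]
    rwa [r1, r2] at k4
  · intro t ht
    by_contra hc
    push Not at hc
    have : F ≤ ENNReal.ofReal (max t 0) * F := by
      refine iSup_le fun x => ?_
      refine (ENNReal.div_le_iff F0 Ft).1 ?_
      rw [← ENNReal.ofReal_toReal (ne_top_of_le_ne_top ENNReal.one_ne_top (nf x))]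
      exact ENNReal.ofReal_le_ofReal ((hc x).trans (le_max_left _ _))
    exact absurd this (not_le.2 (lt_of_lt_of_eq (ENNReal.mul_lt_mul_left F0 Ft (by simp [ht] : ENNReal.ofReal (max t 0) < 1)) (one_mul _)))
  · intro t ht
    by_contra hc
    push Not at hc
    have : G ≤ ENNReal.ofReal (max t 0) * G := by
      refine iSup_le fun x => ?_
      refine (ENNReal.div_le_iff G0 Gt).1 ?_
      rw [← ENNReal.ofReal_toReal (ne_top_of_le_ne_top ENNReal.one_ne_top (ng x))]
      exact ENNReal.ofReal_le_ofReal ((hc x).trans (le_max_left _ _))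
    exact absurd this (not_le.2 (lt_of_lt_of_eq (ENNReal.mul_lt_mul_left G0 Gt (by simp [ht] : ENNReal.ofReal (max t 0) < 1)) (one_mul _)))
  · intro x y
    rw [← ENNReal.toReal_mul, ← ENNReal.toReal_pow]
    refine ENNReal.toReal_mono (by simp) ?_
    rcases le_total (h (2⁻¹ * (x + y)) / s) 1 with h1 | h1
    · rw [min_eq_left h1, div_eq_mul_inv, div_eq_mul_inv, div_eq_mul_inv, mul_pow, ← ENNReal.inv_pow, ss,
        ENNReal.mul_inv (Or.inl F0) (Or.inl Ft)]
      calc _ = f x * g y * (F⁻¹ * G⁻¹) := by ring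
        _ ≤ _ := mul_le_mul_left (H x y) _
    · rw [min_eq_right h1, one_pow]
      exact mul_le_one' (nf x) (ng y)

lemma pl1 {f g h : ℝ → ℝ≥0∞} (hf : Measurable f) (hg : Measurable g) (hh : Measurable h)
    (H : ∀ x y, f x * g y ≤ h (2⁻¹ * (x + y)) ^ 2) :
    (∫⁻ x, f x) * (∫⁻ x, g x) ≤ (∫⁻ x, h x) ^ 2 := by
  have lim : ∀ f : ℝ → ℝ≥0∞, Measurable f → Filter.Tendsto (fun N : ℕ => ∫⁻ x, min (f x) N) Filter.atTop (nhds (∫⁻ x, f x)) := by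
    intro f hf
    refine lintegral_tendsto_of_tendsto_of_monotone (fun n => (hf.min measurable_const).aemeasurable) ?_ ?_
    · refine .of_forall fun x m n hmn => min_le_min_left _ (by exact_mod_cast hmn)
    · refine .of_forall fun x => ?_
      have := (tendsto_const_nhds (x := f x)).min ENNReal.tendsto_nat_nhds_top
      simpa using this
  have b : ∀ N : ℕ, (∫⁻ x, min (f x) N) * (∫⁻ x, min (g x) N) ≤ (∫⁻ x, h x) ^ 2 := fun N =>
    pl1_bdd (hf.min measurable_const) (hg.min measurable_const) hh N (by simp) (fun x => min_le_right _ _)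
      (fun x => min_le_right _ _) fun x y => (mul_le_mul' (min_le_left _ _) (min_le_left _ _)).trans (H x y)
  by_cases z1 : ∫⁻ x, f x = 0
  · simp [z1]
  by_cases z2 : ∫⁻ x, g x = 0
  · simp [z2]
  exact le_of_tendsto' (ENNReal.Tendsto.mul (lim f hf) (Or.inl z1) (lim g hg) (Or.inl z2)) b

lemma pl : ∀ (n : ℕ) {f g h : (Fin n → ℝ) → ℝ≥0∞} (hf : Measurable f) (hg : Measurable g) (hh : Measurable h)
    (H : ∀ x y, f x * g y ≤ h ((2⁻¹ : ℝ) • (x + y)) ^ 2),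
    (∫⁻ x, f x) * (∫⁻ x, g x) ≤ (∫⁻ x, h x) ^ 2 := by
  intro n
  induction n with
  | zero =>
    intro f g h hf hg hh H
    rw [lintegral_unique, lintegral_unique, lintegral_unique]
    have := H default default
    rw [Subsingleton.elim ((2⁻¹ : ℝ) • (default + default : Fin 0 → ℝ)) default] at this
    have e : (volume : Measure (Fin 0 → ℝ)) Set.univ = 1 := by simp [volume_pi]
    rw [e, mul_one, mul_one, mul_one]
    convert this
  | succ n ih =>
    intro f g h hf hg hh H
    have e := (volume_preserving_piFinSuccAbove (fun _ : Fin (n+1) => ℝ) 0).symm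
    have red : ∀ f : (Fin (n+1) → ℝ) → ℝ≥0∞, Measurable f → ∫⁻ x, f x = ∫⁻ t : ℝ, ∫⁻ x : Fin n → ℝ, f (Fin.cons t x) := by
      intro f hf
      rw [← e.lintegral_comp hf, Measure.volume_eq_prod, lintegral_prod]
      · simp [MeasurableEquiv.piFinSuccAbove, Fin.insertNthEquiv]
      · exact (hf.comp e.measurable).aemeasurable
    have mm : ∀ f : (Fin (n+1) → ℝ) → ℝ≥0∞, Measurable f → Measurable fun z : ℝ × (Fin n → ℝ) => f (Fin.cons z.1 z.2) := by
      intro f hf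
      have := hf.comp e.measurable
      simpa [MeasurableEquiv.piFinSuccAbove, Fin.insertNthEquiv, Function.comp_def] using this
    rw [red f hf, red g hg, red h hh]
    refine pl1 (mm f hf).lintegral_prod_right' (mm g hg).lintegral_prod_right' (mm h hh).lintegral_prod_right' ?_
    intro s t
    refine ih ((mm f hf).comp measurable_prodMk_left) ((mm g hg).comp measurable_prodMk_left)
      ((mm h hh).comp measurable_prodMk_left) ?_
    intro x y
    have := H (Fin.cons s x) (Fin.cons t y)
    convert this using 3
    ext i
    refine Fin.cases ?_ (fun i => ?_) i <;> simp [mul_add]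

lemma bm_set {n : ℕ} {A B M : Set (Fin n → ℝ)} (hA : MeasurableSet A) (hB : MeasurableSet B) (hM : MeasurableSet M)
    (h : ∀ a ∈ A, ∀ b ∈ B, (2⁻¹ : ℝ) • (a + b) ∈ M) : volume A * volume B ≤ volume M ^ 2 := by
  have := pl n (f := A.indicator 1) (g := B.indicator 1) (h := M.indicator 1) (measurable_one.indicator hA)
    (measurable_one.indicator hB) (measurable_one.indicator hM) ?_
  · simpa [lintegral_indicator_one, hA, hB, hM] using this
  · intro x y
    by_cases hx : x ∈ A
    · by_cases hy : y ∈ B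
      · simp [hx, hy, h x hx y hy, -smul_add]
      · simp [hy]
    · simp [hx]

end BM
end PartP5

section PartP6
open MeasureTheory

section Poly
variable {ι : Type} [Fintype ι] [DecidableEq ι] {n : ℕ}

def PP (W : ι → (Fin n → ℝ) →ₗ[ℝ] ℝ) (S : Finset ι) (h : ι → ℝ) : Set (Fin n → ℝ) :=
  {x | ∀ i ∈ S, 0 ≤ W i x + h i}

def Bdd (W : ι → (Fin n → ℝ) →ₗ[ℝ] ℝ) (S : Finset ι) : Prop :=
  ∀ x, (∀ i ∈ S, 0 ≤ W i x) → x = 0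

def Simp (W : ι → (Fin n → ℝ) →ₗ[ℝ] ℝ) (S : Finset ι) (h : ι → ℝ) : Prop :=
  ∀ x ∈ PP W S h, LinearIndepOn ℝ W {i | i ∈ S ∧ W i x + h i = 0}

lemma W_cont (f : (Fin n → ℝ) →ₗ[ℝ] ℝ) : Continuous f := f.continuous_of_finiteDimensional

lemma PP_closed2 (W : ι → (Fin n → ℝ) →ₗ[ℝ] ℝ) (S : Finset ι) :
    IsClosed {z : (ι → ℝ) × (Fin n → ℝ) | z.2 ∈ PP W S z.1} := by
  have : {z : (ι → ℝ) × (Fin n → ℝ) | z.2 ∈ PP W S z.1} = ⋂ i ∈ S, {z | 0 ≤ W i z.2 + z.1 i} := by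
    ext z; simp [PP]
  rw [this]
  refine isClosed_biInter fun i _ => isClosed_le continuous_const ?_
  have := W_cont (W i)
  fun_prop

lemma PP_closed (W : ι → (Fin n → ℝ) →ₗ[ℝ] ℝ) (S : Finset ι) (h : ι → ℝ) : IsClosed (PP W S h) :=
  (PP_closed2 W S).preimage (f := fun x => (h, x)) (by fun_prop)

lemma PP_bound {W : ι → (Fin n → ℝ) →ₗ[ℝ] ℝ} {S : Finset ι} (hb : Bdd W S) :
    ∃ R : ℝ, 0 ≤ R ∧ ∀ h x, x ∈ PP W S h → ‖x‖ ≤ R * ‖h‖ := by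
  have hc : Continuous fun x : Fin n → ℝ => ∑ i ∈ S, max 0 (- W i x) := by
    refine continuous_finsetSum _ fun i _ => ?_
    have := W_cont (W i)
    fun_prop
  obtain ⟨m, hm, hm'⟩ := (isCompact_sphere (0 : Fin n → ℝ) 1).exists_forall_le' hc.continuousOn (a := 0) (by
    intro x hx
    have h0 : 0 ≤ ∑ i ∈ S, max 0 (- W i x) := Finset.sum_nonneg fun i _ => le_max_left _ _
    refine lt_of_le_of_ne h0 fun he => ?_
    have h1 := (Finset.sum_eq_zero_iff_of_nonneg (fun i _ => le_max_left _ _)).1 he.symm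
    have h2 := hb x fun i hi => by
      have := h1 i hi
      have := le_max_right 0 (- W i x)
      linarith
    rw [h2] at hx
    simp at hx)
  refine ⟨S.card / m, by positivity, fun h x hx => ?_⟩
  by_cases hx0 : x = 0
  · rw [hx0, norm_zero]; positivity
  have hn : 0 < ‖x‖ := norm_pos_iff.2 hx0
  have h1 := hm' (‖x‖⁻¹ • x) (by simp [norm_smul, hn.ne'])
  have h2 : ∑ i ∈ S, max 0 (- W i (‖x‖⁻¹ • x)) ≤ ∑ i ∈ S, ‖x‖⁻¹ * ‖h‖ := by
    refine Finset.sum_le_sum fun i hi => ?_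
    have h3 := hx i hi
    have h4 : h i ≤ ‖h‖ := (le_abs_self _).trans (norm_le_pi_norm h i)
    refine max_le (by positivity) ?_
    rw [map_smul, smul_eq_mul, ← mul_neg]
    exact mul_le_mul_of_nonneg_left (by linarith) (by positivity)
  rw [Finset.sum_const, nsmul_eq_mul] at h2
  have h5 := h1.trans h2
  rw [div_mul_eq_mul_div, le_div_iff₀ hm]
  have := mul_le_mul_of_nonneg_left h5 hn.le
  calc ‖x‖ * m ≤ _ := this
    _ = _ := by field_simp

lemma PP_compact {W : ι → (Fin n → ℝ) →ₗ[ℝ] ℝ} {S : Finset ι} (hb : Bdd W S) (h : ι → ℝ) :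
    IsCompact (PP W S h) := by
  obtain ⟨R, _, hR⟩ := PP_bound hb
  exact (isCompact_closedBall (0 : Fin n → ℝ) (R * ‖h‖)).of_isClosed_subset (PP_closed W S h)
    fun x hx => by simpa using hR h x hx

lemma PP_compact2 {W : ι → (Fin n → ℝ) →ₗ[ℝ] ℝ} {S : Finset ι} (hb : Bdd W S) {X : Set (ι → ℝ)} (hX : IsCompact X) :
    IsCompact {z : (ι → ℝ) × (Fin n → ℝ) | z.1 ∈ X ∧ z.2 ∈ PP W S z.1} := by
  obtain ⟨R, hR0, hR⟩ := PP_bound hb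
  obtain ⟨r, hr⟩ := hX.isBounded.exists_norm_le
  refine (hX.prod (isCompact_closedBall (0 : Fin n → ℝ) (R * r))).of_isClosed_subset
    ((hX.isClosed.preimage continuous_fst).inter (PP_closed2 W S)) ?_
  rintro ⟨h, x⟩ ⟨h1, h2⟩
  refine ⟨h1, ?_⟩
  simp only [Metric.mem_closedBall, dist_zero_right]
  exact (hR h x h2).trans (mul_le_mul_of_nonneg_left (hr h h1) hR0)

lemma PP_empty_open {W : ι → (Fin n → ℝ) →ₗ[ℝ] ℝ} {S : Finset ι} (hb : Bdd W S) {h0 : ι → ℝ}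
    (he : PP W S h0 = ∅) : ∀ᶠ h in nhds h0, PP W S h = ∅ := by
  have hc := ((PP_compact2 hb (isCompact_closedBall h0 1)).image continuous_fst).isClosed
  have : h0 ∉ Prod.fst '' {z : (ι → ℝ) × (Fin n → ℝ) | z.1 ∈ Metric.closedBall h0 1 ∧ z.2 ∈ PP W S z.1} := by
    rintro ⟨⟨h, x⟩, ⟨_, h2⟩, rfl⟩
    simp only at h2 he
    rw [he] at h2; exact h2
  filter_upwards [hc.isOpen_compl.mem_nhds this, Metric.closedBall_mem_nhds h0 one_pos] with h h1 h2
  rw [Set.eq_empty_iff_forall_notMem]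
  exact fun x hx => h1 ⟨(h, x), ⟨h2, hx⟩, rfl⟩

noncomputable def vF (W : ι → (Fin n → ℝ) →ₗ[ℝ] ℝ) (S : Finset ι) (h : ι → ℝ) : ℝ := (volume (PP W S h)).toReal

lemma exists_coord {n : ℕ} (f : (Fin (n+1) → ℝ) →ₗ[ℝ] ℝ) (hf : f ≠ 0) :
    ∃ A : (Fin (n+1) → ℝ) →ₗ[ℝ] (Fin (n+1) → ℝ), Function.Injective A ∧ ∀ y, f (A y) = y 0 := by
  have h1 : Module.finrank ℝ (LinearMap.ker f) = n := by
    have := Module.Dual.finrank_ker_add_one_of_ne_zero hf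
    simpa using this
  have e : (Fin n → ℝ) ≃ₗ[ℝ] LinearMap.ker f := LinearEquiv.ofFinrankEq _ _ (by simp [h1])
  obtain ⟨v, hv⟩ : ∃ v, f v = 1 := LinearMap.surjective hf 1
  let A : (Fin (n+1) → ℝ) →ₗ[ℝ] (Fin (n+1) → ℝ) :=
    (LinearMap.proj (R := ℝ) (φ := fun _ : Fin (n+1) => ℝ) 0).smulRight v +
      (LinearMap.ker f).subtype ∘ₗ e.toLinearMap ∘ₗ (LinearMap.funLeft ℝ ℝ Fin.succ)
  have hA : ∀ y, A y = y 0 • v + (e (fun i => y i.succ) : Fin (n+1) → ℝ) := fun y => rfl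
  have hfA : ∀ y, f (A y) = y 0 := by
    intro y
    have := (e (fun i => y i.succ)).2
    rw [LinearMap.mem_ker] at this
    rw [hA, map_add, map_smul, hv, this]; simp
  refine ⟨A, ?_, hfA⟩
  rw [injective_iff_map_eq_zero]
  intro y hy
  have h0 : y 0 = 0 := by rw [← hfA y, hy, map_zero]
  rw [hA, h0, zero_smul, zero_add] at hy
  have h2 : e (fun i => y i.succ) = 0 := Subtype.ext hy
  rw [LinearEquiv.map_eq_zero_iff] at h2
  ext i
  refine Fin.cases h0 (fun i => ?_) i
  exact congrFun h2 i

lemma dir_deriv {F : (ι → ℝ) → ℝ} {q : ι → (ι → ℝ) → ℝ} {h0 : ι → ℝ}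
    (hq : ∀ i, ContinuousAt (q i) h0)
    (hd : ∀ i, ∀ᶠ h in nhds h0, HasDerivAt (fun t : ℝ => F (h + t • Pi.single i 1)) (q i h) 0) (v : ι → ℝ) :
    HasDerivAt (fun t : ℝ => F (h0 + t • v)) (∑ i, v i * q i h0) 0 := by
  have claim : ∀ J : Finset ι, ∀ ε > 0, ∃ δ > 0, ∀ a ∈ Metric.ball h0 δ, ∀ t : ℝ, |t| < δ →
      |F (a + t • ∑ i ∈ J, v i • Pi.single i 1) - F a - t * ∑ i ∈ J, v i * q i h0| ≤ ε * |t| := by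
    intro J
    induction J using Finset.induction_on with
    | empty => intro ε hε; exact ⟨1, one_pos, fun a _ t _ => by simp; positivity⟩
    | insert j J hj ih =>
      intro ε hε
      obtain ⟨δ1, hδ1, H1⟩ := ih (ε/2) (by positivity)
      obtain ⟨δ2, hδ2, H2⟩ := Metric.eventually_nhds_iff_ball.1 ((hd j).and
        ((hq j).eventually (Metric.ball_mem_nhds _ (show 0 < ε / (2 * (|v j| + 1)) by positivity))))
      set N := ‖∑ i ∈ J, v i • (Pi.single i 1 : ι → ℝ)‖ + |v j| + 1 with hN
      have hNp : 0 < N := by positivity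
      refine ⟨min δ1 (δ2 / 2 / N) ⊓ (δ2/2), by positivity, fun a ha t ht => ?_⟩
      have ha' : dist a h0 < δ2 / 2 := lt_of_lt_of_le ha inf_le_right
      have ha1 : a ∈ Metric.ball h0 δ1 := Metric.ball_subset_ball (inf_le_left.trans (min_le_left _ _)) ha
      have ht1 : |t| < δ1 := lt_of_lt_of_le ht (inf_le_left.trans (min_le_left _ _))
      have ht2 : |t| * N < δ2 / 2 := by
        rw [← lt_div_iff₀ hNp]; exact lt_of_lt_of_le ht (inf_le_left.trans (min_le_right _ _))
      have h1 := H1 a ha1 t ht1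
      set b := a + t • ∑ i ∈ J, v i • (Pi.single i 1 : ι → ℝ) with hb
      have hmem : ∀ s ∈ Set.Icc (0:ℝ) 1, b + (s * (t * v j)) • Pi.single j 1 ∈ Metric.ball h0 δ2 := by
        intro s hs
        rw [Metric.mem_ball]
        have e : dist (b + (s * (t * v j)) • Pi.single j 1) a ≤ |t| * N := by
          rw [dist_eq_norm, hb, add_right_comm, add_assoc, add_sub_cancel_left, add_comm]
          refine (norm_add_le _ _).trans ?_
          rw [norm_smul, norm_smul, Pi.norm_single, norm_one, mul_one, Real.norm_eq_abs, Real.norm_eq_abs, abs_mul, abs_mul, abs_of_nonneg hs.1]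
          have : s * (|t| * |v j|) ≤ |t| * |v j| := mul_le_of_le_one_left (by positivity) hs.2
          rw [hN]
          nlinarith [abs_nonneg t]
        linarith [dist_triangle (b + (s * (t * v j)) • Pi.single j 1) a h0]
      have h2 : |F (b + (t * v j) • Pi.single j 1) - F b - (t * v j) * q j h0| ≤ ε / 2 * |t| := by
        have hder : ∀ s ∈ Set.Icc (0:ℝ) 1, HasDerivWithinAt (fun s : ℝ => F (b + (s * (t * v j)) • Pi.single j 1) - s * (t * v j * q j h0))
            ((t * v j) * (q j (b + (s * (t * v j)) • Pi.single j 1) - q j h0)) (Set.Icc 0 1) s := by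
          intro s hs
          have hh := (H2 _ (hmem s hs)).1
          have hh2 : HasDerivAt (fun r : ℝ => (r - s) * (t * v j)) (t * v j) s := by
            have := ((hasDerivAt_id s).sub_const s).mul_const (t * v j)
            simpa using this
          have hh3 := HasDerivAt.comp s (h := fun r : ℝ => (r - s) * (t * v j))
            (h₂ := fun r : ℝ => F (b + (s * (t * v j)) • Pi.single j 1 + r • Pi.single j 1)) (by simpa using hh) hh2
          have hh4 : ((fun r : ℝ => F (b + (s * (t * v j)) • Pi.single j 1 + r • Pi.single j 1)) ∘ fun r : ℝ => (r - s) * (t * v j)) =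
              fun s : ℝ => F (b + (s * (t * v j)) • Pi.single j 1) := by
            funext r
            simp only [Function.comp]
            rw [add_assoc, ← add_smul]
            congr 3; ring
          rw [hh4] at hh3
          have hh5 := hh3.sub ((hasDerivAt_id s).mul_const (t * v j * q j h0))
          refine (hh5.congr_deriv ?_).hasDerivWithinAt
          ring
        have := Convex.norm_image_sub_le_of_norm_hasDerivWithin_le hder (C := ε/2*|t|) ?_ (convex_Icc 0 1)
          (Set.left_mem_Icc.2 zero_le_one) (Set.right_mem_Icc.2 zero_le_one)
        · simp only [one_mul, zero_mul, zero_smul, add_zero, sub_zero, norm_one, mul_one, Real.norm_eq_abs] at this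
          rw [show F (b + (t * v j) • Pi.single j 1) - F b - (t * v j) * q j h0 = F (b + (t * v j) • Pi.single j 1) - t * v j * q j h0 - F b by ring]
          exact this
        · intro s hs
          have h4 := (H2 _ (hmem s hs)).2
          rw [Real.dist_eq] at h4
          rw [Real.norm_eq_abs, abs_mul, abs_mul]
          have : |v j| * (ε / (2 * (|v j| + 1))) ≤ ε / 2 := by
            rw [mul_div_assoc', div_le_div_iff₀ (by positivity) (by positivity)]
            nlinarith [abs_nonneg (v j)]
          calc _ ≤ |t| * |v j| * (ε / (2 * (|v j| + 1))) := by gcongr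
            _ = |t| * (|v j| * (ε / (2 * (|v j| + 1)))) := by ring
            _ ≤ |t| * (ε / 2) := by gcongr
            _ = _ := by ring
      have e3 : a + t • ∑ i ∈ insert j J, v i • (Pi.single i 1 : ι → ℝ) = b + (t * v j) • Pi.single j 1 := by
        rw [Finset.sum_insert hj, hb, smul_add, smul_smul]; abel
      rw [e3, Finset.sum_insert hj]
      have e4 : F (b + (t * v j) • Pi.single j 1) - F a - t * (v j * q j h0 + ∑ i ∈ J, v i * q i h0) =
        (F (b + (t * v j) • Pi.single j 1) - F b - (t * v j) * q j h0) + (F b - F a - t * ∑ i ∈ J, v i * q i h0) := by ring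
      rw [e4]
      refine (abs_add_le _ _).trans ?_
      linarith
  have hv : ∑ i, v i • (Pi.single i 1 : ι → ℝ) = v := by
    ext j; simp [Pi.single_apply]
  rw [hasDerivAt_iff_isLittleO_nhds_zero, Asymptotics.isLittleO_iff]
  intro ε hε
  obtain ⟨δ, hδ, H⟩ := claim Finset.univ ε hε
  rw [hv] at H
  filter_upwards [Metric.ball_mem_nhds (0:ℝ) hδ] with t ht
  have := H h0 (Metric.mem_ball_self hδ) t (by simpa using ht)
  simpa using this
end Poly
end PartP6

section PartP7
open MeasureTheory

section Poly
variable {ι : Type} [Fintype ι] [DecidableEq ι] {n : ℕ}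

def cons0 (n : ℕ) : (Fin n → ℝ) →ₗ[ℝ] (Fin (n+1) → ℝ) where
  toFun x := Fin.cons 0 x
  map_add' x y := by
    ext i; refine Fin.cases ?_ (fun i => ?_) i <;> simp
  map_smul' a x := by
    ext i; refine Fin.cases ?_ (fun i => ?_) i <;> simp

lemma cons_eq (t : ℝ) (x : Fin n → ℝ) : (Fin.cons t x : Fin (n+1) → ℝ) = t • Pi.single 0 1 + cons0 n x := by
  ext i
  refine Fin.cases ?_ (fun i => ?_) i
  · simp [cons0]
  · simp [cons0]

/-- facet functionals -/
def Wf (W : ι → (Fin (n+1) → ℝ) →ₗ[ℝ] ℝ) (j : ι) : (Fin n → ℝ) →ₗ[ℝ] ℝ := (W j) ∘ₗ (cons0 n)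

def Wb (W : ι → (Fin (n+1) → ℝ) →ₗ[ℝ] ℝ) (j : ι) : ℝ := W j (Pi.single 0 1)

lemma W_cons (W : ι → (Fin (n+1) → ℝ) →ₗ[ℝ] ℝ) (j : ι) (t : ℝ) (x : Fin n → ℝ) :
    W j (Fin.cons t x) = t * Wb W j + Wf W j x := by
  rw [cons_eq, map_add, map_smul]; rfl

lemma Wf_bdd {W : ι → (Fin (n+1) → ℝ) →ₗ[ℝ] ℝ} {S : Finset ι} {i : ι} (hb : Bdd W S)
    (hW : ∀ x, W i x = x 0) : Bdd (Wf W) (S.erase i) := by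
  intro x hx
  have h1 := hb (cons0 n x) fun j hj => by
    by_cases hji : j = i
    · subst hji; rw [hW]; simp [cons0]
    · exact hx j (Finset.mem_erase.2 ⟨hji, hj⟩)
  ext k
  have := congrFun h1 k.succ
  simpa [cons0] using this

lemma mem_slice {W : ι → (Fin (n+1) → ℝ) →ₗ[ℝ] ℝ} {S : Finset ι} {i : ι} (hi : i ∈ S)
    (hW : ∀ x, W i x = x 0) (h : ι → ℝ) (t : ℝ) (x : Fin n → ℝ) :
    (Fin.cons t x : Fin (n+1) → ℝ) ∈ PP W S h ↔ -h i ≤ t ∧ x ∈ PP (Wf W) (S.erase i) (h + t • Wb W) := by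
  constructor
  · intro hx
    refine ⟨?_, fun j hj => ?_⟩
    · have := hx i hi; rw [hW] at this; simp at this; linarith
    · have := hx j (Finset.mem_of_mem_erase hj)
      rw [W_cons] at this
      simp only [Pi.add_apply, Pi.smul_apply, smul_eq_mul]
      linarith
  · rintro ⟨h1, h2⟩ j hj
    by_cases hji : j = i
    · subst hji; rw [hW]; simp; linarith
    · have := h2 j (Finset.mem_erase.2 ⟨hji, hj⟩)
      rw [W_cons]
      simp only [Pi.add_apply, Pi.smul_apply, smul_eq_mul] at this
      linarith

lemma Wf_simp {W : ι → (Fin (n+1) → ℝ) →ₗ[ℝ] ℝ} {S : Finset ι} {i : ι} (hi : i ∈ S)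
    (hW : ∀ x, W i x = x 0) {h : ι → ℝ} (hs : Simp W S h) : Simp (Wf W) (S.erase i) (h + (- h i) • Wb W) := by
  intro x hx
  have h1 := hs (Fin.cons (- h i) x) ((mem_slice hi hW h _ x).2 ⟨le_rfl, hx⟩)
  set J := {j | j ∈ S.erase i ∧ Wf W j x + (h + (- h i) • Wb W) j = 0} with hJ
  have hiJ : i ∉ J := fun h => by simp [hJ] at h
  have h2 : LinearIndepOn ℝ W (insert i J) := by
    refine h1.mono ?_
    rintro j (rfl | hj)
    · refine ⟨hi, ?_⟩; rw [hW]; simp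
    · refine ⟨Finset.mem_of_mem_erase hj.1, ?_⟩
      have := hj.2
      rw [W_cons]
      simp only [Pi.add_apply, Pi.smul_apply, smul_eq_mul] at this
      linarith
  rw [linearIndepOn_insert hiJ] at h2
  obtain ⟨h3, h4⟩ := h2
  let f : ((Fin (n+1) → ℝ) →ₗ[ℝ] ℝ) →ₗ[ℝ] ((Fin n → ℝ) →ₗ[ℝ] ℝ) := LinearMap.lcomp ℝ ℝ (cons0 n)
  have h5 : Wf W = f ∘ W := rfl
  rw [h5]
  refine h3.map_injOn f ?_
  rw [← LinearMap.disjoint_ker_iff_injOn]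
  rw [Submodule.disjoint_def]
  intro g hg hg0
  have hg1 : ∀ x, g x = g (Pi.single 0 1) * x 0 := by
    intro x
    have h6 : g (cons0 n (Fin.tail x)) = 0 := LinearMap.congr_fun (LinearMap.mem_ker.1 hg0) (Fin.tail x)
    conv_lhs => rw [← Fin.cons_self_tail x, cons_eq, map_add, map_smul, h6]
    simp [mul_comm]
  by_contra hne
  have hc : g (Pi.single 0 1) ≠ 0 := fun hc => hne (LinearMap.ext fun x => by rw [hg1 x, hc, zero_mul]; rfl)
  refine h4 ?_
  have : W i = (g (Pi.single 0 1))⁻¹ • g := by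
    refine LinearMap.ext fun x => ?_
    rw [hW, LinearMap.smul_apply, hg1 x, smul_eq_mul, inv_mul_cancel_left₀ hc]
  rw [this]
  exact Submodule.smul_mem _ _ hg

lemma vF_slice {W : ι → (Fin (n+1) → ℝ) →ₗ[ℝ] ℝ} {S : Finset ι} {i : ι} (hb : Bdd W S) (hi : i ∈ S)
    (hW : ∀ x, W i x = x 0) (h : ι → ℝ) :
    IntegrableOn (fun t : ℝ => vF (Wf W) (S.erase i) (h + t • Wb W)) (Set.Ioi (- h i)) ∧
    vF W S h = ∫ t in Set.Ioi (- h i), vF (Wf W) (S.erase i) (h + t • Wb W) := by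
  set G : ℝ → ENNReal := fun t => volume (PP (Wf W) (S.erase i) (h + t • Wb W)) with hG
  have hGm : Measurable G := by
    have hZ : MeasurableSet {z : ℝ × (Fin n → ℝ) | z.2 ∈ PP (Wf W) (S.erase i) (h + z.1 • Wb W)} := by
      have := (PP_closed2 (Wf W) (S.erase i)).preimage (f := fun z : ℝ × (Fin n → ℝ) => (h + z.1 • Wb W, z.2)) (by fun_prop)
      exact this.measurableSet
    exact measurable_measure_prodMk_left hZ
  have e := (volume_preserving_piFinSuccAbove (fun _ : Fin (n+1) => ℝ) 0).symm
  have hv : volume (PP W S h) = ∫⁻ t in Set.Ioi (- h i), G t := by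
    rw [← e.measure_preimage (PP_closed W S h).measurableSet.nullMeasurableSet, Measure.volume_eq_prod,
      Measure.prod_apply ((PP_closed W S h).measurableSet.preimage e.measurable), setLIntegral_congr Ioi_ae_eq_Ici,
      ← lintegral_indicator measurableSet_Ici]
    refine lintegral_congr fun t => ?_
    have : (Prod.mk t ⁻¹' ((MeasurableEquiv.piFinSuccAbove (fun x : Fin (n+1) => ℝ) 0).symm ⁻¹' PP W S h)) =
        {x : Fin n → ℝ | (Fin.cons t x : Fin (n+1) → ℝ) ∈ PP W S h} := by
      ext x; simp [MeasurableEquiv.piFinSuccAbove, Fin.insertNthEquiv]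
    rw [this]
    simp only [mem_slice hi hW]
    by_cases ht : t ∈ Set.Ici (- h i)
    · rw [Set.indicator_of_mem ht]
      simp only [Set.mem_Ici] at ht
      simp [ht, hG]
    · rw [Set.indicator_of_notMem ht]
      simp only [Set.mem_Ici] at ht
      simp [ht]
  have hfin : ∫⁻ t in Set.Ioi (- h i), G t ≠ ⊤ := by
    rw [← hv]; exact (PP_compact hb h).measure_lt_top.ne
  refine ⟨integrable_toReal_of_lintegral_ne_top hGm.aemeasurable hfin, ?_⟩
  unfold vF
  rw [hv, integral_toReal hGm.aemeasurable]
  exact ae_lt_top hGm hfin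

def LocPoly (n : ℕ) (ι : Type) [Fintype ι] [DecidableEq ι] : Prop :=
  ∀ (W : ι → (Fin n → ℝ) →ₗ[ℝ] ℝ) (S : Finset ι) (h0 : ι → ℝ), Bdd W S → Simp W S h0 →
    ∃ p : MvPolynomial ι ℝ, p.IsHomogeneous n ∧ ∀ᶠ h in nhds h0, vF W S h = MvPolynomial.eval h p

lemma vF_congr {W : ι → (Fin n → ℝ) →ₗ[ℝ] ℝ} {S : Finset ι} {h h' : ι → ℝ} (hh : ∀ i ∈ S, h i = h' i) :
    vF W S h = vF W S h' := by
  unfold vF; congr 2; ext x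
  exact forall₂_congr fun i hi => by rw [hh i hi]

lemma facet_deriv (ih : LocPoly n ι) {W : ι → (Fin (n+1) → ℝ) →ₗ[ℝ] ℝ} {S : Finset ι} {i : ι} {h0 : ι → ℝ}
    (hb : Bdd W S) (hi : i ∈ S) (hW : ∀ x, W i x = x 0) (hs : Simp W S h0) :
    ∃ q : MvPolynomial ι ℝ, q.IsHomogeneous n ∧ ∀ᶠ h in nhds h0,
      HasDerivAt (fun t : ℝ => vF W S (h + t • Pi.single i 1)) (MvPolynomial.eval h q) 0 := by
  obtain ⟨q, hq, hev⟩ := ih (Wf W) (S.erase i) _ (Wf_bdd hb hW) (Wf_simp hi hW hs)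
  refine ⟨MvPolynomial.aeval (fun j => MvPolynomial.X j - MvPolynomial.C (Wb W j) * MvPolynomial.X i) q, ?_, ?_⟩
  · have := hq.aeval (n := 1) (fun j => (MvPolynomial.X j - MvPolynomial.C (Wb W j) * MvPolynomial.X i : MvPolynomial ι ℝ)) ?_
    · simpa using this
    · intro j
      exact (MvPolynomial.isHomogeneous_X _ _).sub ((MvPolynomial.isHomogeneous_X _ _).C_mul _)
  have heval : ∀ h : ι → ℝ, MvPolynomial.eval h (MvPolynomial.aeval (fun j => MvPolynomial.X j - MvPolynomial.C (Wb W j) * MvPolynomial.X i) q)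
      = MvPolynomial.eval (h + (- h i) • Wb W) q := by
    intro h
    rw [MvPolynomial.aeval_def, MvPolynomial.algebraMap_eq, MvPolynomial.eval_eval₂]
    rw [← MvPolynomial.eval₂_id]
    congr 1
    · ext; simp
    · ext j; simp; ring
  have hc : Continuous fun h : ι → ℝ => h + (- h i) • Wb W := by fun_prop
  filter_upwards [(hc.tendsto h0).eventually hev.eventually_nhds] with h hh
  rw [heval]
  set g : ℝ → ℝ := fun t => vF (Wf W) (S.erase i) (h + t • Wb W) with hg
  have hgt : ∀ᶠ t in nhds (- h i), g t = MvPolynomial.eval (h + t • Wb W) q := by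
    have hc2 : Continuous fun t : ℝ => h + t • Wb W := by fun_prop
    exact (hc2.tendsto (- h i)).eventually hh
  have hgc : ContinuousAt g (- h i) := by
    refine ContinuousAt.congr ?_ (Filter.EventuallyEq.symm hgt)
    refine Continuous.continuousAt ?_
    have := MvPolynomial.continuous_eval q
    fun_prop
  have hpe : ∀ t : ℝ, (h + t • (Pi.single i 1 : ι → ℝ)) i = h i + t := by intro t; simp
  have hsl : ∀ t : ℝ, IntegrableOn g (Set.Ioi (- (h i + t))) ∧ vF W S (h + t • Pi.single i 1) = ∫ t in Set.Ioi (- (h i + t)), g t := by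
    intro t
    have := vF_slice hb hi hW (h + t • Pi.single i 1)
    rw [hpe] at this
    have e : (fun s : ℝ => vF (Wf W) (S.erase i) (h + t • Pi.single i 1 + s • Wb W)) = g := by
      funext s
      refine vF_congr fun j hj => ?_
      simp [Finset.ne_of_mem_erase hj]
    rw [e] at this
    exact this
  have hfun : (fun t : ℝ => vF W S (h + t • Pi.single i 1)) =
      fun t => (∫ s in Set.Ioi (- h i), g s) + ∫ s in (- (h i + t))..(- h i), g s := by
    funext t
    have i0 := (hsl 0).1
    rw [add_zero] at i0
    rw [(hsl t).2, ← intervalIntegral.integral_Ioi_sub_Ioi' (hsl t).1 i0]; ring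
  rw [hfun]
  have hgm : StronglyMeasurableAtFilter g (nhds (- h i)) := by
    refine ⟨Set.Ioi (- (h i + 1)), Ioi_mem_nhds (by linarith), (hsl 1).1.aestronglyMeasurable⟩
  have hd := intervalIntegral.integral_hasDerivAt_left (f := g) (a := - h i) (b := - h i) (by simp) hgm hgc
  have hd2 : HasDerivAt (fun t : ℝ => - (h i + t)) (-1) 0 := by
    exact ((hasDerivAt_id (0:ℝ)).const_add (h i)).neg
  have hd3 := HasDerivAt.comp (0:ℝ) (h := fun t : ℝ => - (h i + t)) (h₂ := fun u => ∫ s in u..(- h i), g s) (by simpa using hd) hd2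
  refine (hd3.const_add _).congr_deriv ?_
  rw [hgt.self_of_nhds]; ring
end Poly
end PartP7

section PartP7b
open MeasureTheory

section Poly
variable {ι : Type} [Fintype ι] [DecidableEq ι] {n : ℕ}

lemma PP_lin {W : ι → (Fin n → ℝ) →ₗ[ℝ] ℝ} {S : Finset ι} (A : (Fin n → ℝ) →ₗ[ℝ] (Fin n → ℝ)) (h : ι → ℝ) :
    PP (fun i => W i ∘ₗ A) S h = A ⁻¹' PP W S h := rfl

lemma vF_lin {W : ι → (Fin n → ℝ) →ₗ[ℝ] ℝ} {S : Finset ι} {A : (Fin n → ℝ) →ₗ[ℝ] (Fin n → ℝ)}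
    (hA : LinearMap.det A ≠ 0) (h : ι → ℝ) :
    vF W S h = |LinearMap.det A| * vF (fun i => W i ∘ₗ A) S h := by
  unfold vF
  rw [PP_lin, Measure.addHaar_preimage_linearMap _ hA, ENNReal.toReal_mul, ENNReal.toReal_ofReal (abs_nonneg _), abs_inv,
    ← mul_assoc, mul_inv_cancel₀ (abs_ne_zero.2 hA), one_mul]

lemma vF_homog {W : ι → (Fin n → ℝ) →ₗ[ℝ] ℝ} {S : Finset ι} {s : ℝ} (hs : 0 < s) (h : ι → ℝ) :
    vF W S (s • h) = s ^ n * vF W S h := by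
  have : PP W S h = (fun x => s • x) ⁻¹' PP W S (s • h) := by
    ext x
    refine forall₂_congr fun i _ => ?_
    rw [map_smul, Pi.smul_apply, ← smul_add, smul_eq_mul, mul_nonneg_iff_of_pos_left hs]
  unfold vF
  rw [this, Measure.addHaar_preimage_smul _ hs.ne', ENNReal.toReal_mul, ENNReal.toReal_ofReal (abs_nonneg _)]
  simp only [Module.finrank_fintype_fun_eq_card, Fintype.card_fin, abs_inv]
  rw [abs_of_pos (by positivity), ← mul_assoc, mul_inv_cancel₀ (by positivity), one_mul]

lemma coord_deriv (ih : LocPoly n ι) {W : ι → (Fin (n+1) → ℝ) →ₗ[ℝ] ℝ} {S : Finset ι} {h0 : ι → ℝ}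
    (hb : Bdd W S) (hs : Simp W S h0) (hne : (PP W S h0).Nonempty) (i : ι) :
    ∃ q : MvPolynomial ι ℝ, q.IsHomogeneous n ∧ ∀ᶠ h in nhds h0,
      HasDerivAt (fun t : ℝ => vF W S (h + t • Pi.single i 1)) (MvPolynomial.eval h q) 0 := by
  by_cases hi : i ∈ S
  swap
  · refine ⟨0, MvPolynomial.isHomogeneous_zero _ _ _, Filter.Eventually.of_forall fun h => ?_⟩
    have : (fun t : ℝ => vF W S (h + t • Pi.single i 1)) = fun _ => vF W S h := by
      funext t
      refine vF_congr fun j hj => ?_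
      have : j ≠ i := fun e => hi (e ▸ hj)
      simp [this]
    rw [this, map_zero]
    exact hasDerivAt_const _ _
  by_cases hW : W i = 0
  · refine ⟨0, MvPolynomial.isHomogeneous_zero _ _ _, ?_⟩
    have hpos : 0 < h0 i := by
      obtain ⟨x, hx⟩ := hne
      have h1 := hx i hi
      rw [hW] at h1
      simp only [LinearMap.zero_apply, zero_add] at h1
      refine lt_of_le_of_ne h1 fun h2 => ?_
      refine (hs x hx).ne_zero (i := i) ⟨hi, ?_⟩ hW
      rw [hW, ← h2]; simp
    have hev : ∀ᶠ h in nhds h0, 0 < h i := (continuous_apply i).tendsto h0 |>.eventually (lt_mem_nhds hpos)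
    filter_upwards [hev] with h hh
    rw [map_zero]
    refine (hasDerivAt_const (0:ℝ) (vF W S h)).congr_of_eventuallyEq ?_
    have : ∀ᶠ t : ℝ in nhds 0, 0 < h i + t := by
      have hc : Continuous fun t : ℝ => h i + t := by fun_prop
      exact (hc.tendsto 0).eventually (lt_mem_nhds (by simpa using hh))
    filter_upwards [this] with t ht
    unfold vF; congr 2; ext x
    refine forall₂_congr fun j _ => ?_
    by_cases hj : j = i
    · subst hj
      simp [hW, hh.le, ht.le]
    · simp [hj]
  · obtain ⟨A, hA, hAW⟩ := exists_coord (W i) hW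
    have hdet : LinearMap.det A ≠ 0 := by
      have := LinearEquiv.isUnit_det' (LinearEquiv.ofInjectiveEndo A hA)
      exact this.ne_zero
    have hsurj : Function.Surjective A := LinearMap.injective_iff_surjective.1 hA
    obtain ⟨q, hq, hev⟩ := facet_deriv ih (W := fun j => W j ∘ₗ A) (S := S) (i := i) (h0 := h0)
      (fun x hx => hA (by rw [hb (A x) hx, map_zero])) hi hAW (by
        intro x hx
        have h1 := hs (A x) hx
        let f : ((Fin (n+1) → ℝ) →ₗ[ℝ] ℝ) →ₗ[ℝ] ((Fin (n+1) → ℝ) →ₗ[ℝ] ℝ) := LinearMap.lcomp ℝ ℝ A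
        have hf : Function.Injective f := by
          intro g g' hg
          refine LinearMap.ext fun y => ?_
          obtain ⟨z, rfl⟩ := hsurj y
          exact LinearMap.congr_fun hg z
        exact h1.map_injOn f hf.injOn)
    refine ⟨MvPolynomial.C |LinearMap.det A| * q, hq.C_mul _, ?_⟩
    filter_upwards [hev] with h hh
    rw [show (fun t : ℝ => vF W S (h + t • Pi.single i 1)) = fun t => _ * vF (fun j => W j ∘ₗ A) S (h + t • Pi.single i 1)
      from funext fun t => vF_lin hdet _, map_mul, MvPolynomial.eval_C]
    exact hh.const_mul _

theorem locPoly : ∀ n, LocPoly n ι := by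
  intro n
  induction n with
  | zero =>
    intro W S h0 hb hs
    rcases Set.eq_empty_or_nonempty (PP W S h0) with he | ⟨x, hx⟩
    · refine ⟨0, MvPolynomial.isHomogeneous_zero _ _ _, ?_⟩
      filter_upwards [PP_empty_open hb he] with h hh
      simp [vF, hh]
    · refine ⟨MvPolynomial.C 1, MvPolynomial.isHomogeneous_C _ _, ?_⟩
      have hW0 : ∀ i, W i = 0 := fun i => LinearMap.ext fun y => by rw [Subsingleton.elim y 0, map_zero]; simp
      have hpos : ∀ i ∈ S, 0 < h0 i := by
        intro i hi
        have h1 := hx i hi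
        rw [hW0] at h1
        simp only [LinearMap.zero_apply, zero_add] at h1
        refine lt_of_le_of_ne h1 fun h2 => ?_
        refine (hs x hx).ne_zero (i := i) ⟨hi, ?_⟩ (hW0 i)
        rw [hW0, ← h2]; simp
      have hev : ∀ᶠ h in nhds h0, ∀ i ∈ S, 0 < h i :=
        (Filter.eventually_all_finset S).2 fun i hi => (continuous_apply i).tendsto h0 |>.eventually (lt_mem_nhds (hpos i hi))
      filter_upwards [hev] with h hh
      have : PP W S h = Set.univ := by
        ext y; simp only [PP, Set.mem_ofPred_eq, Set.mem_univ, iff_true]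
        intro i hi; rw [hW0]; simpa using (hh i hi).le
      rw [vF, this]
      simp [volume_pi]
  | succ n ih =>
    intro W S h0 hb hs
    rcases Set.eq_empty_or_nonempty (PP W S h0) with he | hne
    · refine ⟨0, MvPolynomial.isHomogeneous_zero _ _ _, ?_⟩
      filter_upwards [PP_empty_open hb he] with h hh
      simp [vF, hh]
    choose q hq hev using coord_deriv ih hb hs hne
    refine ⟨MvPolynomial.C ((n+1 : ℝ)⁻¹) * ∑ i, MvPolynomial.X i * q i, ?_, ?_⟩
    · refine MvPolynomial.IsHomogeneous.C_mul (MvPolynomial.IsHomogeneous.sum _ _ _ fun i _ => ?_) _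
      rw [add_comm]
      exact (MvPolynomial.isHomogeneous_X _ _).mul (hq i)
    have hev2 := (Filter.eventually_all.2 hev).eventually_nhds
    filter_upwards [hev2] with h hh
    have h1 := dir_deriv (F := vF W S) (q := fun i h => MvPolynomial.eval h (q i)) (h0 := h)
      (fun i => (MvPolynomial.continuous_eval (q i)).continuousAt) (fun i => hh.mono fun _ h => h i) h
    have h2 : HasDerivAt (fun t : ℝ => vF W S (h + t • h)) ((n+1) * vF W S h) 0 := by
      have h3 : HasDerivAt (fun t : ℝ => (1 + t) ^ (n+1) * vF W S h) ((n+1) * vF W S h) 0 := by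
        have := (((hasDerivAt_id (0:ℝ)).const_add 1).pow (n+1)).mul_const (vF W S h)
        simpa using this
      refine h3.congr_of_eventuallyEq ?_
      filter_upwards [lt_mem_nhds (show (-1:ℝ) < 0 by norm_num)] with t ht
      rw [← vF_homog (by linarith), add_smul, one_smul]
    have h4 := h1.unique h2
    simp only [map_mul, map_sum, MvPolynomial.eval_C, MvPolynomial.eval_X]
    rw [h4, ← mul_assoc, inv_mul_cancel₀ (by positivity), one_mul]
end Poly
end PartP7b

section PartP8
open MeasureTheory

section Geo
variable {ι : Type} [Fintype ι] [DecidableEq ι] {n : ℕ}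

lemma mD_map_smul (a : ℝ) (s : Multiset (ι → ℝ)) (p : MvPolynomial ι ℝ) :
    mD (s.map fun v => a • v) p = a ^ s.card • mD s p := by
  induction s using Multiset.induction_on with
  | empty => simp
  | cons v s ih => rw [Multiset.map_cons, mD_cons, mD_cons, ih, dD_smul_left, dD_smul, smul_smul, Multiset.card_cons, pow_succ']

def slab (W : ι → (Fin n → ℝ) →ₗ[ℝ] ℝ) (T : Finset ι) (ε : ℝ) (h : ι → ℝ) : Set (Fin n → ℝ) :=
  {x | x ∈ PP W Finset.univ h ∧ ∀ i ∈ T, W i x + h i < ε}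

lemma slab_meas (W : ι → (Fin n → ℝ) →ₗ[ℝ] ℝ) (T : Finset ι) (ε : ℝ) (h : ι → ℝ) : MeasurableSet (slab W T ε h) := by
  have : slab W T ε h = PP W Finset.univ h ∩ ⋂ i ∈ T, {x | W i x + h i < ε} := by
    ext x; simp [slab]
  rw [this]
  refine (PP_closed W _ h).measurableSet.inter (Finset.measurableSet_biInter _ fun i _ => ?_)
  refine (isOpen_lt ?_ continuous_const).measurableSet
  have := W_cont (W i)
  fun_prop

lemma slab_fin {W : ι → (Fin n → ℝ) →ₗ[ℝ] ℝ} (hb : Bdd W Finset.univ) (T : Finset ι) (ε : ℝ) (h : ι → ℝ) :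
    volume (slab W T ε h) ≠ ⊤ :=
  ((measure_mono fun x hx => hx.1).trans_lt (PP_compact hb h).measure_lt_top).ne

lemma slab_sum {W : ι → (Fin n → ℝ) →ₗ[ℝ] ℝ} (hb : Bdd W Finset.univ) {ε : ℝ} (hε : 0 < ε) (T : Finset ι) : ∀ h : ι → ℝ,
    (volume (slab W T ε h)).toReal = ∑ S ∈ T.powerset, (-1 : ℝ) ^ S.card *
      vF W Finset.univ (h + ∑ k ∈ S, (-ε) • (Pi.single k 1 : ι → ℝ)) := by
  induction T using Finset.induction_on with
  | empty => intro h; simp [slab, vF]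
  | insert j T hj ih =>
    intro h
    rw [Finset.sum_powerset_insert hj, ← ih h]
    have e1 : ∑ S ∈ T.powerset, (-1 : ℝ) ^ (insert j S).card *
      vF W Finset.univ (h + ∑ k ∈ insert j S, (-ε) • (Pi.single k 1 : ι → ℝ)) = - (volume (slab W T ε (h + (-ε) • Pi.single j 1))).toReal := by
      rw [ih, ← Finset.sum_neg_distrib]
      refine Finset.sum_congr rfl fun S hS => ?_
      have : j ∉ S := fun h => hj (Finset.mem_powerset.1 hS h)
      rw [Finset.sum_insert this, Finset.card_insert_of_notMem this, ← add_assoc, pow_succ]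
      ring
    rw [e1]
    have hsub : slab W T ε (h + (-ε) • Pi.single j 1) ⊆ slab W T ε h := by
      rintro x ⟨h1, h2⟩
      refine ⟨fun i hi => ?_, fun i hi => ?_⟩
      · have := h1 i hi
        by_cases hij : i = j
        · subst hij; simp at this; linarith
        · simpa [hij] using this
      · have := h2 i hi
        have hij : i ≠ j := fun e => hj (e ▸ hi)
        simpa [hij] using this
    have e2 : slab W (insert j T) ε h = slab W T ε h \ slab W T ε (h + (-ε) • Pi.single j 1) := by
      ext x
      constructor
      · rintro ⟨h1, h2⟩
        refine ⟨⟨h1, fun i hi => h2 i (Finset.mem_insert_of_mem hi)⟩, fun h3 => ?_⟩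
        have h4 := h3.1 j (Finset.mem_univ _)
        have h5 := h2 j (Finset.mem_insert_self _ _)
        simp at h4; linarith
      · rintro ⟨⟨h1, h2⟩, h3⟩
        refine ⟨h1, fun i hi => ?_⟩
        rcases Finset.mem_insert.1 hi with rfl | hi
        · by_contra hc
          push Not at hc
          refine h3 ⟨fun k hk => ?_, fun k hk => ?_⟩
          · by_cases hij : k = i
            · subst hij; simp; linarith
            · simpa [hij] using h1 k hk
          · have hij : k ≠ i := fun e => hj (e ▸ hk)
            simpa [hij] using h2 k hk
        · exact h2 i hi
    rw [e2, measure_sdiff hsub (slab_meas _ _ _ _).nullMeasurableSet (slab_fin hb _ _ _),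
      ENNReal.toReal_sub_of_le (measure_mono hsub) (slab_fin hb _ _ _)]
    ring

lemma slab_lim {W : ι → (Fin n → ℝ) →ₗ[ℝ] ℝ} (hb : Bdd W Finset.univ) {C : Set (ι → ℝ)} (hC : IsOpen C)
    {p : MvPolynomial ι ℝ} (hp : ∀ h ∈ C, vF W Finset.univ h = MvPolynomial.eval h p) (T : Finset ι) {c : ι → ℝ} (hc : c ∈ C) :
    Filter.Tendsto (fun ε : ℝ => (volume (slab W T ε c)).toReal / ε ^ T.card) (nhdsWithin 0 (Set.Ioi 0))
      (nhds (MvPolynomial.eval c (fT p T))) := by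
  choose θ hθ hθe using fun ε : ℝ => mvt_iter T (fun k => (-ε) • (Pi.single k 1 : ι → ℝ)) p c
  have hlim : ∀ η : ℝ → ι → ℝ, (∀ ε k, η ε k ∈ Set.Icc (0:ℝ) 1) →
      Filter.Tendsto (fun ε : ℝ => c + ∑ k ∈ T, η ε k • (-ε) • (Pi.single k 1 : ι → ℝ)) (nhdsWithin 0 (Set.Ioi 0)) (nhds c) := by
    intro η hη
    have : Filter.Tendsto (fun ε : ℝ => c + ∑ k ∈ T, η ε k • (-ε) • (Pi.single k 1 : ι → ℝ)) (nhdsWithin 0 (Set.Ioi 0)) (nhds (c + ∑ k ∈ T, 0)) := by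
      refine tendsto_const_nhds.add (tendsto_finsetSum _ fun k _ => ?_)
      rw [tendsto_zero_iff_norm_tendsto_zero]
      have h1 : Filter.Tendsto (fun ε : ℝ => |ε|) (nhdsWithin 0 (Set.Ioi 0)) (nhds 0) := by
        have : Continuous fun ε : ℝ => |ε| := continuous_abs
        simpa using (this.tendsto 0).mono_left nhdsWithin_le_nhds
      refine squeeze_zero (fun _ => norm_nonneg _) (fun ε => ?_) h1
      rw [norm_smul, norm_smul, Pi.norm_single, norm_one, mul_one, norm_neg, Real.norm_eq_abs, Real.norm_eq_abs, abs_of_nonneg (hη ε k).1]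
      exact mul_le_of_le_one_left (abs_nonneg _) (hη ε k).2
    simpa using this
  have hS : ∀ᶠ ε in nhdsWithin (0:ℝ) (Set.Ioi 0), ∀ S ∈ T.powerset, c + ∑ k ∈ S, (-ε) • (Pi.single k 1 : ι → ℝ) ∈ C := by
    refine (Filter.eventually_all_finset _).2 fun S hS => ?_
    have := (hlim (fun ε k => if k ∈ S then 1 else 0) (fun ε k => by split_ifs <;> simp)).eventually (hC.mem_nhds hc)
    filter_upwards [this] with ε hε
    have e : ∑ k ∈ S, (-ε) • (Pi.single k 1 : ι → ℝ) = ∑ k ∈ T, (if k ∈ S then (1:ℝ) else 0) • (-ε) • (Pi.single k 1 : ι → ℝ) := by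
      simp only [ite_smul, one_smul, zero_smul]
      rw [← Finset.sum_filter, Finset.filter_mem_eq_inter, Finset.inter_eq_right.2 (Finset.mem_powerset.1 hS)]
    rw [e]
    exact hε
  have hev := ((MvPolynomial.continuous_eval (fT p T)).tendsto c).comp (hlim θ hθ)
  refine hev.congr' ?_
  filter_upwards [hS, self_mem_nhdsWithin] with ε hε hpos
  have hpos : 0 < ε := hpos
  rw [slab_sum hb hpos, eq_div_iff (by positivity)]
  have h1 := hθe ε
  have h2 : T.val.map (fun k => (-ε) • (Pi.single k 1 : ι → ℝ)) = (eT T).map fun v => (-ε) • v := by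
    simp [eT]
  rw [h2, mD_map_smul, MvPolynomial.smul_eval] at h1
  have h3 : (eT T).card = T.card := by simp [eT]
  rw [h3] at h1
  simp only [Function.comp]
  have h4 : ∑ S ∈ T.powerset, (-1 : ℝ) ^ S.card * vF W Finset.univ (c + ∑ k ∈ S, (-ε) • (Pi.single k 1 : ι → ℝ)) =
      (-1) ^ T.card * ∑ S ∈ T.powerset, (-1 : ℝ) ^ (S.card + T.card) * MvPolynomial.eval (c + ∑ k ∈ S, (-ε) • (Pi.single k 1 : ι → ℝ)) p := by
    rw [Finset.mul_sum]
    refine Finset.sum_congr rfl fun S hS => ?_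
    rw [hp _ (hε S hS), pow_add]
    have : (-1 : ℝ) ^ T.card * (-1) ^ T.card = 1 := by rw [← mul_pow]; simp
    linear_combination (- (-1 : ℝ) ^ S.card * (MvPolynomial.eval (c + ∑ k ∈ S, (-ε) • (Pi.single k 1 : ι → ℝ))) p) * this
  rw [h4, h1, ← mul_assoc, ← mul_pow, neg_one_mul, neg_neg, mul_comm]
  rfl

theorem core_of {W : ι → (Fin n → ℝ) →ₗ[ℝ] ℝ} (hb : Bdd W Finset.univ) {C : Set (ι → ℝ)} (hC : IsOpen C) (hne : C.Nonempty)
    {p : MvPolynomial ι ℝ} (hom : p.IsHomogeneous n) (hp : ∀ h ∈ C, vF W Finset.univ h = MvPolynomial.eval h p) :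
    CoreHyp n p C (LinearMap.range (LinearMap.pi W)) := by
  have hnn : ∀ T, ∀ c ∈ C, 0 ≤ MvPolynomial.eval c (fT p T) := by
    intro T c hc
    refine ge_of_tendsto (slab_lim hb hC hp T hc) ?_
    filter_upwards [self_mem_nhdsWithin] with ε (hε : 0 < ε)
    positivity
  have hlc : ∀ T : Finset ι, ∀ c v, c + v ∈ C → c - v ∈ C → c ∈ C →
    MvPolynomial.eval (c + v) (fT p T) * MvPolynomial.eval (c - v) (fT p T) ≤ MvPolynomial.eval c (fT p T) ^ 2 := by
    intro T c v h1 h2 h3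
    refine le_of_tendsto_of_tendsto ((slab_lim hb hC hp T h1).mul (slab_lim hb hC hp T h2)) ((slab_lim hb hC hp T h3).pow 2) ?_
    filter_upwards [self_mem_nhdsWithin] with ε (hε : 0 < ε)
    have := bm_set (slab_meas W T ε (c + v)) (slab_meas W T ε (c - v)) (slab_meas W T ε c) (by
      rintro a ⟨ha1, ha2⟩ b ⟨hb1, hb2⟩
      refine ⟨fun i hi => ?_, fun i hi => ?_⟩
      · have h1 := ha1 i hi
        have h2 := hb1 i hi
        rw [map_smul, map_add, smul_eq_mul]
        simp only [Pi.add_apply, Pi.sub_apply] at h1 h2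
        linarith
      · have h1 := ha2 i hi
        have h2 := hb2 i hi
        rw [map_smul, map_add, smul_eq_mul]
        simp only [Pi.add_apply, Pi.sub_apply] at h1 h2
        linarith)
    have h4 := ENNReal.toReal_mono (by finiteness [slab_fin hb T ε c]) this
    rw [ENNReal.toReal_mul, ENNReal.toReal_pow] at h4
    rw [div_mul_div_comm, div_pow, ← pow_two]
    gcongr
  have hpos : ∀ T : Finset ι, fT p T = 0 ∨ ∀ c ∈ C, 0 < MvPolynomial.eval c (fT p T) := by
    intro T
    by_contra hcon
    push Not at hcon
    obtain ⟨hf, c, hc, hc0⟩ := hcon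
    have hc0 := le_antisymm hc0 (hnn T c hc)
    obtain ⟨r, hr, hball⟩ := Metric.isOpen_iff.1 hC c hc
    set U := {x | x ∈ Metric.ball c r ∧ MvPolynomial.eval x (fT p T) ≠ 0} with hU
    have hUo : IsOpen U := Metric.isOpen_ball.inter
      (isOpen_ne_fun (MvPolynomial.continuous_eval _) continuous_const)
    have hUne : U.Nonempty := by
      by_contra hE
      rw [Set.not_nonempty_iff_eq_empty] at hE
      refine hf (poly_zero_of_open Metric.isOpen_ball ⟨c, Metric.mem_ball_self hr⟩ fun x hx => ?_)
      by_contra h0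
      have : x ∈ U := ⟨hx, h0⟩
      rw [hE] at this; exact this
    have href : ∀ x, x ∈ Metric.ball c r → c + c - x ∈ Metric.ball c r := by
      intro x hx
      rw [mem_ball_iff_norm] at hx ⊢
      rw [show c + c - x - c = -(x - c) by abel, norm_neg]; exact hx
    refine hf (poly_zero_of_open (U := (fun y => c + c - y) ⁻¹' U) (hUo.preimage (by fun_prop)) ?_ ?_)
    · obtain ⟨x, hx⟩ := hUne
      exact ⟨c + c - x, by simpa using hx⟩
    · rintro y ⟨hy1, hy2⟩
      have hy3 := href _ hy1
      rw [sub_sub_cancel] at hy3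
      have h1 := hlc T c (y - c) (by simpa using hball hy3) (by
        have := hball hy1
        rwa [show c - (y - c) = c + c - y by abel]) hc
      rw [hc0, show c - (y - c) = c + c - y by abel, add_sub_cancel] at h1
      have h2 := hnn T _ (hball hy1)
      have h3 := hnn T _ (hball hy3)
      have h4 : 0 < MvPolynomial.eval (c + c - y) (fT p T) := lt_of_le_of_ne h2 (Ne.symm hy2)
      by_contra h5
      have h6 : 0 < MvPolynomial.eval y (fT p T) := lt_of_le_of_ne h3 (Ne.symm h5)
      nlinarith
  refine ⟨hom, hC, ?_, hpos, ?_, hlc⟩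
  · rintro _ ⟨x, rfl⟩
    refine poly_zero_of_open hC hne fun c hc => ?_
    have h1 := dD_deriv (LinearMap.pi W x) c p 0
    rw [zero_smul, add_zero] at h1
    refine h1.unique ((hasDerivAt_const (0:ℝ) (MvPolynomial.eval c p)).congr_of_eventuallyEq ?_)
    have hct : Continuous fun t : ℝ => c + t • LinearMap.pi W x := by fun_prop
    have := (hct.tendsto 0).eventually (hC.mem_nhds (by simpa using hc))
    filter_upwards [this] with t ht
    rw [← hp _ ht, ← hp _ hc]
    unfold vF
    have : PP W Finset.univ (c + t • LinearMap.pi W x) = (fun y => y + t • x) ⁻¹' PP W Finset.univ c := by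
      ext y
      refine forall₂_congr fun i _ => ?_
      simp only [Pi.add_apply, Pi.smul_apply, LinearMap.pi_apply, map_add, map_smul]
      rw [add_assoc, add_comm (c i)]
    rw [this, measure_preimage_add_right]
  · intro T hT c hc
    have hcl : ∀ c ∈ C, ∃ x ∈ PP W Finset.univ c, ∀ i ∈ T, W i x + c i = 0 := by
      intro c hc
      have hpc := (hpos T).resolve_left hT c hc
      have hev : ∀ᶠ ε in nhdsWithin (0:ℝ) (Set.Ioi 0), (slab W T ε c).Nonempty := by
        filter_upwards [(slab_lim hb hC hp T hc).eventually (lt_mem_nhds hpc)] with ε hε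
        by_contra hE
        rw [Set.not_nonempty_iff_eq_empty] at hE
        rw [hE] at hε; simp at hε
      obtain ⟨ε0, x0, hx0⟩ := hev.exists
      have hcont : Continuous fun x => ∑ i ∈ T, (W i x + c i) := by
        refine continuous_finsetSum _ fun i _ => ?_
        have := W_cont (W i)
        fun_prop
      obtain ⟨x, hx, hmin⟩ := (PP_compact hb c).exists_isMinOn ⟨x0, hx0.1⟩ hcont.continuousOn
      refine ⟨x, hx, ?_⟩
      have hnn : ∀ i ∈ T, 0 ≤ W i x + c i := fun i _ => hx i (Finset.mem_univ _)
      have hle : ∑ i ∈ T, (W i x + c i) ≤ 0 := by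
        have hl : Filter.Tendsto (fun ε : ℝ => T.card * ε) (nhdsWithin 0 (Set.Ioi 0)) (nhds 0) := by
          have : Continuous fun ε : ℝ => T.card * ε := by fun_prop
          simpa using (this.tendsto 0).mono_left nhdsWithin_le_nhds
        refine ge_of_tendsto hl ?_
        filter_upwards [hev] with ε ⟨y, hy⟩
        refine (hmin hy.1).trans ?_
        refine (Finset.sum_le_sum fun i hi => (hy.2 i hi).le).trans ?_
        rw [Finset.sum_const, nsmul_eq_mul]
      exact (Finset.sum_eq_zero_iff_of_nonneg hnn).1 (le_antisymm hle (Finset.sum_nonneg hnn))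
    have hct : Continuous fun t : ℝ => (fun i => if i ∈ T then c i else c i - t : ι → ℝ) := by
      refine continuous_pi fun i => ?_
      by_cases h : i ∈ T <;> simp only [h, if_true, if_false] <;> fun_prop
    have hev := ((hct.tendsto 0).mono_left (nhdsWithin_le_nhds (s := Set.Ioi 0))).eventually (hC.mem_nhds (by simpa using hc))
    obtain ⟨t, ht, ht0⟩ := (hev.and self_mem_nhdsWithin).exists
    have ht0 : 0 < t := ht0
    obtain ⟨x, hx, hxT⟩ := hcl _ ht
    refine ⟨fun i => W i x + c i, fun i hi => ?_, fun i hi => ?_, ?_⟩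
    · have := hx i (Finset.mem_univ _)
      simp only [hi, if_false] at this
      linarith
    · have := hxT i hi
      simpa only [hi, if_true] using this
    · refine ⟨-x, ?_⟩
      ext i; simp
end Geo
end PartP8

section PartP8b
open MeasureTheory

section Glue
variable {ι : Type} [Fintype ι] [DecidableEq ι] {n : ℕ}

noncomputable def Mx (n : ℕ) (G : ℕ → ℕ → ℝ) (m : ℕ) : ℝ :=
  ∑ S ∈ (Finset.univ : Finset (Fin n)).powerset, (-1 : ℝ) ^ (S.card + (Finset.univ : Finset (Fin n)).card) *
    G (S.filter fun i : Fin n => (i : ℕ) < m).card (S.filter fun i : Fin n => ¬ (i : ℕ) < m).card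

lemma Mx_lim {n m : ℕ} {β : Type} {fl : Filter β} {G : β → ℕ → ℕ → ℝ} {G0 : ℕ → ℕ → ℝ}
    (h : ∀ a b, Filter.Tendsto (fun r => G r a b) fl (nhds (G0 a b))) :
    Filter.Tendsto (fun r => Mx n (G r) m) fl (nhds (Mx n G0 m)) :=
  tendsto_finsetSum _ fun S _ => (h _ _).const_mul _

lemma glue {W : ι → (Fin n → ℝ) →ₗ[ℝ] ℝ} (hb : Bdd W Finset.univ) {k l : ι → ℝ}
    (hs : ∀ h ∈ segment ℝ k l, Simp W Finset.univ h) :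
    ∃ (C : Set (ι → ℝ)) (p : MvPolynomial ι ℝ), IsOpen C ∧ segment ℝ k l ⊆ C ∧ p.IsHomogeneous n ∧
      ∀ h ∈ C, vF W Finset.univ h = MvPolynomial.eval h p := by
  set U := {h | ∃ p : MvPolynomial ι ℝ, p.IsHomogeneous n ∧ ∀ᶠ h' in nhds h, vF W Finset.univ h' = MvPolynomial.eval h' p} with hU
  have hUo : IsOpen U := by
    rw [isOpen_iff_eventually]
    rintro h ⟨p, hp, hev⟩
    filter_upwards [hev.eventually_nhds] with h' hh
    exact ⟨p, hp, hh⟩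
  have hsub : segment ℝ k l ⊆ U := fun h hh => locPoly n W Finset.univ h hb (hs h hh)
  have hcomp : IsCompact (segment ℝ k l) := by
    rw [segment_eq_image]
    exact isCompact_Icc.image (by fun_prop)
  obtain ⟨δ, hδ, hCU⟩ := hcomp.exists_thickening_subset_open hUo hsub
  set C := Metric.thickening δ (segment ℝ k l) with hC
  have hsC : segment ℝ k l ⊆ C := Metric.self_subset_thickening hδ _
  have hpre : IsPreconnected C := ((convex_segment k l).thickening δ).isPreconnected
  obtain ⟨p, hp, hev⟩ := hsub (left_mem_segment ℝ k l)
  refine ⟨C, p, Metric.isOpen_thickening, hsC, hp, ?_⟩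
  set A := {h | ∀ᶠ h' in nhds h, vF W Finset.univ h' = MvPolynomial.eval h' p} with hA
  have hAo : IsOpen A := by
    rw [isOpen_iff_eventually]
    intro h hh
    exact Filter.Eventually.eventually_nhds hh
  have hCA : C ⊆ A := by
    refine hpre.subset_of_closure_inter_subset hAo ⟨k, hsC (left_mem_segment ℝ k l), hev⟩ ?_
    rintro h ⟨h1, h2⟩
    obtain ⟨q, hq, hqe⟩ := hCU h2
    obtain ⟨V, hV, hVo, hhV⟩ := eventually_nhds_iff.1 hqe
    obtain ⟨a, haV, haA⟩ := mem_closure_iff.1 h1 V hVo hhV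
    have haA : ∀ᶠ h' in nhds a, vF W Finset.univ h' = MvPolynomial.eval h' p := haA
    obtain ⟨V', hV', hVo', hhV'⟩ := eventually_nhds_iff.1 haA
    have : q - p = 0 := poly_zero_of_open (hVo.inter hVo') ⟨a, haV, hhV'⟩ fun x hx => by
      rw [map_sub, ← hV x hx.1, ← hV' x hx.2, sub_self]
    rw [sub_eq_zero] at this
    rw [this] at hqe
    exact hqe
  exact fun h hh => (hCA hh : ∀ᶠ h' in nhds h, _).self_of_nhds

lemma mvmap {V : Type} (k l : V) {m : ℕ} (hm : m ≤ n) :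
    (Finset.univ : Finset (Fin n)).val.map (fun i : Fin n => if (i : ℕ) < m then k else l) =
      Multiset.replicate m k + Multiset.replicate (n - m) l := by
  classical
  rw [← Multiset.filter_add_not (fun i : Fin n => (i : ℕ) < m) (Finset.univ : Finset (Fin n)).val, Multiset.map_add]
  have c1 : (Multiset.filter (fun i : Fin n => (i : ℕ) < m) (Finset.univ : Finset (Fin n)).val).card = m := by
    have := Fin.card_filter_val_lt (n := n) (m := m)
    change (Finset.univ.filter fun i : Fin n => (i : ℕ) < m).card = m
    rw [this]; omega
  have c2 : (Multiset.filter (fun i : Fin n => ¬ (i : ℕ) < m) (Finset.univ : Finset (Fin n)).val).card = n - m := by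
    have := congrArg Multiset.card (Multiset.filter_add_not (fun i : Fin n => (i : ℕ) < m) (Finset.univ : Finset (Fin n)).val)
    rw [Multiset.card_add, c1] at this
    simp only [Finset.card_val, Finset.card_univ, Fintype.card_fin] at this
    omega
  congr 1
  · rw [Multiset.map_congr rfl (g := fun _ => k), Multiset.map_const', c1]
    intro i hi
    simp [(Multiset.mem_filter.1 hi).2]
  · rw [Multiset.map_congr rfl (g := fun _ => l), Multiset.map_const', c2]
    intro i hi
    simp only [(Multiset.mem_filter.1 hi).2, if_false]

lemma Mx_eq {p : MvPolynomial ι ℝ} (hp : p.IsHomogeneous n) (k l : ι → ℝ) {m : ℕ} (hm : m ≤ n) :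
    Mx n (fun a b => MvPolynomial.eval ((a:ℝ) • k + (b:ℝ) • l) p) m =
      MvPolynomial.eval 0 (mD (Multiset.replicate m k + Multiset.replicate (n - m) l) p) := by
  obtain ⟨θ, _, h⟩ := mvt_iter (Finset.univ : Finset (Fin n)) (fun i => if (i : ℕ) < m then k else l) p 0
  rw [mvmap k l hm] at h
  have h0 : (mD (Multiset.replicate m k + Multiset.replicate (n - m) l) p).IsHomogeneous 0 := by
    have := mD_hom (Multiset.replicate m k + Multiset.replicate (n - m) l) hp
    simp only [Multiset.card_add, Multiset.card_replicate] at this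
    rwa [show n - (m + (n - m)) = 0 by omega] at this
  have h1 := h.trans (eval_hom_zero h0 _ 0)
  refine Eq.trans ?_ h1
  unfold Mx
  refine Finset.sum_congr rfl fun S _ => ?_
  have e : (0 : ι → ℝ) + ∑ i ∈ S, (if (i : ℕ) < m then k else l) =
      (((S.filter fun i : Fin n => (i : ℕ) < m).card : ℕ) : ℝ) • k + (((S.filter fun i : Fin n => ¬ (i : ℕ) < m).card : ℕ) : ℝ) • l := by
    rw [zero_add, Finset.sum_ite, Finset.sum_const, Finset.sum_const, Nat.cast_smul_eq_nsmul, Nat.cast_smul_eq_nsmul]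
  rw [e]

theorem seg_ineq {W : ι → (Fin n → ℝ) →ₗ[ℝ] ℝ} (hb : Bdd W Finset.univ) {k l : ι → ℝ}
    (hs : ∀ h ∈ segment ℝ k l, Simp W Finset.univ h) {j : ℕ} (hj1 : 1 ≤ j) (hj2 : j + 1 ≤ n) :
    Mx n (fun a b => vF W Finset.univ ((a:ℝ) • k + (b:ℝ) • l)) (j - 1) *
      Mx n (fun a b => vF W Finset.univ ((a:ℝ) • k + (b:ℝ) • l)) (j + 1) ≤
      Mx n (fun a b => vF W Finset.univ ((a:ℝ) • k + (b:ℝ) • l)) j ^ 2 := by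
  obtain ⟨C, p, hC, hsC, hp, hv⟩ := glue hb hs
  have hG : (fun a b : ℕ => vF W Finset.univ ((a:ℝ) • k + (b:ℝ) • l)) = fun a b : ℕ => MvPolynomial.eval ((a:ℝ) • k + (b:ℝ) • l) p := by
    funext a b
    by_cases hab : a + b = 0
    · have ha : a = 0 := by omega
      have hb' : b = 0 := by omega
      subst ha hb'
      simp only [Nat.cast_zero, zero_smul, add_zero]
      have h1 := eval_hom_smul hp 0 0
      rw [zero_smul, zero_pow (by omega), zero_mul] at h1
      rw [h1]
      have : PP W Finset.univ 0 ⊆ {0} := fun x hx => hb x fun i hi => by simpa using hx i hi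
      unfold vF
      have hne : Nonempty (Fin n) := ⟨⟨0, by omega⟩⟩
      rw [measure_mono_null this (measure_singleton _)]; rfl
    · have hpos : (0:ℝ) < (a + b : ℝ) := by
        have : 0 < a + b := by omega
        exact_mod_cast this
      have hmem : ((a:ℝ) / (a + b)) • k + ((b:ℝ) / (a+b)) • l ∈ segment ℝ k l :=
        ⟨_, _, by positivity, by positivity, by field_simp, rfl⟩
      have e : (a:ℝ) • k + (b:ℝ) • l = ((a:ℝ) + b) • (((a:ℝ) / (a + b)) • k + ((b:ℝ) / (a+b)) • l) := by
        rw [smul_add, smul_smul, smul_smul, mul_div_cancel₀ _ hpos.ne', mul_div_cancel₀ _ hpos.ne']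
      rw [e, vF_homog hpos, eval_hom_smul hp, hv _ (hsC hmem)]
  have hk := hsC (left_mem_segment ℝ k l)
  have hl := hsC (right_mem_segment ℝ k l)
  have H := core_of hb hC ⟨k, hk⟩ hp hv
  have F := H.final (Multiset.replicate (j-1) k + Multiset.replicate (n-j-1) l) (by simp; omega)
    (by
      intro c hc
      rcases Multiset.mem_add.1 hc with hc | hc <;> rw [Multiset.eq_of_mem_replicate hc] <;> assumption) k l hk hl
  rw [hG, Mx_eq hp k l (by omega), Mx_eq hp k l (by omega), Mx_eq hp k l (by omega)]
  have e1 : k ::ₘ k ::ₘ (Multiset.replicate (j-1) k + Multiset.replicate (n-j-1) l) =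
      Multiset.replicate (j+1) k + Multiset.replicate (n-(j+1)) l := by
    rw [← Multiset.cons_add, ← Multiset.cons_add, ← Multiset.replicate_succ, ← Multiset.replicate_succ, Nat.sub_sub]
    congr 2; omega
  have e2 : l ::ₘ l ::ₘ (Multiset.replicate (j-1) k + Multiset.replicate (n-j-1) l) =
      Multiset.replicate (j-1) k + Multiset.replicate (n-(j-1)) l := by
    rw [← Multiset.add_cons, ← Multiset.add_cons, ← Multiset.replicate_succ, ← Multiset.replicate_succ]
    congr 2; omega
  have e3 : k ::ₘ l ::ₘ (Multiset.replicate (j-1) k + Multiset.replicate (n-j-1) l) =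
      Multiset.replicate j k + Multiset.replicate (n-j) l := by
    rw [← Multiset.add_cons, ← Multiset.cons_add, ← Multiset.replicate_succ, ← Multiset.replicate_succ]
    congr 2 <;> omega
  rw [e1, e2, e3] at F
  linarith
end Glue
end PartP8b

section PartP9
open MeasureTheory
open scoped Pointwise

section FM
variable {V : Type} [AddCommGroup V] [Module ℝ V]

/-- the cone generated by a list -/
def Cn : List V → Set V
  | [] => {0}
  | v :: L => {x | ∃ c : ℝ, 0 ≤ c ∧ x - c • v ∈ Cn L}

lemma Cn_zero (L : List V) : (0 : V) ∈ Cn L := by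
  induction L with
  | nil => exact rfl
  | cons v L ih => exact ⟨0, le_rfl, by simpa using ih⟩

lemma Cn_gen (L : List V) {v : V} (hv : v ∈ L) : v ∈ Cn L := by
  induction L with
  | nil => simp at hv
  | cons w L ih =>
    rcases List.mem_cons.1 hv with rfl | hv
    · exact ⟨1, zero_le_one, by simpa using Cn_zero L⟩
    · exact ⟨0, le_rfl, by simpa using ih hv⟩

lemma Cn_ind (Q : V → Prop) (h0 : Q 0) (L : List V) (hs : ∀ v ∈ L, ∀ y, Q y → ∀ c : ℝ, 0 ≤ c → Q (y + c • v)) :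
    ∀ x ∈ Cn L, Q x := by
  induction L with
  | nil => intro x hx; rw [show x = 0 from hx]; exact h0
  | cons w L ih =>
    rintro x ⟨c, hc, hx⟩
    have := hs w (by simp) _ (ih (fun v hv => hs v (by simp [hv])) _ hx) c hc
    simpa using this

lemma fm_elim [FiniteDimensional ℝ V] (L : List V) : ∃ F : Finset (V →ₗ[ℝ] ℝ), ∀ x, x ∈ Cn L ↔ ∀ f ∈ F, 0 ≤ f x := by
  classical
  induction L with
  | nil =>
    let b := Module.finBasis ℝ V
    refine ⟨Finset.univ.image (fun i => b.coord i) ∪ Finset.univ.image (fun i => - b.coord i), fun x => ?_⟩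
    constructor
    · intro hx f _; rw [show x = 0 from hx, map_zero]
    · intro h
      refine (b.forall_coord_eq_zero_iff).1 fun i => le_antisymm ?_ ?_
      · have := h (- b.coord i) (by simp)
        simpa using this
      · exact h (b.coord i) (by simp)
  | cons v L ih =>
    obtain ⟨F, hF⟩ := ih
    refine ⟨F.filter (fun f => 0 ≤ f v) ∪ ((F.filter fun f => 0 < f v) ×ˢ (F.filter fun f => f v < 0)).image
      (fun z => z.1 v • z.2 - z.2 v • z.1), fun x => ?_⟩
    have hm : x ∈ Cn (v :: L) ↔ ∃ c : ℝ, 0 ≤ c ∧ ∀ f ∈ F, c * f v ≤ f x := by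
      refine exists_congr fun c => and_congr_right fun _ => ?_
      rw [hF]
      refine forall₂_congr fun f _ => ?_
      rw [map_sub, map_smul, smul_eq_mul, sub_nonneg]
    rw [hm]
    constructor
    · rintro ⟨c, hc, h⟩ f hf
      rcases Finset.mem_union.1 hf with hf | hf
      · obtain ⟨h1, h2⟩ := Finset.mem_filter.1 hf
        exact (mul_nonneg hc h2).trans (h f h1)
      · obtain ⟨⟨f1, f2⟩, hz, rfl⟩ := Finset.mem_image.1 hf
        obtain ⟨h1, h2⟩ := Finset.mem_product.1 hz
        obtain ⟨h1, h3⟩ := Finset.mem_filter.1 h1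
        obtain ⟨h2, h4⟩ := Finset.mem_filter.1 h2
        have h5 := h f1 h1
        have h6 := h f2 h2
        simp only [LinearMap.sub_apply, LinearMap.smul_apply, smul_eq_mul] at *
        nlinarith
    · intro h
      set Lw : Finset ℝ := insert 0 ((F.filter fun f => f v < 0).image fun f => f x / f v) with hLw
      have hne : Lw.Nonempty := ⟨0, by simp [hLw]⟩
      refine ⟨Lw.max' hne, Finset.le_max' _ _ (by simp [hLw]), fun f hf => ?_⟩
      rcases lt_trichotomy (f v) 0 with h1 | h1 | h1
      · have h2 : f x / f v ≤ Lw.max' hne := Finset.le_max' _ _ (by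
          rw [hLw]
          exact Finset.mem_insert_of_mem (Finset.mem_image.2 ⟨f, Finset.mem_filter.2 ⟨hf, h1⟩, rfl⟩))
        rwa [div_le_iff_of_neg h1] at h2
      · rw [h1, mul_zero]
        exact h f (Finset.mem_union_left _ (Finset.mem_filter.2 ⟨hf, h1.ge⟩))
      · rw [← le_div_iff₀ h1, Finset.max'_le_iff]
        intro y hy
        rcases Finset.mem_insert.1 hy with rfl | hy
        · exact div_nonneg (h f (Finset.mem_union_left _ (Finset.mem_filter.2 ⟨hf, h1.le⟩))) h1.le
        · obtain ⟨g, hg, rfl⟩ := Finset.mem_image.1 hy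
          obtain ⟨hg, hg1⟩ := Finset.mem_filter.1 hg
          have := h (f v • g - g v • f) (Finset.mem_union_right _ (Finset.mem_image.2 ⟨(f, g), by simp [hf, hg, h1, hg1], rfl⟩))
          simp only [LinearMap.sub_apply, LinearMap.smul_apply, smul_eq_mul] at this
          rw [div_le_iff_of_neg hg1, div_mul_eq_mul_div, div_le_iff₀ h1]
          linarith

theorem poly_rep {n : ℕ} (A B : Finset (Fin n → ℝ)) (hA : A.Nonempty) (hB : B.Nonempty) :
    ∃ (ι : Type) (_ : Fintype ι) (_ : DecidableEq ι) (W : ι → (Fin n → ℝ) →ₗ[ℝ] ℝ) (α β : ι → ℝ),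
      ∀ s t : ℝ, 0 ≤ s → 0 ≤ t → ∀ x, x ∈ PP W Finset.univ (s • α + t • β) ↔
        ∃ a ∈ convexHull ℝ (A : Set (Fin n → ℝ)), ∃ b ∈ convexHull ℝ (B : Set (Fin n → ℝ)), x = s • a + t • b := by
  classical
  set K := convexHull ℝ (A : Set (Fin n → ℝ)) with hK
  set L := convexHull ℝ (B : Set (Fin n → ℝ)) with hL
  have hKc : Convex ℝ K := convex_convexHull _ _
  have hLc : Convex ℝ L := convex_convexHull _ _
  set Ls : List ((Fin n → ℝ) × ℝ × ℝ) := A.toList.map (fun a => (a, 1, 0)) ++ B.toList.map (fun b => (b, 0, 1)) with hLs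
  obtain ⟨F, hF⟩ := fm_elim Ls
  let emb : (Fin n → ℝ) →ₗ[ℝ] (Fin n → ℝ) × ℝ × ℝ := LinearMap.inl ℝ _ _
  refine ⟨{f // f ∈ F}, inferInstance, inferInstance, fun f => f.1 ∘ₗ emb, fun f => f.1 (0, 1, 0), fun f => f.1 (0, 0, 1), ?_⟩
  intro s t hs ht x
  have key : x ∈ PP (fun f : {f // f ∈ F} => f.1 ∘ₗ emb) Finset.univ (s • (fun f : {f // f ∈ F} => f.1 (0, 1, 0)) + t • (fun f : {f // f ∈ F} => f.1 (0, 0, 1))) ↔ (x, s, t) ∈ Cn Ls := by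
    rw [hF]
    have : ∀ f : (Fin n → ℝ) × ℝ × ℝ →ₗ[ℝ] ℝ, f (x, s, t) = f (emb x) + (s * f (0,1,0) + t * f (0,0,1)) := by
      intro f
      rw [← smul_eq_mul, ← smul_eq_mul, ← map_smul, ← map_smul, ← map_add, ← map_add]
      congr 1
      simp [emb]
    simp only [this]
    constructor
    · intro h f hf
      exact h ⟨f, hf⟩ (Finset.mem_univ _)
    · rintro h ⟨f, hf⟩ _
      exact h f hf
  rw [key]
  constructor
  · intro h
    have := Cn_ind (fun z => 0 ≤ z.2.1 ∧ 0 ≤ z.2.2 ∧ z.1 ∈ {y | ∃ u ∈ z.2.1 • K, ∃ w ∈ z.2.2 • L, y = u + w}) ?_ Ls ?_ _ h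
    · obtain ⟨_, _, _, ⟨a, ha, rfl⟩, _, ⟨b, hb, rfl⟩, h3⟩ := this
      exact ⟨a, ha, b, hb, h3⟩
    · obtain ⟨a, ha⟩ := hA
      obtain ⟨b, hb⟩ := hB
      exact ⟨le_rfl, le_rfl, 0, ⟨a, subset_convexHull _ _ ha, by simp⟩, 0, ⟨b, subset_convexHull _ _ hb, by simp⟩, by simp⟩
    · rintro v hv ⟨y, s, t⟩ ⟨hs, ht, u, hu, w, hw, hy⟩ c hc
      simp only at hs ht hu hw hy
      rcases List.mem_append.1 hv with hv | hv
      · obtain ⟨a, ha, rfl⟩ := List.mem_map.1 hv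
        have haK : a ∈ K := subset_convexHull _ _ (by simpa using ha)
        refine ⟨by simp; linarith, by simpa using ht, u + c • a, ?_, w, by simpa using hw, ?_⟩
        · simp only [Prod.smul_mk, smul_eq_mul, mul_one, Prod.mk_add_mk]
          rw [hKc.add_smul hs hc]
          exact Set.add_mem_add hu (Set.smul_mem_smul_set haK)
        · simp [hy]; abel
      · obtain ⟨b, hb, rfl⟩ := List.mem_map.1 hv
        have hbL : b ∈ L := subset_convexHull _ _ (by simpa using hb)
        refine ⟨by simpa using hs, by simp; linarith, u, by simpa using hu, w + c • b, ?_, ?_⟩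
        · simp only [Prod.smul_mk, smul_eq_mul, mul_one, Prod.mk_add_mk]
          rw [hLc.add_smul ht hc]
          exact Set.add_mem_add hw (Set.smul_mem_smul_set hbL)
        · simp [hy]; abel
  · rintro ⟨a, ha, b, hb, rfl⟩
    have hcv : ∀ f : (Fin n → ℝ) × ℝ × ℝ →ₗ[ℝ] ℝ, ∀ r : (Fin n → ℝ) × ℝ × ℝ, Convex ℝ {y : Fin n → ℝ | 0 ≤ f (emb y + r)} := by
      intro f r y hy z hz p q hp hq hpq
      simp only [Set.mem_ofPred_eq] at *
      have : emb (p • y + q • z) + r = p • (emb y + r) + q • (emb z + r) := by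
        rw [smul_add, smul_add, map_add, map_smul, map_smul, add_add_add_comm, ← add_smul, hpq, one_smul]
      rw [this, map_add, map_smul, map_smul, smul_eq_mul, smul_eq_mul]
      positivity
    have h1 : ∀ f ∈ F, 0 ≤ f (emb a + (0, 1, 0)) := by
      intro f hf
      refine convexHull_min (fun y hy => ?_) (hcv f (0, 1, 0)) ha
      have := (hF (y, 1, 0)).1 (Cn_gen Ls (by
        refine List.mem_append_left _ (List.mem_map.2 ⟨y, by simpa using hy, rfl⟩))) f hf
      simpa [emb] using this
    have h2 : ∀ f ∈ F, 0 ≤ f (emb b + (0, 0, 1)) := by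
      intro f hf
      refine convexHull_min (fun y hy => ?_) (hcv f (0, 0, 1)) hb
      have := (hF (y, 0, 1)).1 (Cn_gen Ls (by
        refine List.mem_append_right _ (List.mem_map.2 ⟨y, by simpa using hy, rfl⟩))) f hf
      simpa [emb] using this
    rw [hF]
    intro f hf
    have e : ((s • a + t • b, s, t) : (Fin n → ℝ) × ℝ × ℝ) = s • (emb a + (0,1,0)) + t • (emb b + (0,0,1)) := by
      simp [emb]
    rw [e, map_add, map_smul, map_smul, smul_eq_mul, smul_eq_mul]
    have := h1 f hf
    have := h2 f hf
    positivity
end FM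
end PartP9

section PartP10
open MeasureTheory
open scoped Pointwise

section Pert
variable {ι : Type} [Fintype ι] [DecidableEq ι] {n : ℕ}

lemma exists_generic (P : Finset (Finset ι)) (lam : Finset ι → ι → ℝ) (h : ∀ J ∈ P, ∃ i ∈ J, lam J i ≠ 0) :
    ∃ g : ι → ℝ, (∀ i, 0 < g i) ∧ ∀ J ∈ P, ∑ i ∈ J, lam J i * g i ≠ 0 := by
  set p : MvPolynomial ι ℝ := ∏ J ∈ P, ∑ i ∈ J, MvPolynomial.C (lam J i) * MvPolynomial.X i with hp
  have hp0 : p ≠ 0 := by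
    rw [hp, Finset.prod_ne_zero_iff]
    intro J hJ h0
    obtain ⟨i, hi, hne⟩ := h J hJ
    have := congrArg (MvPolynomial.eval (Pi.single i 1)) h0
    simp only [map_sum, map_mul, MvPolynomial.eval_C, MvPolynomial.eval_X, map_zero] at this
    rw [Finset.sum_eq_single_of_mem i hi] at this
    · simp at this; exact hne this
    · intro k _ hk; simp [hk]
  by_contra hcon
  push Not at hcon
  refine hp0 (poly_zero_of_open (U := {g | ∀ i, 0 < g i}) ?_ ⟨fun _ => 1, fun _ => one_pos⟩ ?_)
  · have : {g : ι → ℝ | ∀ i, 0 < g i} = ⋂ i, {g | 0 < g i} := by ext; simp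
    rw [this]
    exact isOpen_iInter_of_finite fun i => isOpen_lt continuous_const (continuous_apply i)
  · intro g hg
    obtain ⟨J, hJ, h0⟩ := hcon g hg
    rw [hp, map_prod, Finset.prod_eq_zero hJ]
    simpa using h0

lemma perturb {W : ι → (Fin n → ℝ) →ₗ[ℝ] ℝ} (hb : Bdd W Finset.univ) {α β : ι → ℝ}
    (hdec : ∀ s t : ℝ, 0 ≤ s → 0 ≤ t → ∀ x ∈ PP W Finset.univ (s • α + t • β),
      ∃ a ∈ PP W Finset.univ α, ∃ b ∈ PP W Finset.univ β, x = s • a + t • b) {δ : ℝ} (hδ : 0 < δ) :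
    ∃ g : ι → ℝ, (∀ i, 0 < g i) ∧ ∀ᶠ ε in nhdsWithin (0:ℝ) (Set.Ioi 0),
      ∀ h ∈ segment ℝ (α + δ • β + ε • g) (δ • α + β + ε • g), Simp W Finset.univ h := by
  classical
  have hlam : ∀ J : Finset ι, ∃ lam : ι → ℝ, ¬ LinearIndepOn ℝ W (J : Set ι) → ∑ i ∈ J, lam i • W i = 0 ∧ ∃ i ∈ J, lam i ≠ 0 := by
    intro J
    by_cases h : LinearIndepOn ℝ W (J : Set ι)
    · exact ⟨0, fun h' => absurd h h'⟩
    · obtain ⟨f, hf⟩ := not_linearIndepOn_finset_iff.1 h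
      exact ⟨f, fun _ => hf⟩
  choose lam hlam using hlam
  obtain ⟨g, hg, hgen⟩ := exists_generic (Finset.univ.filter fun J : Finset ι => ¬ LinearIndepOn ℝ W (J : Set ι)) lam
    (fun J hJ => (hlam J (Finset.mem_filter.1 hJ).2).2)
  refine ⟨g, hg, ?_⟩
  have tight : ∀ (J : Finset ι), ¬ LinearIndepOn ℝ W (J : Set ι) → ∀ (h : ι → ℝ) x, (∀ i ∈ J, W i x + h i = 0) →
      ∑ i ∈ J, lam J i * h i = 0 := by
    intro J hJ h x hx
    have h1 := LinearMap.congr_fun (hlam J hJ).1 x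
    simp only [LinearMap.sum_apply, LinearMap.smul_apply, smul_eq_mul, LinearMap.zero_apply] at h1
    rw [← h1, ← sub_eq_zero, ← Finset.sum_sub_distrib] 
    have : ∑ i ∈ J, (lam J i * h i - lam J i * W i x) = ∑ i ∈ J, (- 2 * (lam J i * W i x)) := by
      refine Finset.sum_congr rfl fun i hi => ?_
      have := hx i hi
      have : h i = - W i x := by linarith
      rw [this]; ring
    rw [this, ← Finset.mul_sum, h1, mul_zero]
  have main : ∀ J : Finset ι, ¬ LinearIndepOn ℝ W (J : Set ι) → ∀ᶠ ε in nhdsWithin (0:ℝ) (Set.Ioi 0),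
      ∀ h ∈ segment ℝ (α + δ • β) (δ • α + β), ∀ x ∈ PP W Finset.univ (h + ε • g), ¬ ∀ i ∈ J, W i x + (h + ε • g) i = 0 := by
    intro J hJ
    have hgJ := hgen J (Finset.mem_filter.2 ⟨Finset.mem_univ _, hJ⟩)
    by_cases h0 : ∑ i ∈ J, lam J i * α i = 0 ∧ ∑ i ∈ J, lam J i * β i = 0
    · filter_upwards [self_mem_nhdsWithin] with ε (hε : 0 < ε)
      rintro h ⟨s, t, hs, ht, hst, rfl⟩ x hx hti
      have h1 := tight J hJ _ x hti
      have h2 : ∑ i ∈ J, lam J i * (s • (α + δ • β) + t • (δ • α + β) + ε • g) i =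
          (s + t * δ) * ∑ i ∈ J, lam J i * α i + (s * δ + t) * (∑ i ∈ J, lam J i * β i) + ε * ∑ i ∈ J, lam J i * g i := by
        simp only [Finset.mul_sum, ← Finset.sum_add_distrib]
        refine Finset.sum_congr rfl fun i _ => ?_
        simp only [Pi.add_apply, Pi.smul_apply, smul_eq_mul]; ring
      rw [h2, h0.1, h0.2] at h1
      simp at h1
      rcases h1 with h1 | h1
      · linarith
      · exact hgJ h1
    · have hsegc : IsCompact (segment ℝ (α + δ • β) (δ • α + β)) := by
        rw [segment_eq_image]
        exact isCompact_Icc.image (by fun_prop)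
      set Z : Set (((ι → ℝ) × ℝ) × (Fin n → ℝ)) := {z | (z.1.1 ∈ segment ℝ (α + δ • β) (δ • α + β) ∧ z.1.2 ∈ Set.Icc (0:ℝ) 1) ∧
        z.2 ∈ PP W Finset.univ (z.1.1 + z.1.2 • g) ∧ ∀ i ∈ J, W i z.2 + (z.1.1 + z.1.2 • g) i = 0} with hZ
      have hZc : IsCompact Z := by
        obtain ⟨R, hR0, hR⟩ := PP_bound hb
        have hX : IsCompact ((segment ℝ (α + δ • β) (δ • α + β)) ×ˢ Set.Icc (0:ℝ) 1) := hsegc.prod isCompact_Icc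
        obtain ⟨r, hr⟩ := (hX.image (f := fun z : (ι → ℝ) × ℝ => z.1 + z.2 • g) (by fun_prop)).isBounded.exists_norm_le
        refine (hX.prod (isCompact_closedBall (0 : Fin n → ℝ) (R * r))).of_isClosed_subset ?_ ?_
        · have c1 : IsClosed {z : ((ι → ℝ) × ℝ) × (Fin n → ℝ) | z.1 ∈ ((segment ℝ (α + δ • β) (δ • α + β)) ×ˢ Set.Icc (0:ℝ) 1)} :=
            hX.isClosed.preimage continuous_fst
          have c2 := (PP_closed2 W Finset.univ).preimage (f := fun z : ((ι → ℝ) × ℝ) × (Fin n → ℝ) => (z.1.1 + z.1.2 • g, z.2)) (by fun_prop)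
          have c3 : IsClosed (⋂ i ∈ J, {z : ((ι → ℝ) × ℝ) × (Fin n → ℝ) | W i z.2 + (z.1.1 + z.1.2 • g) i = 0}) := by
            refine isClosed_biInter fun i _ => isClosed_eq ?_ continuous_const
            have := W_cont (W i)
            simp only [Pi.add_apply, Pi.smul_apply]
            fun_prop
          have : Z = {z : ((ι → ℝ) × ℝ) × (Fin n → ℝ) | z.1 ∈ ((segment ℝ (α + δ • β) (δ • α + β)) ×ˢ Set.Icc (0:ℝ) 1)} ∩
            ((fun z : ((ι → ℝ) × ℝ) × (Fin n → ℝ) => (z.1.1 + z.1.2 • g, z.2)) ⁻¹' {z | z.2 ∈ PP W Finset.univ z.1} ∩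
            (⋂ i ∈ J, {z : ((ι → ℝ) × ℝ) × (Fin n → ℝ) | W i z.2 + (z.1.1 + z.1.2 • g) i = 0})) := by
            ext z; simp [hZ]
          rw [this]
          exact c1.inter (c2.inter c3)
        · rintro ⟨⟨h, ε⟩, x⟩ ⟨⟨h1, h2⟩, h3, _⟩
          refine ⟨⟨h1, h2⟩, ?_⟩
          simp only [Metric.mem_closedBall, dist_zero_right]
          exact (hR _ x h3).trans (mul_le_mul_of_nonneg_left (hr _ ⟨(h, ε), ⟨h1, h2⟩, rfl⟩) hR0)
      have hcl := (hZc.image (f := fun z => z.1.2) (by fun_prop)).isClosed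
      have h0' : (0:ℝ) ∉ (fun z : ((ι → ℝ) × ℝ) × (Fin n → ℝ) => z.1.2) '' Z := by
        rintro ⟨⟨⟨h, ε⟩, x⟩, ⟨⟨h1, _⟩, h2, h3⟩, h4⟩
        simp only at h1 h2 h3 h4
        subst h4
        rw [zero_smul, add_zero] at h2 h3
        obtain ⟨s, t, hs, ht, hst, rfl⟩ := h1
        have e : s • (α + δ • β) + t • (δ • α + β) = (s + t * δ) • α + (s * δ + t) • β := by
          ext i; simp only [Pi.add_apply, Pi.smul_apply, smul_eq_mul]; ring
        rw [e] at h2 h3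
        have p1 : 0 < s + t * δ := by
          rcases hs.eq_or_lt with rfl | hs
          · have : t = 1 := by linarith
            subst this; linarith
          · positivity
        have p2 : 0 < s * δ + t := by
          rcases ht.eq_or_lt with rfl | ht
          · have : s = 1 := by linarith
            subst this; linarith
          · positivity
        obtain ⟨a, ha, b, hb, rfl⟩ := hdec _ _ p1.le p2.le x h2
        have hz : ∀ i ∈ J, W i a + α i = 0 ∧ W i b + β i = 0 := by
          intro i hi
          have h5 := h3 i hi
          have h6 := ha i (Finset.mem_univ _)
          have h7 := hb i (Finset.mem_univ _)
          simp only [map_add, map_smul, smul_eq_mul, Pi.add_apply, Pi.smul_apply] at h5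
          have h8 : (s + t * δ) * (W i a + α i) + (s * δ + t) * (W i b + β i) = 0 := by linarith
          have h9 := mul_nonneg p1.le h6
          have h10 := mul_nonneg p2.le h7
          constructor
          · exact (mul_eq_zero.1 (show (s + t * δ) * (W i a + α i) = 0 by linarith)).resolve_left p1.ne'
          · exact (mul_eq_zero.1 (show (s * δ + t) * (W i b + β i) = 0 by linarith)).resolve_left p2.ne'
        exact h0 ⟨tight J hJ _ a fun i hi => (hz i hi).1, tight J hJ _ b fun i hi => (hz i hi).2⟩
      filter_upwards [nhdsWithin_le_nhds (hcl.isOpen_compl.mem_nhds h0'), self_mem_nhdsWithin,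
        nhdsWithin_le_nhds (gt_mem_nhds (show (0:ℝ) < 1 from one_pos))] with ε h1 h2 h3
      intro h hh x hx hti
      exact h1 ⟨((h, ε), x), ⟨⟨hh, ⟨le_of_lt h2, le_of_lt h3⟩⟩, hx, hti⟩, rfl⟩
  have main2 := (Filter.eventually_all.2 fun J : Finset ι => Filter.eventually_all.2 fun hJ : ¬ LinearIndepOn ℝ W (J : Set ι) => main J hJ)
  filter_upwards [main2] with ε hε
  rintro _ ⟨s, t, hs, ht, hst, rfl⟩ x hx
  have e : s • (α + δ • β + ε • g) + t • (δ • α + β + ε • g) = (s • (α + δ • β) + t • (δ • α + β)) + ε • g := by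
    have : ε • g = (s + t) • ε • g := by rw [hst, one_smul]
    conv_rhs => rw [this]
    simp only [smul_add, add_smul]
    abel
  rw [e] at hx ⊢
  by_contra hJ
  set J : Finset ι := Finset.univ.filter fun i => W i x + ((s • (α + δ • β) + t • (δ • α + β)) + ε • g) i = 0 with hJd
  have hJe : {i | i ∈ Finset.univ ∧ W i x + ((s • (α + δ • β) + t • (δ • α + β)) + ε • g) i = 0} = (J : Set ι) := by
    ext i; simp [hJd]
  rw [hJe] at hJ
  exact hε J hJ _ ⟨s, t, hs, ht, hst, rfl⟩ x hx fun i hi => (Finset.mem_filter.1 hi).2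

lemma vF_rc {W : ι → (Fin n → ℝ) →ₗ[ℝ] ℝ} (hb : Bdd W Finset.univ) {g : ι → ℝ} (hg : ∀ i, 0 ≤ g i) (h : ι → ℝ) :
    Filter.Tendsto (fun ε : ℝ => vF W Finset.univ (h + ε • g)) (nhdsWithin 0 (Set.Ioi 0)) (nhds (vF W Finset.univ h)) := by
  have h1 := tendsto_measure_biInter_gt (μ := (volume : Measure (Fin n → ℝ))) (s := fun ε : ℝ => PP W Finset.univ (h + ε • g)) (a := 0)
    (fun r _ => (PP_closed W _ _).measurableSet.nullMeasurableSet) (by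
      intro i j hi hij x hx k hk
      have := hx k hk
      simp only [Pi.add_apply, Pi.smul_apply, smul_eq_mul] at this ⊢
      have := mul_le_mul_of_nonneg_right hij (hg k)
      linarith) ⟨1, one_pos, (PP_compact hb _).measure_lt_top.ne⟩
  have h2 : (⋂ r : ℝ, ⋂ (_ : r > 0), PP W Finset.univ (h + r • g)) = PP W Finset.univ h := by
    ext x
    simp only [Set.mem_iInter]
    constructor
    · intro hx k hk
      have hl : Filter.Tendsto (fun r : ℝ => W k x + (h k + r * g k)) (nhdsWithin 0 (Set.Ioi 0)) (nhds (W k x + (h k + 0 * g k))) := by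
        have : Continuous fun r : ℝ => W k x + (h k + r * g k) := by fun_prop
        exact (this.tendsto 0).mono_left nhdsWithin_le_nhds
      rw [zero_mul, add_zero] at hl
      refine ge_of_tendsto hl ?_
      filter_upwards [self_mem_nhdsWithin] with r hr
      exact hx r hr k hk
    · intro hx r hr k hk
      have := hx k hk
      simp only [Pi.add_apply, Pi.smul_apply, smul_eq_mul]
      have := mul_nonneg (le_of_lt hr) (hg k)
      linarith
  rw [h2] at h1
  exact (ENNReal.tendsto_toReal (PP_compact hb h).measure_lt_top.ne).comp h1

theorem poly_case (A B : Finset (Fin n → ℝ)) (hA : A.Nonempty) (hB : B.Nonempty) {δ : ℝ} (hδ : 0 < δ)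
    {j : ℕ} (hj1 : 1 ≤ j) (hj2 : j + 1 ≤ n) {G : ℕ → ℕ → ℝ}
    (hG : ∀ a b : ℕ, G a b = (volume {x | ∃ y ∈ convexHull ℝ (A : Set (Fin n → ℝ)), ∃ z ∈ convexHull ℝ (B : Set (Fin n → ℝ)),
      x = ((a:ℝ) + b * δ) • y + ((a:ℝ) * δ + b) • z}).toReal) :
    Mx n G (j - 1) * Mx n G (j + 1) ≤ Mx n G j ^ 2 := by
  obtain ⟨ι, _, _, W, α, β, hrep⟩ := poly_rep A B hA hB
  have hb : Bdd W Finset.univ := by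
    intro x hx
    obtain ⟨a, _, b, _, h⟩ := (hrep 0 0 le_rfl le_rfl x).1 (fun i hi => by simpa using hx i hi)
    simpa using h
  have hα : ∀ x, x ∈ PP W Finset.univ α ↔ x ∈ convexHull ℝ (A : Set (Fin n → ℝ)) := by
    intro x
    have := hrep 1 0 zero_le_one le_rfl x
    rw [one_smul, zero_smul, add_zero] at this
    rw [this]
    constructor
    · rintro ⟨a, ha, b, hb, rfl⟩; simpa using ha
    · intro h
      obtain ⟨b, hb⟩ := hB
      exact ⟨x, h, b, subset_convexHull _ _ hb, by simp⟩
  have hβ : ∀ x, x ∈ PP W Finset.univ β ↔ x ∈ convexHull ℝ (B : Set (Fin n → ℝ)) := by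
    intro x
    have := hrep 0 1 le_rfl zero_le_one x
    rw [one_smul, zero_smul, zero_add] at this
    rw [this]
    constructor
    · rintro ⟨a, ha, b, hb, rfl⟩; simpa using hb
    · intro h
      obtain ⟨b, hb⟩ := hA
      exact ⟨b, subset_convexHull _ _ hb, x, h, by simp⟩
  obtain ⟨g, hg, hev⟩ := perturb hb (α := α) (β := β) (fun s t hs ht x hx => by
    obtain ⟨a, ha, b, hb, h⟩ := (hrep s t hs ht x).1 hx
    exact ⟨a, (hα a).2 ha, b, (hβ b).2 hb, h⟩) hδ
  have hlim : ∀ a b : ℕ, Filter.Tendsto (fun ε : ℝ => vF W Finset.univ ((a:ℝ) • (α + δ • β + ε • g) + (b:ℝ) • (δ • α + β + ε • g)))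
      (nhdsWithin 0 (Set.Ioi 0)) (nhds (G a b)) := by
    intro a b
    have h1 := vF_rc hb (g := ((a:ℝ) + b) • g) (fun i => by have := (hg i).le; simp only [Pi.smul_apply, smul_eq_mul]; positivity)
      (((a:ℝ) + b * δ) • α + ((a:ℝ) * δ + b) • β)
    have h2 : vF W Finset.univ (((a:ℝ) + b * δ) • α + ((a:ℝ) * δ + b) • β) = G a b := by
      rw [hG, vF]
      congr 2
      ext x
      exact hrep _ _ (by positivity) (by positivity) x
    rw [h2] at h1
    refine h1.congr fun ε => ?_
    congr 1
    ext i; simp only [Pi.add_apply, Pi.smul_apply, smul_eq_mul]; ring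
  refine le_of_tendsto_of_tendsto ((Mx_lim hlim).mul (Mx_lim hlim)) ((Mx_lim hlim).pow 2) ?_
  filter_upwards [hev] with ε hε
  exact seg_ineq hb hε hj1 hj2
end Pert
end PartP10

section PartP11
open MeasureTheory
open scoped Pointwise

section Body
variable {n : ℕ}

lemma approx {K : Set (Fin n → ℝ)} (hc : IsCompact K) (hv : Convex ℝ K) (hne : K.Nonempty) {η : ℝ} (hη : 0 < η) :
    ∃ A : Finset (Fin n → ℝ), A.Nonempty ∧ K ⊆ convexHull ℝ (A : Set (Fin n → ℝ)) ∧
      ∀ x ∈ convexHull ℝ (A : Set (Fin n → ℝ)), ∃ y ∈ K, dist x y ≤ η := by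
  obtain ⟨t, htK, htf, hcov⟩ := hc.finite_cover_balls hη
  set V : (Fin n → ℝ) → Set (Fin n → ℝ) := fun c => Set.pi Set.univ fun i => {c i - η, c i + η} with hV
  have hVf : (⋃ c ∈ t, V c).Finite := htf.biUnion fun c _ => Set.Finite.pi fun i => Set.toFinite _
  have hhull : ∀ c, convexHull ℝ (V c) = Metric.closedBall c η := by
    intro c
    rw [hV, convexHull_pi, closedBall_pi c hη.le]
    congr 1
    funext i
    rw [convexHull_pair, segment_eq_Icc (by linarith), Real.closedBall_eq_Icc]
  have hsub : K ⊆ convexHull ℝ (⋃ c ∈ t, V c) := by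
    intro x hx
    obtain ⟨c, hct, hxc⟩ := Set.mem_iUnion₂.1 (hcov hx)
    refine convexHull_mono (Set.subset_biUnion_of_mem hct) ?_
    rw [hhull]
    exact Metric.ball_subset_closedBall hxc
  refine ⟨hVf.toFinset, ?_, ?_, ?_⟩
  · have : (convexHull ℝ (⋃ c ∈ t, V c)).Nonempty := hne.mono hsub
    rw [convexHull_nonempty_iff] at this
    simpa using this
  · simpa using hsub
  · intro x hx
    rw [Set.Finite.coe_toFinset] at hx
    have h1 : x ∈ Metric.cthickening η K := by
      refine convexHull_min ?_ (hv.cthickening η) hx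
      refine Set.iUnion₂_subset fun c hct y hy => ?_
      have : y ∈ Metric.closedBall c η := by rw [← hhull]; exact subset_convexHull _ _ hy
      exact Metric.mem_cthickening_of_dist_le y c η K (htK hct) this
    rw [hc.cthickening_eq_biUnion_closedBall hη.le] at h1
    obtain ⟨y, hy, hxy⟩ := Set.mem_iUnion₂.1 h1
    exact ⟨y, hy, hxy⟩

def XX (K L : Set (Fin n → ℝ)) (s t : ℝ) : Set (Fin n → ℝ) := {x | ∃ y ∈ K, ∃ z ∈ L, x = s • y + t • z}

lemma XX_compact {K L : Set (Fin n → ℝ)} (hK : IsCompact K) (hL : IsCompact L) (s t : ℝ) : IsCompact (XX K L s t) := by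
  have : XX K L s t = (fun z : (Fin n → ℝ) × (Fin n → ℝ) => s • z.1 + t • z.2) '' (K ×ˢ L) := by
    ext x; constructor
    · rintro ⟨y, hy, z, hz, rfl⟩; exact ⟨(y, z), ⟨hy, hz⟩, rfl⟩
    · rintro ⟨⟨y, z⟩, ⟨hy, hz⟩, rfl⟩; exact ⟨y, hy, z, hz, rfl⟩
  rw [this]
  exact (hK.prod hL).image (by fun_prop)

lemma shrink {K : Set (Fin n → ℝ)} (hv : Convex ℝ K) (h0 : (0 : Fin n → ℝ) ∈ K) {s s' : ℝ} (hs : 0 ≤ s) (hss : s ≤ s')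
    {y : Fin n → ℝ} (hy : y ∈ K) : ∃ y' ∈ K, s • y = s' • y' := by
  rcases (hs.trans hss).eq_or_lt with h | h
  · have : s = 0 := by linarith
    exact ⟨0, h0, by simp [this]⟩
  · refine ⟨(s / s') • y, hv.smul_mem_of_zero_mem h0 hy ⟨by positivity, (div_le_one h).2 hss⟩, ?_⟩
    rw [smul_smul, mul_div_cancel₀ _ h.ne']

lemma body0 {K L : Set (Fin n → ℝ)} (hKc : IsCompact K) (hKv : Convex ℝ K) (hK0 : (0 : Fin n → ℝ) ∈ K)
    (hLc : IsCompact L) (hLv : Convex ℝ L) (hL0 : (0 : Fin n → ℝ) ∈ L) {j : ℕ} (hj1 : 1 ≤ j) (hj2 : j + 1 ≤ n) {G : ℕ → ℕ → ℝ}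
    (hG : ∀ a b : ℕ, G a b = (volume (XX K L a b)).toReal) :
    Mx n G (j - 1) * Mx n G (j + 1) ≤ Mx n G j ^ 2 := by
  have hAe : ∀ η : ℝ, ∃ A : Finset (Fin n → ℝ), 0 < η → A.Nonempty ∧ K ⊆ convexHull ℝ (A : Set (Fin n → ℝ)) ∧
      ∀ x ∈ convexHull ℝ (A : Set (Fin n → ℝ)), ∃ y ∈ K, dist x y ≤ η := fun η => by
    by_cases h : 0 < η
    · obtain ⟨A, hA⟩ := approx hKc hKv ⟨0, hK0⟩ h; exact ⟨A, fun _ => hA⟩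
    · exact ⟨∅, fun h' => absurd h' h⟩
  have hBe : ∀ η : ℝ, ∃ A : Finset (Fin n → ℝ), 0 < η → A.Nonempty ∧ L ⊆ convexHull ℝ (A : Set (Fin n → ℝ)) ∧
      ∀ x ∈ convexHull ℝ (A : Set (Fin n → ℝ)), ∃ y ∈ L, dist x y ≤ η := fun η => by
    by_cases h : 0 < η
    · obtain ⟨A, hA⟩ := approx hLc hLv ⟨0, hL0⟩ h; exact ⟨A, fun _ => hA⟩
    · exact ⟨∅, fun h' => absurd h' h⟩
  choose A hA using hAe
  choose B hB using hBe
  obtain ⟨M1, hM1⟩ := hKc.isBounded.exists_norm_le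
  obtain ⟨M2, hM2⟩ := hLc.isBounded.exists_norm_le
  have hM1p : 0 ≤ M1 := (norm_nonneg _).trans (hM1 0 hK0)
  have hM2p : 0 ≤ M2 := (norm_nonneg _).trans (hM2 0 hL0)
  set Y : ℝ → ℕ → ℕ → Set (Fin n → ℝ) := fun η a b => XX (convexHull ℝ (A η : Set (Fin n → ℝ))) (convexHull ℝ (B η : Set (Fin n → ℝ)))
    ((a:ℝ) + b * η) ((a:ℝ) * η + b) with hY
  have hlim : ∀ a b : ℕ, Filter.Tendsto (fun η : ℝ => (volume (Y η a b)).toReal) (nhdsWithin 0 (Set.Ioi 0)) (nhds (G a b)) := by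
    intro a b
    rw [hG]
    refine (ENNReal.tendsto_toReal (XX_compact hKc hLc a b).measure_lt_top.ne).comp ?_
    set c : ℝ := (a + b) * (2 + M1 + M2) with hc
    have hup : Filter.Tendsto (fun η : ℝ => volume (Metric.cthickening (c * η) (XX K L a b))) (nhdsWithin 0 (Set.Ioi 0))
        (nhds (volume (XX K L a b))) := by
      have h1 := tendsto_measure_cthickening_of_isCompact (μ := (volume : Measure (Fin n → ℝ))) (XX_compact hKc hLc a b)
      have h2 : Filter.Tendsto (fun η : ℝ => c * η) (nhdsWithin 0 (Set.Ioi 0)) (nhds 0) := by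
        have : Continuous fun η : ℝ => c * η := by fun_prop
        simpa using (this.tendsto 0).mono_left nhdsWithin_le_nhds
      exact h1.comp h2
    refine tendsto_of_tendsto_of_tendsto_of_le_of_le' tendsto_const_nhds hup ?_ ?_
    · filter_upwards [self_mem_nhdsWithin] with η (hη : 0 < η)
      refine measure_mono ?_
      rintro x ⟨y, hy, z, hz, rfl⟩
      obtain ⟨_, hKA, _⟩ := hA η hη
      obtain ⟨_, hLB, _⟩ := hB η hη
      have p1 : (0:ℝ) ≤ b * η := by positivity
      have p2 : (0:ℝ) ≤ a * η := by positivity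
      obtain ⟨y', hy', e1⟩ := shrink (convex_convexHull ℝ _) (hKA hK0) (s := a) (s' := (a:ℝ) + b * η) (by positivity) (by linarith) (hKA hy)
      obtain ⟨z', hz', e2⟩ := shrink (convex_convexHull ℝ _) (hLB hL0) (s := b) (s' := (a:ℝ) * η + b) (by positivity) (by linarith) (hLB hz)
      exact ⟨y', hy', z', hz', by rw [e1, e2]⟩
    · filter_upwards [self_mem_nhdsWithin, nhdsWithin_le_nhds (gt_mem_nhds (show (0:ℝ) < 1 from one_pos))] with η hη hη1
      have hη : 0 < η := hη
      refine measure_mono ?_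
      rintro x ⟨y, hy, z, hz, rfl⟩
      obtain ⟨y0, hy0, dy⟩ := (hA η hη).2.2 y hy
      obtain ⟨z0, hz0, dz⟩ := (hB η hη).2.2 z hz
      refine Metric.mem_cthickening_of_dist_le _ ((a:ℝ) • y0 + (b:ℝ) • z0) _ _ ⟨y0, hy0, z0, hz0, rfl⟩ ?_
      rw [dist_eq_norm] at dy dz ⊢
      have ny : ‖y‖ ≤ M1 + 1 := by
        have := norm_add_le (y - y0) y0
        rw [sub_add_cancel] at this
        linarith [hM1 y0 hy0]
      have nz : ‖z‖ ≤ M2 + 1 := by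
        have := norm_add_le (z - z0) z0
        rw [sub_add_cancel] at this
        linarith [hM2 z0 hz0]
      have e : ((a:ℝ) + b * η) • y + ((a:ℝ) * η + b) • z - ((a:ℝ) • y0 + (b:ℝ) • z0) =
          (a:ℝ) • (y - y0) + ((b:ℝ) * η) • y + (b:ℝ) • (z - z0) + ((a:ℝ) * η) • z := by
        simp only [add_smul, smul_sub]; abel
      rw [e]
      refine (norm_add_le _ _).trans ((add_le_add_left (norm_add₃_le) _).trans ?_)
      simp only [norm_smul, norm_mul, Real.norm_natCast, Real.norm_eq_abs, Nat.abs_cast, abs_of_pos hη]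
      have q1 : (a:ℝ) * ‖y - y0‖ ≤ a * η := by gcongr
      have q2 : (b:ℝ) * η * ‖y‖ ≤ b * η * (M1 + 1) := by gcongr
      have q3 : (b:ℝ) * ‖z - z0‖ ≤ b * η := by gcongr
      have q4 : (a:ℝ) * η * ‖z‖ ≤ a * η * (M2 + 1) := by gcongr
      have r1 : 0 ≤ (a:ℝ) * η * M1 := by positivity
      have r2 : 0 ≤ (b:ℝ) * η * M2 := by positivity
      rw [hc]
      nlinarith
  refine le_of_tendsto_of_tendsto ((Mx_lim hlim).mul (Mx_lim hlim)) ((Mx_lim hlim).pow 2) ?_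
  filter_upwards [self_mem_nhdsWithin] with η (hη : 0 < η)
  exact poly_case (A η) (B η) (hA η hη).1 (hB η hη).1 hη hj1 hj2 fun a b => rfl

lemma body {K L : Set (Fin n → ℝ)} (hKc : IsCompact K) (hKv : Convex ℝ K) (hK0 : K.Nonempty)
    (hLc : IsCompact L) (hLv : Convex ℝ L) (hL0 : L.Nonempty) {j : ℕ} (hj1 : 1 ≤ j) (hj2 : j + 1 ≤ n) {G : ℕ → ℕ → ℝ}
    (hG : ∀ a b : ℕ, G a b = (volume (XX K L a b)).toReal) :
    Mx n G (j - 1) * Mx n G (j + 1) ≤ Mx n G j ^ 2 := by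
  obtain ⟨k, hk⟩ := hK0
  obtain ⟨l, hl⟩ := hL0
  refine body0 (K := (fun x => x + -k) '' K) (L := (fun x => x + -l) '' L) (hKc.image (by fun_prop)) ?_ ⟨k, hk, by simp⟩
    (hLc.image (by fun_prop)) ?_ ⟨l, hl, by simp⟩ hj1 hj2 (G := G) ?_
  · simpa only [add_comm] using hKv.translate (-k)
  · simpa only [add_comm] using hLv.translate (-l)
  · intro a b
    rw [hG]
    have : XX ((fun x => x + -k) '' K) ((fun x => x + -l) '' L) a b =
        (fun x => x + ((a:ℝ) • k + (b:ℝ) • l)) ⁻¹' XX K L a b := by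
      ext x
      constructor
      · rintro ⟨_, ⟨y, hy, rfl⟩, _, ⟨z, hz, rfl⟩, rfl⟩
        refine ⟨y, hy, z, hz, ?_⟩
        simp only [smul_add, smul_neg]; abel
      · rintro ⟨y, hy, z, hz, h⟩
        refine ⟨_, ⟨y, hy, rfl⟩, _, ⟨z, hz, rfl⟩, ?_⟩
        rw [← eq_sub_iff_add_eq] at h
        rw [h]; simp only [smul_add, smul_neg]; abel
    rw [this, measure_preimage_add_right]
end Body
end PartP11

open scoped Pointwise
open MeasureTheory Finset

section Link
variable {n : ℕ}
lemma nsmul_set {K : Set (Fin n → ℝ)} (hv : Convex ℝ K) (hne : K.Nonempty) (a : ℕ) : a • K = (a : ℝ) • K := by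
  induction a with
  | zero => rw [zero_nsmul, Nat.cast_zero, Set.zero_smul_set hne]
  | succ a ih => rw [succ_nsmul, ih, Nat.cast_succ, hv.add_smul (by positivity) zero_le_one, one_smul]

lemma sum_set {K L : Set (Fin n → ℝ)} (hKv : Convex ℝ K) (hK0 : K.Nonempty) (hLv : Convex ℝ L) (hL0 : L.Nonempty) (m : ℕ)
    (S : Finset (Fin n)) : ∑ i ∈ S, (if (i : ℕ) < m then K else L) =
      XX K L ((S.filter fun i : Fin n => (i : ℕ) < m).card : ℕ) ((S.filter fun i : Fin n => ¬ (i : ℕ) < m).card : ℕ) := by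
  rw [Finset.sum_ite, Finset.sum_const, Finset.sum_const, nsmul_set hKv hK0, nsmul_set hLv hL0]
  ext x
  constructor
  · rintro ⟨_, ⟨y, hy, rfl⟩, _, ⟨z, hz, rfl⟩, rfl⟩
    exact ⟨y, hy, z, hz, rfl⟩
  · rintro ⟨y, hy, z, hz, rfl⟩
    exact ⟨_, ⟨y, hy, rfl⟩, _, ⟨z, hz, rfl⟩, rfl⟩

lemma mvKL_eq {K L : Set (Fin n → ℝ)} (hKv : Convex ℝ K) (hK0 : K.Nonempty) (hLv : Convex ℝ L) (hL0 : L.Nonempty) (m : ℕ)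
    (hn : 0 < n) : mvKL n K L m = Mx n (fun a b => (volume (XX K L a b)).toReal) m := by
  unfold mvKL MV Mx
  rw [Finset.sum_powerset]
  have hc : (Finset.univ : Finset (Fin n)).card = n := by simp
  rw [hc, Finset.range_eq_Ico, Finset.sum_eq_sum_Ico_succ_bot (by omega)]
  have h0 : ∑ S ∈ Finset.powersetCard 0 (Finset.univ : Finset (Fin n)), (-1 : ℝ) ^ (S.card + n) *
      (volume (XX K L ((S.filter fun i : Fin n => (i : ℕ) < m).card : ℕ) ((S.filter fun i : Fin n => ¬ (i : ℕ) < m).card : ℕ))).toReal = 0 := by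
    rw [Finset.powersetCard_zero, Finset.sum_singleton]
    have : XX K L ((((∅ : Finset (Fin n)).filter fun i : Fin n => (i : ℕ) < m).card : ℕ) : ℝ) ((((∅ : Finset (Fin n)).filter fun i : Fin n => ¬ (i : ℕ) < m).card : ℕ) : ℝ) ⊆ {0} := by
      rintro x ⟨y, _, z, _, rfl⟩
      simp
    have hne : Nonempty (Fin n) := ⟨⟨0, hn⟩⟩
    rw [measure_mono_null this (measure_singleton _)]
    simp
  rw [h0, zero_add]
  refine Finset.sum_congr ?_ fun j hj => ?_
  · ext j; simp only [Finset.mem_Icc, Finset.mem_Ico]; omega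
  rw [Finset.mul_sum]
  refine Finset.sum_congr rfl fun S hS => ?_
  rw [sum_set hKv hK0 hLv hL0, vol, (Finset.mem_powersetCard.1 hS).2]
  congr 1
  have hj' : j ≤ n := by have := Finset.mem_Ico.1 hj; omega
  obtain ⟨d, rfl⟩ := Nat.exists_eq_add_of_le hj'
  rw [Nat.add_sub_cancel_left, ← add_assoc, pow_add, ← two_mul, pow_mul]
  simp
end Link

/-- Log-concavity example: for nonempty compact convex sets `K, L ⊆ ℝⁿ` and `1 ≤ j ≤ n−1`,
`MV(K^{(j−1)}, L^{(n−j+1)}) · MV(K^{(j+1)}, L^{(n−j−1)}) ≤ MV(K^{(j)}, L^{(n−j)})²`;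
in particular, when these mixed volumes are positive, the sequence
`b_j = log MV(K^{(j)}, L^{(n−j)})` satisfies `b_{j−1} + b_{j+1} ≤ 2·b_j`. -/
theorem mixed_volume_log_concave {n j : ℕ} (hj1 : 1 ≤ j) (hj2 : j ≤ n - 1)
    (K L : Set (Fin n → ℝ))
    (hKne : K.Nonempty) (hKc : IsCompact K) (hKcv : Convex ℝ K)
    (hLne : L.Nonempty) (hLc : IsCompact L) (hLcv : Convex ℝ L) :
    mvKL n K L (j - 1) * mvKL n K L (j + 1) ≤ mvKL n K L j ^ 2 ∧
      (0 < mvKL n K L (j - 1) → 0 < mvKL n K L j → 0 < mvKL n K L (j + 1) →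
        Real.log (mvKL n K L (j - 1)) + Real.log (mvKL n K L (j + 1)) ≤
          2 * Real.log (mvKL n K L j)) := by
  have main : mvKL n K L (j - 1) * mvKL n K L (j + 1) ≤ mvKL n K L j ^ 2 := by
    have hn : 0 < n := by omega
    rw [mvKL_eq hKcv hKne hLcv hLne _ hn, mvKL_eq hKcv hKne hLcv hLne _ hn, mvKL_eq hKcv hKne hLcv hLne _ hn]
    exact body hKc hKcv hKne hLc hLcv hLne hj1 (by omega) fun a b => rfl
  refine ⟨main, fun h1 h2 h3 => ?_⟩
  rw [← Real.log_mul h1.ne' h3.ne', ← Nat.cast_two, ← Real.log_pow]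
  exact Real.log_le_log (mul_pos h1 h3) main
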